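/- arXiv:2211.02515 — 3 statements merged into one kernel-verified Lean document; each statement's English description precedes it below -/
import Mathlib

section
/- There is a positive absolute constant C such that the following holds. If Assumption (A) holds, then there exists a real number ρ̃ with L(ρ̃,χ) = 0, ρ̃ < 1, 1 − ρ̃ ≤ C·𝓛^{-2022}, ρ̃ is a simple zero of L(s,χ) (i.e. L'(ρ̃,χ) ≠ 0), and L(s,χ) has no zero other than ρ̃ in the region {s : Re s > 1 − 2𝓛^{-1}, |Im s| < 2D}. -/
open scoped Classical

noncomputable section

/-- The Dirichlet L-function of `χ` (extended to modulus `0` by `0`, a case never used below). -/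
def Lfun {N : ℕ} (χ : DirichletCharacter ℂ N) (s : ℂ) : ℂ :=
  if h : N = 0 then 0
  else
    haveI : NeZero N := ⟨h⟩
    DirichletCharacter.LFunction χ s

/-- A Dirichlet character is *real* if all of its values are real numbers. -/
def IsRealChar {N : ℕ} (χ : DirichletCharacter ℂ N) : Prop :=
  ∀ a : ZMod N, (χ a).im = 0

/-- `𝓛 = log D`. -/
def bigL (D : ℕ) : ℝ := Real.log D

/-- `P = exp (𝓛 ^ 9)`. -/
def bigP (D : ℕ) : ℝ := Real.exp (bigL D ^ 9)

/-- Assumption (A): `L(1, χ) < 𝓛 ^ (-2022)`. -/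
def AssumptionA (D : ℕ) (χ : DirichletCharacter ℂ D) : Prop :=
  (Lfun χ 1).re < bigL D ^ (-2022 : ℤ)

/-- `p ~ P`, i.e. `p` is a prime with `P < p < P * (1 + 𝓛 ^ (-68))`. -/
def SimP (D p : ℕ) : Prop :=
  p.Prime ∧ bigP D < (p : ℝ) ∧ (p : ℝ) < bigP D * (1 + bigL D ^ (-68 : ℤ))

/-- The finite set of primes `p ~ P`. -/
def primesP (D : ℕ) : Finset ℕ :=
  (Finset.range ⌈2 * bigP D⌉₊).filter (SimP D)

/-- `𝒫 = ∑_{p ~ P} p`. -/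
def calP (D : ℕ) : ℝ := ∑ p ∈ primesP D, (p : ℝ)

/-- `ν(n) = ∑_{d ∣ n} χ(d)`. -/
def nuF (D : ℕ) (χ : DirichletCharacter ℂ D) (n : ℕ) : ℂ :=
  ∑ d ∈ n.divisors, χ (d : ZMod D)

/-- `υ(n) = ∑_{ab = n} μ(a) μ(b) χ(b)`. -/
def upsF (D : ℕ) (χ : DirichletCharacter ℂ D) (n : ℕ) : ℂ :=
  ∑ d ∈ n.divisors,
    ((ArithmeticFunction.moebius (n / d) : ℤ) : ℂ) * ((ArithmeticFunction.moebius d : ℤ) : ℂ) *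
      χ (d : ZMod D)

/-- `t₀ = 𝓛 ^ 519`. -/
def t0 (D : ℕ) : ℝ := bigL D ^ 519

/-- `s₀ = 1/2 + 2 π i t₀`. -/
def s0 (D : ℕ) : ℂ := 1 / 2 + 2 * (Real.pi : ℂ) * Complex.I * (t0 D : ℂ)

/-- `𝓛₁ = 𝓛 ^ 405`. -/
def bigL1 (D : ℕ) : ℝ := bigL D ^ 405

/-- `ν` truncated to `n ≤ D ^ 4`, as an arithmetic function. -/
def nuT (D : ℕ) (χ : DirichletCharacter ℂ D) : ArithmeticFunction ℂ :=
  ⟨fun n => if n = 0 then 0 else if n ≤ D ^ 4 then nuF D χ n else 0, by simp⟩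

/-- `υ` truncated to `n ≤ D ^ 4`, as an arithmetic function. -/
def upsT (D : ℕ) (χ : DirichletCharacter ℂ D) : ArithmeticFunction ℂ :=
  ⟨fun n => if n = 0 then 0 else if n ≤ D ^ 4 then upsF D χ n else 0, by simp⟩

/-- `ν₂₀`, the 20-fold Dirichlet convolution of the truncation of `ν`. -/
def nu20 (D : ℕ) (χ : DirichletCharacter ℂ D) (n : ℕ) : ℂ := (nuT D χ ^ 20) n

/-- `υ₂₀`, the 20-fold Dirichlet convolution of the truncation of `υ`. -/
def ups20 (D : ℕ) (χ : DirichletCharacter ℂ D) (n : ℕ) : ℂ := (upsT D χ ^ 20) n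

/-- `ς(n) = ∑_{lm = n, l ≤ D⁴, m ≤ D⁴} ν(l) υ(m)`. -/
def sigF (D : ℕ) (χ : DirichletCharacter ℂ D) (n : ℕ) : ℂ :=
  ∑ d ∈ n.divisors,
    if d ≤ D ^ 4 ∧ n / d ≤ D ^ 4 then nuF D χ d * upsF D χ (n / d) else 0

/-- `X₁(x, ψ) = ∑_{n ≤ x} ν₂₀(n) ψ(n) n^{-s₀}`. -/
def X1 (D : ℕ) (χ : DirichletCharacter ℂ D) {p : ℕ} (ψ : DirichletCharacter ℂ p) (x : ℝ) : ℂ :=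
  ∑ n ∈ Finset.Icc 1 ⌊x⌋₊, nu20 D χ n * ψ (n : ZMod p) * (n : ℂ) ^ (-s0 D)

/-- `X₂(x, ψ) = ∑_{n ≤ x} υ₂₀(n) ψ(n) n^{-s₀}`. -/
def X2 (D : ℕ) (χ : DirichletCharacter ℂ D) {p : ℕ} (ψ : DirichletCharacter ℂ p) (x : ℝ) : ℂ :=
  ∑ n ∈ Finset.Icc 1 ⌊x⌋₊, ups20 D χ n * ψ (n : ZMod p) * (n : ℂ) ^ (-s0 D)

/-- `X₃(x, ψ) = ∑_{D⁴ < n ≤ x} ν(n) ψ(n) n^{-s₀}`. -/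
def X3 (D : ℕ) (χ : DirichletCharacter ℂ D) {p : ℕ} (ψ : DirichletCharacter ℂ p) (x : ℝ) : ℂ :=
  ∑ n ∈ Finset.Ioc (D ^ 4) ⌊x⌋₊, nuF D χ n * ψ (n : ZMod p) * (n : ℂ) ^ (-s0 D)

/-- `X₄(x, ψ) = ∑_{D⁴ < n ≤ x} ς(n) ψ(n) n^{-s₀}`. -/
def X4 (D : ℕ) (χ : DirichletCharacter ℂ D) {p : ℕ} (ψ : DirichletCharacter ℂ p) (x : ℝ) : ℂ :=
  ∑ n ∈ Finset.Ioc (D ^ 4) ⌊x⌋₊, sigF D χ n * ψ (n : ZMod p) * (n : ℂ) ^ (-s0 D)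

/-- Inequality (3.4). -/
def Ineq1 (D : ℕ) (χ : DirichletCharacter ℂ D) {p : ℕ} (ψ : DirichletCharacter ℂ p) : Prop :=
  ‖X1 D χ ψ ((D : ℝ) ^ 80)‖ + ‖X2 D χ ψ ((D : ℝ) ^ 80)‖ +
      (∫ x in (1 : ℝ)..((D : ℝ) ^ 80), (‖X1 D χ ψ x‖ + ‖X2 D χ ψ x‖) / x) <
    bigL D ^ 1171

/-- Inequality (3.5). -/
def Ineq2 (D : ℕ) (χ : DirichletCharacter ℂ D) {p : ℕ} (ψ : DirichletCharacter ℂ p) : Prop :=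
  ‖X3 D χ ψ (bigP D ^ 2)‖ + (∫ x in ((D : ℝ) ^ 4)..(bigP D ^ 2), ‖X3 D χ ψ x‖ / x) <
    bigL D ^ (-585 : ℤ)

/-- Inequality (3.6). -/
def Ineq3 (D : ℕ) (χ : DirichletCharacter ℂ D) {p : ℕ} (ψ : DirichletCharacter ℂ p) : Prop :=
  ‖X4 D χ ψ ((D : ℝ) ^ 8)‖ + (∫ x in ((D : ℝ) ^ 4)..((D : ℝ) ^ 8), ‖X4 D χ ψ x‖ / x) <
    bigL D ^ (-633 : ℤ)

/-- Membership in `Ψ₁`: `ψ` is a primitive character mod `p` with `p ~ P` satisfying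
(3.4), (3.5) and (3.6). -/
def MemPsi1 (D : ℕ) (χ : DirichletCharacter ℂ D) {p : ℕ} (ψ : DirichletCharacter ℂ p) : Prop :=
  SimP D p ∧ ψ.IsPrimitive ∧ Ineq1 D χ ψ ∧ Ineq2 D χ ψ ∧ Ineq3 D χ ψ

/-- `F(s, ψ) = ∑_{n ≤ D⁴} ν(n) ψ(n) n^{-s}`. -/
def Ffun (D : ℕ) (χ : DirichletCharacter ℂ D) {p : ℕ} (ψ : DirichletCharacter ℂ p) (s : ℂ) : ℂ :=
  ∑ n ∈ Finset.Icc 1 (D ^ 4), nuF D χ n * ψ (n : ZMod p) * (n : ℂ) ^ (-s)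

/-- `G(s, ψ) = ∑_{n ≤ D⁴} υ(n) ψ(n) n^{-s}`. -/
def Gfun (D : ℕ) (χ : DirichletCharacter ℂ D) {p : ℕ} (ψ : DirichletCharacter ℂ p) (s : ℂ) : ℂ :=
  ∑ n ∈ Finset.Icc 1 (D ^ 4), upsF D χ n * ψ (n : ZMod p) * (n : ℂ) ^ (-s)

/-- `F'(s, ψ) = -∑_{n ≤ D⁴} ν(n) ψ(n) (log n) n^{-s}`, the derivative of `F` in `s`. -/
def Ffun' (D : ℕ) (χ : DirichletCharacter ℂ D) {p : ℕ} (ψ : DirichletCharacter ℂ p) (s : ℂ) : ℂ :=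
  -∑ n ∈ Finset.Icc 1 (D ^ 4),
    nuF D χ n * ψ (n : ZMod p) * ((Real.log n : ℝ) : ℂ) * (n : ℂ) ^ (-s)

/-- `F(1 - s, ψ̄) = ∑_{n ≤ D⁴} ν(n) conj(ψ(n)) n^{s - 1}`, as a function of `s`. -/
def FfunBar (D : ℕ) (χ : DirichletCharacter ℂ D) {p : ℕ} (ψ : DirichletCharacter ℂ p)
    (s : ℂ) : ℂ :=
  ∑ n ∈ Finset.Icc 1 (D ^ 4),
    nuF D χ n * (starRingEnd ℂ) (ψ (n : ZMod p)) * (n : ℂ) ^ (s - 1)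

/-- The region `Ω`. -/
def InOmega (D : ℕ) (s : ℂ) : Prop :=
  |(s - s0 D).re| < 1 / 2 ∧ |(s - s0 D).im| < bigL1 D + 2

/-- The region `Ω₁`. -/
def InOmega1 (D : ℕ) (s : ℂ) : Prop :=
  1 / 2 - Real.log (bigL D) / (100 * bigL D) < s.re ∧
    s.re < 1 + Real.log (bigL D) / (100 * bigL D) ∧
    |s.im - 2 * Real.pi * t0 D| < bigL1 D + 5

/-- The region `Ω₂`. -/
def InOmega2 (D : ℕ) (s : ℂ) : Prop :=
  1 / 2 - (bigL D)⁻¹ < s.re ∧ s.re < 1 + (bigL D)⁻¹ ∧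
    |s.im - 2 * Real.pi * t0 D| < bigL1 D + 4

/-- `α = π / log P`. -/
def alphaD (D : ℕ) : ℝ := Real.pi / Real.log (bigP D)

/-- The region `Ω₃`. -/
def InOmega3 (D : ℕ) (s : ℂ) : Prop :=
  1 / 2 - alphaD D < s.re ∧ s.re < 1 + alphaD D ∧
    |s.im - 2 * Real.pi * t0 D| < bigL1 D + 3

/-- The Gauss sum `τ(θ) = ∑_{a mod k} θ(a) e(a/k)`. -/
def tauSum {k : ℕ} (θ : DirichletCharacter ℂ k) : ℂ :=
  ∑ a ∈ Finset.range k,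
    θ (a : ZMod k) * Complex.exp (2 * (Real.pi : ℂ) * Complex.I * (a : ℂ) / (k : ℂ))

/-- The factor `Z(s, θ)` from the functional equation. -/
def Zfun {k : ℕ} (θ : DirichletCharacter ℂ k) (s : ℂ) : ℂ :=
  if θ (-1) = 1 then
    tauSum θ * (Real.pi : ℂ) ^ (s - 1 / 2) * (k : ℂ) ^ (-s) *
      Complex.Gamma ((1 - s) / 2) / Complex.Gamma (s / 2)
  else
    -Complex.I * tauSum θ * (Real.pi : ℂ) ^ (s - 1 / 2) * (k : ℂ) ^ (-s) *
      Complex.Gamma ((2 - s) / 2) / Complex.Gamma ((1 + s) / 2)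

/-- The product character `χψ` modulo `D * p`, i.e. `n ↦ χ(n) ψ(n)`. -/
def chiPsi (D : ℕ) (χ : DirichletCharacter ℂ D) {p : ℕ} (ψ : DirichletCharacter ℂ p) :
    DirichletCharacter ℂ (D * p) :=
  DirichletCharacter.changeLevel (dvd_mul_right D p) χ *
    DirichletCharacter.changeLevel (dvd_mul_left p D) ψ

/-- `Z̃(s, ψ) = Z(s, ψ) Z(s, χψ)`. -/
def Ztilde (D : ℕ) (χ : DirichletCharacter ℂ D) {p : ℕ} (ψ : DirichletCharacter ℂ p)
    (s : ℂ) : ℂ :=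
  Zfun ψ s * Zfun (chiPsi D χ ψ) s

/-- `T = exp (𝓛 ^ 1.1)`. -/
def bigT (D : ℕ) : ℝ := Real.exp (bigL D ^ (1.1 : ℝ))

/-- `P₄ = P T⁻² t₀`. -/
def P4 (D : ℕ) : ℝ := bigP D * bigT D ^ (-2 : ℤ) * t0 D

/-- The smooth weight `g(x) = π^{-1/2} ∫_{-∞}^{𝓛^{15} log x} e^{-u²} du`. -/
def gfun (D : ℕ) (x : ℝ) : ℝ :=
  Real.pi ^ (-(1 : ℝ) / 2) * ∫ u in Set.Iio (bigL D ^ 15 * Real.log x), Real.exp (-u ^ 2)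

/-- `g*(y) = g(y)` for `y > 1/2`, and `0` otherwise. -/
def gstar (D : ℕ) (y : ℝ) : ℝ := if 1 / 2 < y then gfun D y else 0

/-- `K(s, ψ) = ∑_n ψ(n) n^{-s} g*(P₄ / n)`. -/
def Kfun (D : ℕ) {p : ℕ} (ψ : DirichletCharacter ℂ p) (s : ℂ) : ℂ :=
  ∑' n : ℕ, ψ (n : ZMod p) * (n : ℂ) ^ (-s) * ((gstar D (P4 D / n) : ℝ) : ℂ)

/-- `N(1 - s, ψ̄) = ∑_n conj(ψ(n)) n^{s-1} g*(T² / n)`, as a function of `s`. -/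
def Nfun (D : ℕ) {p : ℕ} (ψ : DirichletCharacter ℂ p) (s : ℂ) : ℂ :=
  ∑' n : ℕ,
    (starRingEnd ℂ) (ψ (n : ZMod p)) * (n : ℂ) ^ (s - 1) * ((gstar D (bigT D ^ 2 / n) : ℝ) : ℂ)

/-- `𝔞 = (6/π²) L'(1,χ)² ∏_{q ∣ D} q/(q+1)`. -/
def fraka (D : ℕ) (χ : DirichletCharacter ℂ D) : ℂ :=
  6 / (Real.pi : ℂ) ^ 2 * deriv (Lfun χ) 1 ^ 2 * ∏ q ∈ D.primeFactors, (q : ℂ) / ((q : ℂ) + 1)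

/-- Truncated remainder function of the partial sums of `a`. -/
def remE (a : ℕ → ℂ) (c : ℂ) (N : ℕ) (t : ℝ) : ℂ :=
  if (N : ℝ) < t then
    (∑ k ∈ Finset.Icc 1 ⌊t⌋₊, a k) - (∑ k ∈ Finset.Icc 1 N, a k) - c * ((t : ℂ) - N)
  else 0

lemma remE_bound {a : ℕ → ℂ} {c : ℂ} {K θ : ℝ} (hK : 0 ≤ K) (hθ : 0 ≤ θ)
    (h : ∀ x : ℝ, 1 ≤ x → ‖(∑ k ∈ Finset.Icc 1 ⌊x⌋₊, a k) - c * x‖ ≤ K * x ^ θ)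
    {N : ℕ} (hN : 1 ≤ N) {t : ℝ} (ht : 0 < t) : ‖remE a c N t‖ ≤ 2 * K * t ^ θ := by
  unfold remE
  split_ifs with hlt
  · have hN1 : (1 : ℝ) ≤ N := by exact_mod_cast hN
    have h1 := h t (hN1.trans hlt.le)
    have h2 := h N hN1
    rw [Nat.floor_natCast] at h2
    have h3 : (N : ℝ) ^ θ ≤ t ^ θ := Real.rpow_le_rpow (by positivity) hlt.le hθ
    have h4 : K * (N : ℝ) ^ θ ≤ K * t ^ θ := mul_le_mul_of_nonneg_left h3 hK
    calc _ = ‖((∑ k ∈ Finset.Icc 1 ⌊t⌋₊, a k) - c * t) - ((∑ k ∈ Finset.Icc 1 N, a k) - c * (N : ℝ))‖ := by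
            congr 1; push_cast; ring
      _ ≤ K * t ^ θ + K * (N : ℝ) ^ θ := (norm_sub_le _ _).trans (add_le_add h1 h2)
      _ ≤ _ := by linarith
  · simp; positivity

lemma remE_measurable (a : ℕ → ℂ) (c : ℂ) (N : ℕ) : Measurable (remE a c N) := by
  unfold remE
  refine Measurable.ite measurableSet_Ioi ?_ measurable_const
  have : Measurable (fun t : ℝ => ∑ k ∈ Finset.Icc 1 ⌊t⌋₊, a k) :=
    (measurable_from_nat (f := fun n : ℕ => ∑ k ∈ Finset.Icc 1 n, a k)).comp Nat.measurable_floor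
  fun_prop

lemma remE_locInt {a : ℕ → ℂ} {c : ℂ} {K θ : ℝ} (hK : 0 ≤ K) (hθ : 0 ≤ θ)
    (h : ∀ x : ℝ, 1 ≤ x → ‖(∑ k ∈ Finset.Icc 1 ⌊x⌋₊, a k) - c * x‖ ≤ K * x ^ θ)
    {N : ℕ} (hN : 1 ≤ N) : MeasureTheory.LocallyIntegrableOn (remE a c N) (Set.Ioi 0) := by
  have h1 : MeasureTheory.LocallyIntegrableOn (fun t : ℝ => 2 * K * t ^ θ) (Set.Ioi 0) := by
    apply ContinuousOn.locallyIntegrableOn _ measurableSet_Ioi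
    exact continuousOn_const.mul (continuousOn_id.rpow_const (fun x hx => Or.inr hθ))
  rw [MeasureTheory.locallyIntegrableOn_iff isOpen_Ioi.isLocallyClosed] at h1 ⊢
  intro k hk hkc
  refine MeasureTheory.Integrable.mono' (h1 k hk hkc)
    (remE_measurable a c N).aestronglyMeasurable ?_
  refine MeasureTheory.ae_restrict_of_forall_mem hkc.measurableSet ?_
  intro t ht
  exact remE_bound hK hθ h hN (hk ht)

lemma remE_bigO_top {a : ℕ → ℂ} {c : ℂ} {K θ : ℝ} (hK : 0 ≤ K) (hθ : 0 ≤ θ)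
    (h : ∀ x : ℝ, 1 ≤ x → ‖(∑ k ∈ Finset.Icc 1 ⌊x⌋₊, a k) - c * x‖ ≤ K * x ^ θ)
    {N : ℕ} (hN : 1 ≤ N) : remE a c N =O[Filter.atTop] (fun t : ℝ => t ^ (-(-θ))) := by
  rw [neg_neg]
  apply Asymptotics.IsBigO.of_bound (2 * K)
  filter_upwards [Filter.eventually_gt_atTop 0] with t ht
  rw [Real.norm_of_nonneg (by positivity)]
  exact remE_bound hK hθ h hN ht

lemma remE_bigO_bot (a : ℕ → ℂ) (c : ℂ) {N : ℕ} (hN : 1 ≤ N) (b : ℝ) :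
    remE a c N =O[nhdsWithin 0 (Set.Ioi 0)] (fun t : ℝ => t ^ b) := by
  have : remE a c N =ᶠ[nhdsWithin 0 (Set.Ioi 0)] 0 := by
    have : ∀ᶠ t : ℝ in nhds 0, t < 1 := gt_mem_nhds one_pos
    filter_upwards [nhdsWithin_le_nhds this] with t ht
    have : (1 : ℝ) ≤ N := by exact_mod_cast hN
    simp only [remE, Pi.zero_apply, ite_eq_right_iff]
    intro; linarith
  exact this.trans_isBigO (Asymptotics.isBigO_zero _ _)


lemma remE_mellin_diff {a : ℕ → ℂ} {c : ℂ} {K θ : ℝ} (hK : 0 ≤ K) (hθ : 0 ≤ θ)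
    (h : ∀ x : ℝ, 1 ≤ x → ‖(∑ k ∈ Finset.Icc 1 ⌊x⌋₊, a k) - c * x‖ ≤ K * x ^ θ)
    {N : ℕ} (hN : 1 ≤ N) {s : ℂ} (hs : θ < s.re) :
    DifferentiableAt ℂ (fun s => mellin (remE a c N) (-s)) s := by
  have : DifferentiableAt ℂ (mellin (remE a c N)) (-s) :=
    mellin_differentiableAt_of_isBigO_rpow (a := -θ) (b := -s.re - 1) (remE_locInt hK hθ h hN)
      (remE_bigO_top hK hθ h hN) (by simpa using hs) (remE_bigO_bot a c hN _) (by simp)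
  exact this.comp s differentiableAt_id.neg

lemma remE_mellinConv {a : ℕ → ℂ} {c : ℂ} {K θ : ℝ} (hK : 0 ≤ K) (hθ : 0 ≤ θ)
    (h : ∀ x : ℝ, 1 ≤ x → ‖(∑ k ∈ Finset.Icc 1 ⌊x⌋₊, a k) - c * x‖ ≤ K * x ^ θ)
    {N : ℕ} (hN : 1 ≤ N) {s : ℂ} (hs : θ < s.re) : MellinConvergent (remE a c N) (-s) :=
    mellinConvergent_of_isBigO_rpow (a := -θ) (b := -s.re - 1) (remE_locInt hK hθ h hN)
      (remE_bigO_top hK hθ h hN) (by simpa using hs) (remE_bigO_bot a c hN _) (by simp)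

lemma remE_mellin_eq (a : ℕ → ℂ) (c : ℂ) (N : ℕ) (s : ℂ) : mellin (remE a c N) (-s) =
    ∫ t in Set.Ioi (N : ℝ), (t : ℂ) ^ (-s - 1) * remE a c N t := by
  unfold mellin
  simp only [smul_eq_mul]
  apply MeasureTheory.setIntegral_eq_of_subset_of_forall_sdiff_eq_zero measurableSet_Ioi
  · exact Set.Ioi_subset_Ioi (by positivity)
  · intro x hx
    have : ¬ (N : ℝ) < x := hx.2
    simp [remE, this]

lemma remE_mellin_bound {a : ℕ → ℂ} {c : ℂ} {K θ : ℝ} (hK : 0 ≤ K) (hθ : 0 ≤ θ)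
    (h : ∀ x : ℝ, 1 ≤ x → ‖(∑ k ∈ Finset.Icc 1 ⌊x⌋₊, a k) - c * x‖ ≤ K * x ^ θ)
    {N : ℕ} (hN : 1 ≤ N) {s : ℂ} (hs : θ < s.re) :
    ‖mellin (remE a c N) (-s)‖ ≤ 2 * K * (N : ℝ) ^ (θ - s.re) / (s.re - θ) := by
  rw [remE_mellin_eq]
  have hN0 : (0 : ℝ) < N := by exact_mod_cast hN
  have hi : ∫ t in Set.Ioi (N : ℝ), 2 * K * t ^ (θ - s.re - 1) =
      2 * K * (N : ℝ) ^ (θ - s.re) / (s.re - θ) := by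
    rw [MeasureTheory.integral_const_mul, integral_Ioi_rpow_of_lt (by linarith) hN0,
      sub_add_cancel, mul_div_assoc]
    congr 1
    rw [← neg_sub s.re θ, div_neg]; ring
  rw [← hi]
  apply MeasureTheory.norm_integral_le_of_norm_le
  · exact (integrableOn_Ioi_rpow_of_lt (by linarith) hN0).const_mul _
  · filter_upwards [MeasureTheory.ae_restrict_mem measurableSet_Ioi] with t ht
    have ht0 : 0 < t := hN0.trans ht
    rw [norm_mul, Complex.norm_cpow_eq_rpow_re_of_pos ht0]
    calc _ ≤ t ^ (-s - 1).re * (2 * K * t ^ θ) := by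
          gcongr; exact remE_bound hK hθ h hN ht0
      _ = _ := by
          rw [show θ - s.re - 1 = (-s-1).re + θ by simp; ring, Real.rpow_add ht0]; ring

lemma remE_LSeries {a : ℕ → ℂ} {c : ℂ} {K θ : ℝ} (hK : 0 ≤ K) (hθ : 0 ≤ θ)
    (h : ∀ x : ℝ, 1 ≤ x → ‖(∑ k ∈ Finset.Icc 1 ⌊x⌋₊, a k) - c * x‖ ≤ K * x ^ θ)
    {N : ℕ} (hN : 1 ≤ N) (hθ1 : θ ≤ 1) {s : ℂ} (hs : 1 < s.re) (hS : LSeriesSummable a s) :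
    LSeries a s - ∑ n ∈ Finset.Icc 1 N, a n * (n : ℂ) ^ (-s) - c * (N : ℂ) ^ (1 - s) / (s - 1) =
      s * mellin (remE a c N) (-s) := by
  have hN0 : (0 : ℝ) < N := by exact_mod_cast hN
  have hN1 : (1 : ℝ) ≤ N := by exact_mod_cast hN
  set b : ℕ → ℂ := fun n => if n ≤ N then 0 else a n with hb
  have hHa : HasSum (LSeries.term a s) (LSeries a s) := hS.hasSum
  have hF : HasSum (fun n => if n ∈ Finset.Icc 1 N then LSeries.term a s n else 0)
      (∑ n ∈ Finset.Icc 1 N, a n * (n : ℂ) ^ (-s)) := by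
    have : HasSum (fun n => if n ∈ Finset.Icc 1 N then LSeries.term a s n else 0)
        (∑ n ∈ Finset.Icc 1 N, if n ∈ Finset.Icc 1 N then LSeries.term a s n else 0) :=
      hasSum_sum_of_ne_finset_zero (fun n hn => if_neg hn)
    convert this using 1
    apply Finset.sum_congr rfl
    intro n hn
    have : n ≠ 0 := by have := (Finset.mem_Icc.1 hn).1; omega
    simp only [hn, if_true, LSeries.term_of_ne_zero this]
    rw [Complex.cpow_neg, div_eq_mul_inv]
  have hHb : HasSum (LSeries.term b s) (LSeries a s - ∑ n ∈ Finset.Icc 1 N, a n * (n : ℂ) ^ (-s)) := by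
    refine (hHa.sub hF).congr_fun ?_
    intro n
    rcases Nat.eq_zero_or_pos n with rfl | hn
    · simp
    · by_cases hnN : n ≤ N
      · have : n ∈ Finset.Icc 1 N := Finset.mem_Icc.2 ⟨hn, hnN⟩
        simp [LSeries.term_of_ne_zero hn.ne', this, hb, hnN]
      · simp [LSeries.term_of_ne_zero hn.ne', hb, hnN]
  have hsum : ∀ n : ℕ, N ≤ n → ∑ k ∈ Finset.Icc 1 n, b k =
      (∑ k ∈ Finset.Icc 1 n, a k) - ∑ k ∈ Finset.Icc 1 N, a k := by
    intro n hn
    induction n, hn using Nat.le_induction with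
    | base =>
      rw [sub_self]; apply Finset.sum_eq_zero
      intro k hk; simp [hb, (Finset.mem_Icc.1 hk).2]
    | succ n hn ih =>
      rw [Finset.sum_Icc_succ_top (by omega), Finset.sum_Icc_succ_top (by omega), ih]
      have : ¬ (n + 1 ≤ N) := by omega
      simp only [hb, this, if_false]; ring
  have hsum0 : ∀ n : ℕ, n ≤ N → ∑ k ∈ Finset.Icc 1 n, b k = 0 := by
    intro n hn
    apply Finset.sum_eq_zero
    intro k hk; simp [hb, (Finset.mem_Icc.1 hk).2.trans hn]
  have hO : (fun n ↦ ∑ k ∈ Finset.Icc 1 n, b k) =O[Filter.atTop] fun n ↦ (n : ℝ) ^ (1 : ℝ) := by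
    apply Asymptotics.IsBigO.of_bound (‖c‖ + K + ‖∑ k ∈ Finset.Icc 1 N, a k‖)
    filter_upwards [Filter.eventually_ge_atTop N] with n hn
    rw [hsum n hn]
    have hn1 : (1 : ℝ) ≤ n := by exact_mod_cast hN.trans hn
    have h1 := h n hn1
    rw [Nat.floor_natCast] at h1
    have h2 : (n : ℝ) ^ θ ≤ n := by
      simpa using Real.rpow_le_rpow_of_exponent_le hn1 hθ1
    have h3 : ‖∑ k ∈ Finset.Icc 1 n, a k‖ ≤ K * n + ‖c‖ * n := by
      calc _ = ‖((∑ k ∈ Finset.Icc 1 n, a k) - c * (n : ℝ)) + c * (n : ℝ)‖ := by congr 1; ring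
        _ ≤ K * (n : ℝ) ^ θ + ‖c * (n : ℝ)‖ := (norm_add_le _ _).trans (by gcongr)
        _ ≤ _ := by
          rw [norm_mul]; simp only [Complex.norm_real, Real.norm_natCast]; gcongr
    rw [Real.rpow_one, Real.norm_natCast]
    calc _ ≤ (K * n + ‖c‖ * n) + ‖∑ k ∈ Finset.Icc 1 N, a k‖ * 1 := by
            rw [mul_one]; exact (norm_sub_le _ _).trans (by gcongr)
      _ ≤ (K * n + ‖c‖ * n) + ‖∑ k ∈ Finset.Icc 1 N, a k‖ * n := by gcongr
      _ = _ := by ring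
  have key := LSeries_eq_mul_integral b zero_le_one hs hHb.summable hO
  rw [show LSeries b s = _ from hHb.tsum_eq] at key
  have hs0 : s - 1 ≠ 0 := by
    intro h0; have := congrArg Complex.re h0; simp at this; linarith
  have hs00 : s ≠ 0 := by
    intro h0; have := congrArg Complex.re h0; simp at this; linarith
  rw [key, remE_mellin_eq]
  have e1 : ∫ t in Set.Ioi (1 : ℝ), (∑ k ∈ Finset.Icc 1 ⌊t⌋₊, b k) * (t : ℂ) ^ (-(s + 1)) =
      ∫ t in Set.Ioi (N : ℝ), (∑ k ∈ Finset.Icc 1 ⌊t⌋₊, b k) * (t : ℂ) ^ (-(s + 1)) := by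
    apply MeasureTheory.setIntegral_eq_of_subset_of_forall_sdiff_eq_zero measurableSet_Ioi
    · exact Set.Ioi_subset_Ioi hN1
    · intro x hx
      have hxN : x ≤ N := not_lt.1 hx.2
      rw [hsum0 _ (by rw [← Nat.floor_natCast (R := ℝ) N]; exact Nat.floor_le_floor hxN), zero_mul]
  have e2 : ∫ t in Set.Ioi (N : ℝ), (∑ k ∈ Finset.Icc 1 ⌊t⌋₊, b k) * (t : ℂ) ^ (-(s + 1)) =
      ∫ t in Set.Ioi (N : ℝ), ((t : ℂ) ^ (-s - 1) * remE a c N t +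
        (c * (t : ℂ) ^ (-s) - c * N * (t : ℂ) ^ (-s - 1))) := by
    apply MeasureTheory.setIntegral_congr_fun measurableSet_Ioi
    intro t ht
    have ht' : (N : ℝ) < t := ht
    have ht0 : (t : ℂ) ≠ 0 := by exact_mod_cast (hN0.trans ht').ne'
    simp only [remE, ht', if_true]
    rw [hsum _ (Nat.le_floor ht'.le)]
    have : (t : ℂ) ^ (-s) = (t : ℂ) ^ (-s - 1) * t := by
      rw [Complex.cpow_sub _ _ ht0, Complex.cpow_one]; field_simp
    rw [this, show -(s + 1) = -s - 1 by ring]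
    ring
  have i0 : MeasureTheory.IntegrableOn (fun t : ℝ => (t : ℂ) ^ (-s - 1) * remE a c N t) (Set.Ioi (N : ℝ)) := by
    have := remE_mellinConv hK hθ h hN (s := s) (by linarith)
    exact MeasureTheory.IntegrableOn.mono_set this (Set.Ioi_subset_Ioi hN0.le)
  have i1 : MeasureTheory.IntegrableOn (fun t : ℝ => (t : ℂ) ^ (-s)) (Set.Ioi (N : ℝ)) :=
    integrableOn_Ioi_cpow_of_lt (by simpa using hs) hN0
  have i2 : MeasureTheory.IntegrableOn (fun t : ℝ => (t : ℂ) ^ (-s - 1)) (Set.Ioi (N : ℝ)) :=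
    integrableOn_Ioi_cpow_of_lt (by simp; linarith) hN0
  have i3 : MeasureTheory.IntegrableOn (fun t : ℝ => c * (t : ℂ) ^ (-s) - c * N * (t : ℂ) ^ (-s - 1))
      (Set.Ioi (N : ℝ)) := (i1.const_mul c).sub (i2.const_mul (c * N))
  rw [e1, e2, MeasureTheory.integral_add i0 i3,
    MeasureTheory.integral_sub (i1.const_mul c) (i2.const_mul (c * N)),
    MeasureTheory.integral_const_mul, MeasureTheory.integral_const_mul,
    integral_Ioi_cpow_of_lt (by simpa using hs) hN0,
    integral_Ioi_cpow_of_lt (by simp; linarith) hN0]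
  have hNc : (N : ℂ) ≠ 0 := by exact_mod_cast hN0.ne'
  have hp : (N : ℂ) ^ (1 - s) = (N : ℂ) ^ (-s) * N := by
    rw [sub_eq_neg_add, Complex.cpow_add _ _ hNc, Complex.cpow_one]
  rw [sub_add_cancel, show -s + 1 = 1 - s by ring]
  simp only [Complex.ofReal_natCast]
  rw [hp]
  have : (1 - s) ≠ 0 := by rw [← neg_sub]; exact neg_ne_zero.2 hs0
  field_simp
  ring

lemma half_plane_identity {θ : ℝ} (hθ1 : θ ≤ 1) {f g : ℂ → ℂ}
    (hf : ∀ s : ℂ, θ < s.re → DifferentiableAt ℂ f s)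
    (hg : ∀ s : ℂ, θ < s.re → DifferentiableAt ℂ g s)
    (hfg : ∀ s : ℂ, 1 < s.re → f s = g s) {s : ℂ} (hs : θ < s.re) : f s = g s := by
  have hopen : IsOpen {s : ℂ | θ < s.re} := isOpen_lt continuous_const Complex.continuous_re
  have hpre : IsPreconnected {s : ℂ | θ < s.re} := (convex_halfSpace_re_gt θ).isPreconnected
  have hfa : AnalyticOnNhd ℂ f {s : ℂ | θ < s.re} :=
    DifferentiableOn.analyticOnNhd (fun s hs => (hf s hs).differentiableWithinAt) hopen
  have hga : AnalyticOnNhd ℂ g {s : ℂ | θ < s.re} :=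
    DifferentiableOn.analyticOnNhd (fun s hs => (hg s hs).differentiableWithinAt) hopen
  refine hfa.eqOn_of_preconnected_of_eventuallyEq hga hpre (z₀ := 2) ?_ ?_ hs
  · show θ < (2 : ℂ).re
    simp; linarith
  · have : {s : ℂ | 1 < s.re} ∈ nhds (2 : ℂ) :=
      (isOpen_lt continuous_const Complex.continuous_re).mem_nhds (by simp)
    filter_upwards [this] with s hs using hfg s hs

lemma differentiableAt_natcpow (N : ℕ) (hN : 1 ≤ N) (w : ℂ → ℂ) (s : ℂ) (hw : DifferentiableAt ℂ w s) :
    DifferentiableAt ℂ (fun s => (N : ℂ) ^ (w s)) s := by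
  apply DifferentiableAt.const_cpow hw
  left; exact_mod_cast (by omega : N ≠ 0)

lemma differentiableAt_dpoly (a : ℕ → ℂ) (N : ℕ) (s : ℂ) :
    DifferentiableAt ℂ (fun s : ℂ => ∑ n ∈ Finset.Icc 1 N, a n * (n : ℂ) ^ (-s)) s := by
  apply DifferentiableAt.fun_sum
  intro n hn
  exact (differentiableAt_natcpow n (Finset.mem_Icc.1 hn).1 _ s differentiableAt_id.neg).const_mul _

/-- Approximation lemma without a pole. -/
lemma approx_entire {a : ℕ → ℂ} {K θ : ℝ} (hK : 0 ≤ K) (hθ : 0 ≤ θ) (hθ1 : θ ≤ 1)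
    (h : ∀ x : ℝ, 1 ≤ x → ‖(∑ k ∈ Finset.Icc 1 ⌊x⌋₊, a k)‖ ≤ K * x ^ θ)
    {N : ℕ} (hN : 1 ≤ N) {f : ℂ → ℂ} (hf : ∀ s : ℂ, θ < s.re → DifferentiableAt ℂ f s)
    (hS : ∀ s : ℂ, 1 < s.re → LSeriesSummable a s)
    (hfs : ∀ s : ℂ, 1 < s.re → f s = LSeries a s) {s : ℂ} (hs : θ < s.re) :
    ‖f s - ∑ n ∈ Finset.Icc 1 N, a n * (n : ℂ) ^ (-s)‖ ≤
      ‖s‖ * (2 * K * (N : ℝ) ^ (θ - s.re) / (s.re - θ)) := by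
  have h' : ∀ x : ℝ, 1 ≤ x → ‖(∑ k ∈ Finset.Icc 1 ⌊x⌋₊, a k) - 0 * x‖ ≤ K * x ^ θ := by
    simpa using h
  have := half_plane_identity hθ1 (f := fun s => f s - ∑ n ∈ Finset.Icc 1 N, a n * (n : ℂ) ^ (-s))
    (g := fun s => s * mellin (remE a 0 N) (-s)) ?_ ?_ ?_ hs
  · rw [this, norm_mul]
    gcongr
    exact remE_mellin_bound hK hθ h' hN hs
  · intro s hs
    exact (hf s hs).sub (differentiableAt_dpoly a N s)
  · intro s hs
    exact differentiableAt_id.mul (remE_mellin_diff hK hθ h' hN hs)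
  · intro s hs
    have := remE_LSeries hK hθ h' hN hθ1 hs (hS s hs)
    simp only [zero_mul, zero_div, sub_zero] at this
    rw [hfs s hs, this]

/-- Approximation lemma with a possible pole at `1`. -/
lemma approx_pole {a : ℕ → ℂ} {c : ℂ} {K θ : ℝ} (hK : 0 ≤ K) (hθ : 0 ≤ θ) (hθ1 : θ ≤ 1)
    (h : ∀ x : ℝ, 1 ≤ x → ‖(∑ k ∈ Finset.Icc 1 ⌊x⌋₊, a k) - c * x‖ ≤ K * x ^ θ)
    {N : ℕ} (hN : 1 ≤ N) {f g : ℂ → ℂ} (hg : ∀ s : ℂ, θ < s.re → DifferentiableAt ℂ g s)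
    (hfg : ∀ s : ℂ, s ≠ 1 → g s = (s - 1) * f s)
    (hS : ∀ s : ℂ, 1 < s.re → LSeriesSummable a s)
    (hfs : ∀ s : ℂ, 1 < s.re → f s = LSeries a s) {s : ℂ} (hs : θ < s.re) (hs1 : s ≠ 1) :
    ‖f s - ∑ n ∈ Finset.Icc 1 N, a n * (n : ℂ) ^ (-s) - c * (N : ℂ) ^ (1 - s) / (s - 1)‖ ≤
      ‖s‖ * (2 * K * (N : ℝ) ^ (θ - s.re) / (s.re - θ)) := by
  have hs0 : s - 1 ≠ 0 := sub_ne_zero.2 hs1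
  have := half_plane_identity hθ1
    (f := fun s => g s - (s - 1) * (∑ n ∈ Finset.Icc 1 N, a n * (n : ℂ) ^ (-s)) - c * (N : ℂ) ^ (1 - s))
    (g := fun s => (s - 1) * (s * mellin (remE a c N) (-s))) ?_ ?_ ?_ hs
  · rw [hfg s hs1] at this
    have e : f s - ∑ n ∈ Finset.Icc 1 N, a n * (n : ℂ) ^ (-s) - c * (N : ℂ) ^ (1 - s) / (s - 1)
        = s * mellin (remE a c N) (-s) := by
      apply mul_left_cancel₀ hs0
      rw [← this]; field_simp
    rw [e, norm_mul]
    gcongr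
    exact remE_mellin_bound hK hθ h hN hs
  · intro s hs
    refine ((hg s hs).sub ((differentiableAt_id.sub_const 1).mul (differentiableAt_dpoly a N s))).sub ?_
    exact (differentiableAt_natcpow N hN _ s (differentiableAt_id.const_sub 1)).const_mul _
  · intro s hs
    exact (differentiableAt_id.sub_const 1).mul (differentiableAt_id.mul (remE_mellin_diff hK hθ h hN hs))
  · intro s hs
    have hs1 : s ≠ 1 := by rintro rfl; simp at hs
    have hs0 : s - 1 ≠ 0 := sub_ne_zero.2 hs1
    rw [hfg s hs1, hfs s hs, ← remE_LSeries hK hθ h hN hθ1 hs (hS s hs)]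
    field_simp

lemma sum_chi_range {D : ℕ} [NeZero D] {χ : DirichletCharacter ℂ D} (hχ : χ ≠ 1) (n : ℕ) :
    ‖∑ k ∈ Finset.range n, χ (k : ZMod D)‖ ≤ D := by
  induction n using Nat.strong_induction_on with
  | _ n ih =>
    rcases lt_or_ge n D with hn | hn
    · calc _ ≤ ∑ k ∈ Finset.range n, ‖χ (k : ZMod D)‖ := norm_sum_le _ _
        _ ≤ ∑ k ∈ Finset.range n, (1 : ℝ) := Finset.sum_le_sum fun k _ => χ.norm_le_one _
        _ ≤ D := by simp; exact_mod_cast hn.le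
    · obtain ⟨m, rfl⟩ := Nat.exists_eq_add_of_le hn
      have hfull : ∑ k ∈ Finset.range D, χ (k : ZMod D) = 0 := by
        rw [← MulChar.sum_eq_zero_of_ne_one hχ]
        refine Finset.sum_bij (fun k _ => (k : ZMod D)) (fun _ _ => Finset.mem_univ _) ?_ ?_ (fun _ _ => rfl)
        · intro a ha b hb hab
          rw [ZMod.natCast_eq_natCast_iff] at hab
          exact Nat.ModEq.eq_of_lt_of_lt hab (Finset.mem_range.1 ha) (Finset.mem_range.1 hb)
        · intro b _
          exact ⟨b.val, Finset.mem_range.2 (ZMod.val_lt b), by simp⟩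
      rw [Finset.sum_range_add, hfull, zero_add]
      simp only [Nat.cast_add, CharP.cast_eq_zero, zero_add]
      exact ih m (by have := NeZero.pos D; omega)

lemma sum_chi_Icc {D : ℕ} [NeZero D] {χ : DirichletCharacter ℂ D} (hχ : χ ≠ 1) (n : ℕ) :
    ‖∑ k ∈ Finset.Icc 1 n, χ (k : ZMod D)‖ ≤ 2 * D := by
  have := sum_chi_range hχ (n + 1)
  rw [Finset.range_eq_Ico, Finset.sum_eq_sum_Ico_succ_bot (by omega)] at this
  have h1 : Finset.Ico (0 + 1) (n + 1) = Finset.Icc 1 n := by ext; simp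
  rw [h1] at this
  have h2 : ‖χ ((0 : ℕ) : ZMod D)‖ ≤ D := (χ.norm_le_one _).trans (by exact_mod_cast NeZero.pos D)
  calc _ = ‖(χ ((0 : ℕ) : ZMod D) + ∑ k ∈ Finset.Icc 1 n, χ (k : ZMod D)) - χ ((0 : ℕ) : ZMod D)‖ := by
        congr 1; ring
    _ ≤ D + D := (norm_sub_le _ _).trans (add_le_add this h2)
    _ = _ := by ring

lemma approx_L {D : ℕ} [NeZero D] {χ : DirichletCharacter ℂ D} (hχ : χ ≠ 1) {N : ℕ} (hN : 1 ≤ N)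
    {s : ℂ} (hs : 0 < s.re) :
    ‖χ.LFunction s - ∑ n ∈ Finset.Icc 1 N, χ (n : ZMod D) * (n : ℂ) ^ (-s)‖ ≤
      ‖s‖ * (4 * D * (N : ℝ) ^ (- s.re) / s.re) := by
  have := approx_entire (a := fun n : ℕ => χ (n : ZMod D)) (K := 2 * D) (θ := 0) (by positivity) le_rfl zero_le_one
    (fun x hx => by simpa using sum_chi_Icc hχ ⌊x⌋₊) hN (f := χ.LFunction)
    (fun s _ => DirichletCharacter.differentiable_LFunction hχ s)
    (fun s hs => DirichletCharacter.LSeriesSummable_of_one_lt_re χ hs)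
    (fun s hs => DirichletCharacter.LFunction_eq_LSeries χ hs) hs
  refine this.trans (le_of_eq ?_)
  simp; left; ring

lemma abel_antitone {c : ℕ → ℂ} {f : ℕ → ℝ} {B : ℝ} {y : ℕ}
    (hc : ∀ n, y ≤ n → ‖∑ k ∈ Finset.Ioc y n, c k‖ ≤ B)
    (hf : ∀ n, y < n → f (n + 1) ≤ f n) {n : ℕ} (hn : y + 1 ≤ n) :
    ‖(∑ k ∈ Finset.Ioc y n, c k * f k) - f n * ∑ k ∈ Finset.Ioc y n, c k‖ ≤ B * (f (y + 1) - f n) := by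
  induction n, hn using Nat.le_induction with
  | base => simp; ring_nf; try simp
  | succ n hn ih =>
    rw [Finset.sum_Ioc_succ_top (by omega), Finset.sum_Ioc_succ_top (by omega)]
    set X := ∑ k ∈ Finset.Ioc y n, c k * (f k : ℂ)
    set C := ∑ k ∈ Finset.Ioc y n, c k with hC
    have h1 := hf n (by omega)
    have h2 := hc n (by omega)
    calc _ = ‖(X - f n * C) + ((f n - f (n + 1) : ℝ) : ℂ) * C‖ := by congr 1; push_cast; ring
      _ ≤ B * (f (y + 1) - f n) + (f n - f (n + 1)) * B := by
        refine (norm_add_le _ _).trans (add_le_add ih ?_)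
        rw [norm_mul, Complex.norm_real, Real.norm_of_nonneg (by linarith)]
        gcongr
      _ = _ := by ring

lemma abel_antitone' {c : ℕ → ℂ} {f : ℕ → ℝ} {B : ℝ} {y : ℕ} (hB : 0 ≤ B)
    (hc : ∀ n, y ≤ n → ‖∑ k ∈ Finset.Ioc y n, c k‖ ≤ B)
    (hf : ∀ n, y < n → f (n + 1) ≤ f n) (hf0 : ∀ n, 0 ≤ f n) {n : ℕ} (hn : y ≤ n) :
    ‖(∑ k ∈ Finset.Ioc y n, c k * f k)‖ ≤ B * f (y + 1) := by
  rcases hn.eq_or_lt with rfl | hn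
  · simp; exact mul_nonneg hB (hf0 _)
  · have h1 := abel_antitone hc hf hn
    have h2 := hc n hn.le
    calc _ = ‖((∑ k ∈ Finset.Ioc y n, c k * f k) - f n * ∑ k ∈ Finset.Ioc y n, c k) +
            f n * ∑ k ∈ Finset.Ioc y n, c k‖ := by congr 1; ring
      _ ≤ B * (f (y + 1) - f n) + f n * B := by
        refine (norm_add_le _ _).trans (add_le_add h1 ?_)
        rw [norm_mul, Complex.norm_real, Real.norm_of_nonneg (hf0 _)]
        gcongr; exact hf0 _
      _ = _ := by ring

lemma Icc_one_eq_Ioc (n : ℕ) : Finset.Icc 1 n = Finset.Ioc 0 n := by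
  ext; simp; omega

lemma sum_chi_Ioc {D : ℕ} [NeZero D] {χ : DirichletCharacter ℂ D} (hχ : χ ≠ 1) {y n : ℕ} (h : y ≤ n) :
    ‖∑ k ∈ Finset.Ioc y n, χ (k : ZMod D)‖ ≤ 4 * D := by
  have h1 := sum_chi_Icc hχ n
  have h2 := sum_chi_Icc hχ y
  rw [Icc_one_eq_Ioc] at h1 h2
  rw [← Finset.sum_Ioc_consecutive _ (Nat.zero_le y) h] at h1
  calc _ = ‖(∑ k ∈ Finset.Ioc 0 y, χ (k : ZMod D) + ∑ k ∈ Finset.Ioc y n, χ (k : ZMod D)) - ∑ k ∈ Finset.Ioc 0 y, χ (k : ZMod D)‖ := by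
        congr 1; ring
    _ ≤ 2 * D + 2 * D := (norm_sub_le _ _).trans (add_le_add h1 h2)
    _ = _ := by ring

lemma sum_nu_eq {D : ℕ} (χ : DirichletCharacter ℂ D) (n : ℕ) :
    ∑ k ∈ Finset.Icc 1 n, χ.zetaMul k = ∑ k ∈ Finset.Ioc 0 n, χ (k : ZMod D) * ((n / k : ℕ) : ℝ) := by
  rw [Icc_one_eq_Ioc, DirichletCharacter.zetaMul, mul_comm, ArithmeticFunction.sum_Ioc_mul_zeta_eq_sum]
  apply Finset.sum_congr rfl
  intro k hk
  have : k ≠ 0 := by have := (Finset.mem_Ioc.1 hk).1; omega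
  simp [toArithmeticFunction, this]

lemma approx_L_one {D : ℕ} [NeZero D] {χ : DirichletCharacter ℂ D} (hχ : χ ≠ 1) {N : ℕ} (hN : 1 ≤ N) :
    ‖χ.LFunction 1 - ∑ n ∈ Finset.Icc 1 N, χ (n : ZMod D) * ((n : ℝ)⁻¹ : ℝ)‖ ≤ 4 * D / N := by
  have := approx_L hχ hN (s := 1) (by simp)
  simp only [Complex.cpow_neg_one, norm_one, one_mul, Complex.one_re, div_one, Real.rpow_neg_one] at this
  push_cast
  rwa [div_eq_mul_inv]

lemma norm_L_one_le {D : ℕ} [NeZero D] {χ : DirichletCharacter ℂ D} (hχ : χ ≠ 1) :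
    ‖χ.LFunction 1‖ ≤ 5 * D := by
  have := approx_L_one hχ (N := 1) le_rfl
  simp at this
  have hD : (1 : ℝ) ≤ D := by exact_mod_cast NeZero.pos D
  calc _ = ‖(χ.LFunction 1 - 1) + 1‖ := by congr 1; ring
    _ ≤ 4 * D + 1 := (norm_add_le _ _).trans (by simpa using this)
    _ ≤ _ := by linarith

lemma sum_nu_nat {D : ℕ} [NeZero D] {χ : DirichletCharacter ℂ D} (hχ : χ ≠ 1) {n : ℕ} (hn : 1 ≤ n) :
    ‖(∑ k ∈ Finset.Icc 1 n, χ.zetaMul k) - χ.LFunction 1 * n‖ ≤ 13 * D * √n := by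
  have hD : (1 : ℝ) ≤ D := by exact_mod_cast NeZero.pos D
  set y := Nat.sqrt n with hy
  have hy1 : 1 ≤ y := Nat.sqrt_pos.2 hn
  have hyn : y ≤ n := Nat.sqrt_le_self n
  have hy2 : (y : ℝ) ≤ √n := Real.nat_sqrt_le_real_sqrt
  have hy3 : √n < y + 1 := Real.real_sqrt_lt_nat_sqrt_succ
  have hy1' : (1 : ℝ) ≤ y := by exact_mod_cast hy1
  have hn0 : (0 : ℝ) ≤ n := by positivity
  have hsq : √(n : ℝ) * √n = n := Real.mul_self_sqrt hn0
  have hs0 : 0 < √(n : ℝ) := by linarith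
  rw [sum_nu_eq, ← Finset.sum_Ioc_consecutive _ (Nat.zero_le y) hyn]
  have tail : ‖∑ k ∈ Finset.Ioc y n, χ (k : ZMod D) * (((n / k : ℕ) : ℝ) : ℂ)‖ ≤ 4 * D * √n := by
    have := abel_antitone' (c := fun k => χ (k : ZMod D)) (f := fun k => ((n / k : ℕ) : ℝ)) (B := 4 * D)
      (by positivity) (fun n hn => sum_chi_Ioc hχ hn)
      (fun k hk => by
        have : n / (k + 1) ≤ n / k := Nat.div_le_div_left (by omega) (by omega)
        exact_mod_cast this) (fun _ => by positivity) hyn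
    refine this.trans ?_
    gcongr
    refine Nat.cast_div_le.trans ?_
    rw [div_le_iff₀ (by positivity)]
    push_cast
    nlinarith
  have hfl : ‖∑ k ∈ Finset.Ioc 0 y, χ (k : ZMod D) * (((n / k : ℕ) : ℝ) : ℂ) -
      n * ∑ k ∈ Finset.Ioc 0 y, χ (k : ZMod D) * ((k : ℝ)⁻¹ : ℝ)‖ ≤ √n := by
    rw [Finset.mul_sum, ← Finset.sum_sub_distrib]
    refine (norm_sum_le _ _).trans ?_
    calc _ ≤ ∑ k ∈ Finset.Ioc 0 y, (1 : ℝ) := by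
          apply Finset.sum_le_sum
          intro k hk
          have hk0 : 0 < k := (Finset.mem_Ioc.1 hk).1
          have hk0' : (0 : ℝ) < k := by exact_mod_cast hk0
          have : χ (k : ZMod D) * (((n / k : ℕ) : ℝ) : ℂ) - n * (χ (k : ZMod D) * ((k : ℝ)⁻¹ : ℝ)) =
            χ (k : ZMod D) * ((((n / k : ℕ) : ℝ) - n / k : ℝ) : ℂ) := by
              push_cast; ring
          rw [this, norm_mul, Complex.norm_real, Real.norm_eq_abs]
          have h1 : ((n / k : ℕ) : ℝ) ≤ n / k := Nat.cast_div_le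
          have h2 : (n : ℝ) / k < (n / k : ℕ) + 1 := by
            rw [div_lt_iff₀ hk0']
            exact_mod_cast (by rw [mul_comm]; exact Nat.lt_mul_div_succ n hk0 : n < (n / k + 1) * k)
          have h3 : |((n / k : ℕ) : ℝ) - n / k| ≤ 1 := by rw [abs_le]; constructor <;> linarith
          calc _ ≤ 1 * 1 := mul_le_mul (χ.norm_le_one _) h3 (abs_nonneg _) zero_le_one
            _ = 1 := by ring
      _ = y := by simp
      _ ≤ _ := hy2
  have hL : ‖n * ∑ k ∈ Finset.Ioc 0 y, χ (k : ZMod D) * ((k : ℝ)⁻¹ : ℝ) - χ.LFunction 1 * n‖ ≤ 8 * D * √n := by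
    have := approx_L_one hχ hy1
    rw [Icc_one_eq_Ioc, norm_sub_rev] at this
    rw [mul_comm (χ.LFunction 1), ← mul_sub, norm_mul, Complex.norm_natCast]
    calc _ ≤ (n : ℝ) * (4 * D / y) := by gcongr
      _ ≤ _ := by
        rw [← mul_div_assoc, div_le_iff₀ (by positivity)]
        nlinarith [mul_nonneg (by linarith : (0 : ℝ) ≤ D) hs0.le, mul_le_mul_of_nonneg_left (by linarith : √(n : ℝ) ≤ 2 * y) (mul_nonneg (by linarith : (0 : ℝ) ≤ D) hs0.le)]
  calc _ = ‖(∑ k ∈ Finset.Ioc 0 y, χ (k : ZMod D) * (((n / k : ℕ) : ℝ) : ℂ) -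
      n * ∑ k ∈ Finset.Ioc 0 y, χ (k : ZMod D) * ((k : ℝ)⁻¹ : ℝ)) + (n * ∑ k ∈ Finset.Ioc 0 y, χ (k : ZMod D) * ((k : ℝ)⁻¹ : ℝ) - χ.LFunction 1 * n) + ∑ k ∈ Finset.Ioc y n, χ (k : ZMod D) * (((n / k : ℕ) : ℝ) : ℂ)‖ := by
        congr 1; ring
    _ ≤ √n + 8 * D * √n + 4 * D * √n := by
      refine (norm_add_le _ _).trans (add_le_add ((norm_add_le _ _).trans (add_le_add hfl hL)) tail)
    _ ≤ _ := by nlinarith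

lemma sum_nu_real {D : ℕ} [NeZero D] {χ : DirichletCharacter ℂ D} (hχ : χ ≠ 1) (x : ℝ) (hx : 1 ≤ x) :
    ‖(∑ k ∈ Finset.Icc 1 ⌊x⌋₊, χ.zetaMul k) - χ.LFunction 1 * x‖ ≤ 20 * D * x ^ (1 / 2 : ℝ) := by
  rw [← Real.sqrt_eq_rpow]
  have hD : (1 : ℝ) ≤ D := by exact_mod_cast NeZero.pos D
  have h1 := sum_nu_nat hχ (n := ⌊x⌋₊) (Nat.le_floor (by simpa using hx))
  have h2 : (⌊x⌋₊ : ℝ) ≤ x := Nat.floor_le (by linarith)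
  have h3 : x < ⌊x⌋₊ + 1 := Nat.lt_floor_add_one x
  have h4 : √(⌊x⌋₊ : ℝ) ≤ √x := Real.sqrt_le_sqrt h2
  have h5 : 1 ≤ √x := Real.one_le_sqrt.2 hx
  have h6 := norm_L_one_le hχ
  calc _ = ‖((∑ k ∈ Finset.Icc 1 ⌊x⌋₊, χ.zetaMul k) - χ.LFunction 1 * ⌊x⌋₊) - χ.LFunction 1 * ((x - ⌊x⌋₊ : ℝ) : ℂ)‖ := by
        congr 1; push_cast; ring
    _ ≤ 13 * D * √x + 5 * D * 1 := by
      refine (norm_sub_le _ _).trans (add_le_add (h1.trans (by gcongr)) ?_)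
      rw [norm_mul, Complex.norm_real, Real.norm_of_nonneg (by linarith)]
      apply mul_le_mul h6 (by linarith) (by linarith) (by positivity)
    _ ≤ _ := by nlinarith

lemma F_eq_LSeries_nu {D : ℕ} [NeZero D] (χ : DirichletCharacter ℂ D) {s : ℂ} (hs : 1 < s.re) :
    riemannZeta s * χ.LFunction s = LSeries χ.zetaMul s := by
  rw [DirichletCharacter.zetaMul, ← ArithmeticFunction.coe_mul, LSeries_convolution']
  · rw [χ.LFunction_eq_LSeries hs]
    congr 1
    · simp_rw [← ArithmeticFunction.LSeries_zeta_eq_riemannZeta hs, ← ArithmeticFunction.natCoe_apply]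
    · exact LSeries_congr χ.apply_eq_toArithmeticFunction_apply s
  · exact ArithmeticFunction.LSeriesSummable_zeta_iff.mpr hs
  · exact (LSeriesSummable_congr _ fun h ↦ (χ.apply_eq_toArithmeticFunction_apply h).symm).mpr <|
      ZMod.LSeriesSummable_of_one_lt_re χ hs

lemma approx_F {D : ℕ} [NeZero D] {χ : DirichletCharacter ℂ D} (hχ : χ ≠ 1) {N : ℕ} (hN : 1 ≤ N)
    {s : ℂ} (hs : 1 / 2 < s.re) (hs1 : s ≠ 1) :
    ‖riemannZeta s * χ.LFunction s - ∑ n ∈ Finset.Icc 1 N, χ.zetaMul n * (n : ℂ) ^ (-s)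
      - χ.LFunction 1 * (N : ℂ) ^ (1 - s) / (s - 1)‖ ≤
      ‖s‖ * (2 * (20 * D) * (N : ℝ) ^ (1 / 2 - s.re) / (s.re - 1 / 2)) := by
  refine approx_pole (f := fun s => riemannZeta s * χ.LFunction s)
    (g := fun s => DirichletCharacter.LFunctionTrivChar₁ 1 s * χ.LFunction s)
    (by positivity) (by norm_num) (by norm_num) (sum_nu_real hχ) hN ?_ ?_ ?_ ?_ hs hs1
  · intro s _
    exact (DirichletCharacter.differentiable_LFunctionTrivChar₁ 1 s).mul
      (DirichletCharacter.differentiable_LFunction hχ s)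
  · intro s hs
    rw [DirichletCharacter.LFunctionTrivChar₁, Function.update_of_ne hs, DirichletCharacter.LFunctionTrivChar_eq_mul_riemannZeta hs]
    simp; ring
  · intro s hs
    exact χ.LSeriesSummable_zetaMul hs
  · intro s hs
    exact F_eq_LSeries_nu χ hs

lemma chi_sq_of_real {D : ℕ} {χ : DirichletCharacter ℂ D} (h : ∀ a, (χ a).im = 0) : χ ^ 2 = 1 := by
  ext u
  have h1 := χ.unit_norm_eq_one u
  have h2 : χ u = ((χ u).re : ℂ) := by apply Complex.ext <;> simp [h]
  rw [h2, Complex.norm_real, Real.norm_eq_abs] at h1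
  rw [MulChar.pow_apply_coe, MulChar.one_apply_coe, h2, ← Complex.ofReal_pow, ← sq_abs, h1]
  simp

lemma chi_ne_one_of_prim {D : ℕ} [NeZero D] (hD : 2 ≤ D) {χ : DirichletCharacter ℂ D}
    (h : χ.IsPrimitive) : χ ≠ 1 := by
  rintro rfl
  have h1 : (1 : DirichletCharacter ℂ D).conductor = D := h
  rw [DirichletCharacter.conductor_one] at h1
  omega

/-- Twisting a Dirichlet convolution by a completely multiplicative function. -/
lemma mul_pmul_cm (f g h : ArithmeticFunction ℂ)
    (hh : ∀ m n : ℕ, m ≠ 0 → n ≠ 0 → h (m * n) = h m * h n) :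
    (f * g).pmul h = f.pmul h * g.pmul h := by
  ext n
  rw [ArithmeticFunction.pmul_apply, ArithmeticFunction.mul_apply, ArithmeticFunction.mul_apply,
    Finset.sum_mul]
  apply Finset.sum_congr rfl
  intro x hx
  rw [Nat.mem_divisorsAntidiagonal] at hx
  have h1 : x.1 ≠ 0 := by rintro h; simp [h] at hx; omega
  have h2 : x.2 ≠ 0 := by rintro h; simp [h] at hx; omega
  simp only [ArithmeticFunction.pmul_apply]
  rw [← hx.1, hh _ _ h1 h2]; ring

def chiA {D : ℕ} (χ : DirichletCharacter ℂ D) : ArithmeticFunction ℂ :=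
  toArithmeticFunction (χ ·)

lemma chiA_apply {D : ℕ} (χ : DirichletCharacter ℂ D) {n : ℕ} (hn : n ≠ 0) :
    chiA χ n = χ n := by simp [chiA, toArithmeticFunction, hn]

lemma chiA_cm {D : ℕ} (χ : DirichletCharacter ℂ D) (m n : ℕ) (hm : m ≠ 0) (hn : n ≠ 0) :
    chiA χ (m * n) = chiA χ m * chiA χ n := by
  rw [chiA_apply _ hm, chiA_apply _ hn, chiA_apply _ (mul_ne_zero hm hn)]; simp

def muC : ArithmeticFunction ℂ := (ArithmeticFunction.moebius : ArithmeticFunction ℂ)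

def ups {D : ℕ} (χ : DirichletCharacter ℂ D) : ArithmeticFunction ℂ :=
  muC * muC.pmul (chiA χ)

lemma nu_mul_ups {D : ℕ} (χ : DirichletCharacter ℂ D) : χ.zetaMul * ups χ = 1 := by
  have h1 : ((ArithmeticFunction.zeta : ArithmeticFunction ℂ)) * muC = 1 :=
    ArithmeticFunction.coe_zeta_mul_coe_moebius
  have h2 : chiA χ * muC.pmul (chiA χ) = 1 := by
    have := (mul_pmul_cm _ _ (chiA χ) (chiA_cm χ)).symm.trans (congrArg (fun f : ArithmeticFunction ℂ => f.pmul (chiA χ)) h1)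
    rw [ArithmeticFunction.pmul_comm (ArithmeticFunction.zeta : ArithmeticFunction ℂ), ArithmeticFunction.pmul_zeta] at this
    rw [this]
    ext n
    rw [ArithmeticFunction.pmul_apply, ArithmeticFunction.one_apply]
    split_ifs with h
    · subst h; rw [chiA_apply _ one_ne_zero]; simp
    · simp
  rw [DirichletCharacter.zetaMul, ups]
  change (ArithmeticFunction.zeta : ArithmeticFunction ℂ) * chiA χ * _ = 1
  calc _ = ((ArithmeticFunction.zeta : ArithmeticFunction ℂ) * muC) * (chiA χ * muC.pmul (chiA χ)) := by ring
    _ = 1 := by rw [h1, h2, one_mul]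

lemma ups_mult {D : ℕ} (χ : DirichletCharacter ℂ D) : (ups χ).IsMultiplicative := by
  have h : muC.IsMultiplicative := ArithmeticFunction.isMultiplicative_moebius.intCast
  exact h.mul (h.pmul (DirichletCharacter.isMultiplicative_toArithmeticFunction χ))

lemma ups_prime_pow {D : ℕ} (χ : DirichletCharacter ℂ D) {p : ℕ} (hp : p.Prime) (k : ℕ) :
    ups χ (p ^ k) = if k = 0 then 1 else if k = 1 then -(1 + χ p) else if k = 2 then χ p else 0 := by
  have hm : ∀ k, muC (p ^ k) = if k = 0 then 1 else if k = 1 then -1 else 0 := by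
    intro k
    rcases eq_or_ne k 0 with rfl | hk
    · simp [muC]
    · simp only [muC, ArithmeticFunction.intCoe_apply, ArithmeticFunction.moebius_apply_prime_pow hp hk, hk, if_false]
      split_ifs <;> simp
  have hc : ∀ k, chiA χ (p ^ k) = χ p ^ k := by
    intro k
    rw [chiA_apply _ (pow_ne_zero _ hp.ne_zero)]; simp
  have : ups χ (p ^ k) = ∑ i ∈ Finset.range (k + 1), muC (p ^ i) * (muC (p ^ (k - i)) * χ p ^ (k - i)) := by
    rw [ups, ArithmeticFunction.mul_apply]
    rw [Nat.sum_divisorsAntidiagonal (fun a b => muC a * (muC.pmul (chiA χ)) b), Nat.sum_divisors_prime_pow hp]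
    apply Finset.sum_congr rfl
    intro i hi
    have : p ^ k / p ^ i = p ^ (k - i) := Nat.pow_div (by simp at hi; omega) hp.pos
    rw [this, ArithmeticFunction.pmul_apply, hc]
  rw [this]
  match k with
  | 0 => simp [muC]
  | 1 => simp only [hm, Finset.sum_range_succ]; simp
  | 2 => simp [hm, Finset.sum_range_succ]
  | k + 3 =>
    simp only [hm]
    rw [Finset.sum_eq_zero]
    · simp
    · intro i hi
      by_cases h0 : i = 0
      · subst h0; simp
      · by_cases h1 : i = 1
        · subst h1; simp
        · simp [h0, h1]

lemma norm_ups_le {D : ℕ} {χ : DirichletCharacter ℂ D} (hχ : χ ^ 2 = 1) (n : ℕ) :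
    ‖ups χ n‖ ≤ ‖χ.zetaMul n‖ := by
  rcases eq_or_ne n 0 with rfl | hn
  · simp
  rw [(ups_mult χ).multiplicative_factorization _ hn, χ.isMultiplicative_zetaMul.multiplicative_factorization _ hn,
    Finsupp.prod, Finsupp.prod, norm_prod, norm_prod]
  apply Finset.prod_le_prod (fun _ _ => norm_nonneg _)
  intro p hp
  have hp : p.Prime := Nat.prime_of_mem_primeFactors (by simpa using hp)
  generalize n.factorization p = k
  rw [ups_prime_pow χ hp]
  have hz : χ.zetaMul (p ^ k) = ∑ i ∈ Finset.range (k + 1), χ p ^ i := by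
    rw [DirichletCharacter.zetaMul, ArithmeticFunction.coe_zeta_mul_apply, Nat.sum_divisors_prime_pow hp]
    apply Finset.sum_congr rfl
    intro i _
    exact (chiA_apply χ (pow_ne_zero _ hp.ne_zero)).trans (by simp)
  match k with
  | 0 => rw [hz]; simp
  | 1 => rw [hz]; simp only [Finset.sum_range_succ]; simp; rw [← norm_neg]; apply le_of_eq; congr 1; ring
  | 2 =>
    simp [hz, Finset.sum_range_succ]
    rcases MulChar.isQuadratic_iff_sq_eq_one.mpr hχ p with h | h | h <;> rw [h] <;> norm_num
  | k + 3 => simp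

lemma nu_re {D : ℕ} {χ : DirichletCharacter ℂ D} (hχ : χ ^ 2 = 1) (n : ℕ) :
    χ.zetaMul n = (‖χ.zetaMul n‖ : ℂ) := by
  have h := DirichletCharacter.zetaMul_nonneg hχ n
  open scoped ComplexOrder in
  exact (Complex.norm_of_nonneg' h).symm

lemma L_real {D : ℕ} [NeZero D] {χ : DirichletCharacter ℂ D} (hχ : χ ≠ 1) (hr : ∀ a, (χ a).im = 0)
    {x : ℝ} (hx : 0 < x) : (χ.LFunction x).im = 0 := by
  have key : ∀ N : ℕ, 1 ≤ N → |(χ.LFunction x).im| ≤ ‖(x : ℂ)‖ * (4 * D * (N : ℝ) ^ (-x) / x) := by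
    intro N hN
    have h := approx_L hχ hN (s := x) (by simpa using hx)
    have h2 := (Complex.abs_im_le_norm _).trans h
    rw [Complex.sub_im, Complex.im_sum, Finset.sum_eq_zero, sub_zero] at h2
    · simpa using h2
    · intro n hn
      have : ((n : ℂ) ^ (-(x : ℂ))) = (((n : ℝ) ^ (-x) : ℝ) : ℂ) := by
        rw [Complex.ofReal_cpow (by positivity)]; push_cast; rfl
      rw [this, Complex.im_mul_ofReal, hr, zero_mul]
  have lim : Filter.Tendsto (fun N : ℕ => ‖(x : ℂ)‖ * (4 * D * (N : ℝ) ^ (-x) / x)) Filter.atTop (nhds 0) := by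
    have := (tendsto_rpow_neg_atTop hx).comp tendsto_natCast_atTop_atTop
    have := ((this.const_mul (4 * (D : ℝ))).div_const x).const_mul ‖(x : ℂ)‖
    simpa using this
  have := ge_of_tendsto lim (Filter.eventually_atTop.2 ⟨1, key⟩)
  exact abs_eq_zero.1 (le_antisymm this (abs_nonneg _))

lemma L_one_nonneg {D : ℕ} [NeZero D] {χ : DirichletCharacter ℂ D} (hχ : χ ≠ 1) (h2 : χ ^ 2 = 1) :
    0 ≤ (χ.LFunction 1).re := by
  have key : ∀ n : ℕ, 1 ≤ n → - (13 * D / √n) ≤ (χ.LFunction 1).re := by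
    intro n hn
    have h := (Complex.abs_re_le_norm _).trans (sum_nu_nat hχ hn)
    have hn0 : (0 : ℝ) < n := by exact_mod_cast hn
    have hsq : √(n : ℝ) * √n = n := Real.mul_self_sqrt hn0.le
    have hs0 : 0 < √(n : ℝ) := Real.sqrt_pos.2 hn0
    rw [Complex.sub_re, Complex.re_sum] at h
    have h3 : 0 ≤ ∑ k ∈ Finset.Icc 1 n, (χ.zetaMul k).re := by
      apply Finset.sum_nonneg
      intro k _
      rw [nu_re h2]; simp
    have h4 : (χ.LFunction 1 * n).re = (χ.LFunction 1).re * n := by simp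
    rw [h4] at h
    have h5 := (abs_le.1 h).2
    rw [← neg_div, div_le_iff₀ hs0]
    have : -(13 * D) * √(n:ℝ) ≤ ((χ.LFunction 1).re * √n) * √n := by
      rw [mul_assoc, hsq]; linarith
    exact le_of_mul_le_mul_right this hs0
  have lim : Filter.Tendsto (fun n : ℕ => - (13 * (D : ℝ) / √n)) Filter.atTop (nhds 0) := by
    have : Filter.Tendsto (fun n : ℕ => √(n : ℝ)) Filter.atTop Filter.atTop :=
      Real.tendsto_sqrt_atTop.comp tendsto_natCast_atTop_atTop
    simpa using (this.const_div_atTop (13 * (D : ℝ))).neg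
  exact le_of_tendsto lim (Filter.eventually_atTop.2 ⟨1, key⟩)

/-- The completely multiplicative function `n ↦ n ^ (-s)`. -/
def pw (s : ℂ) : ArithmeticFunction ℂ := ⟨fun n => if n = 0 then 0 else (n : ℂ) ^ (-s), by simp⟩

lemma pw_apply (s : ℂ) {n : ℕ} (hn : n ≠ 0) : pw s n = (n : ℂ) ^ (-s) := by
  simp [pw, hn]

lemma pw_cm (s : ℂ) (m n : ℕ) (hm : m ≠ 0) (hn : n ≠ 0) : pw s (m * n) = pw s m * pw s n := by
  rw [pw_apply _ hm, pw_apply _ hn, pw_apply _ (mul_ne_zero hm hn)]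
  push_cast
  exact Complex.natCast_mul_natCast_cpow m n (-s)

def Wsum {D : ℕ} (χ : DirichletCharacter ℂ D) (M N : ℕ) : ℝ :=
  ∑ n ∈ Finset.Ioc M N, ‖χ.zetaMul n‖ / n

lemma Wsum_nonneg {D : ℕ} (χ : DirichletCharacter ℂ D) (M N : ℕ) : 0 ≤ Wsum χ M N :=
  Finset.sum_nonneg fun _ _ => by positivity

lemma sum_inv_le (N : ℕ) : ∑ n ∈ Finset.Ioc 0 N, (1 : ℝ) / n ≤ 1 + Real.log N := by
  have h := harmonic_le_one_add_log N
  rw [harmonic_eq_sum_Icc, Icc_one_eq_Ioc] at h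
  push_cast at h
  simpa using h

lemma Wsum_le {D : ℕ} {χ : DirichletCharacter ℂ D} (hχ : χ ^ 2 = 1) (N : ℕ) :
    Wsum χ 0 N ≤ (1 + Real.log N) ^ 2 := by
  have e : χ.zetaMul.pmul (pw 1) = (ArithmeticFunction.zeta : ArithmeticFunction ℂ).pmul (pw 1) * (chiA χ).pmul (pw 1) := by
    rw [← mul_pmul_cm _ _ _ (pw_cm 1)]; rfl
  have h := ArithmeticFunction.sum_Ioc_mul_eq_sum_prod_filter ((ArithmeticFunction.zeta : ArithmeticFunction ℂ).pmul (pw 1)) ((chiA χ).pmul (pw 1)) N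
  rw [← e] at h
  have h1 : ∑ n ∈ Finset.Ioc 0 N, (χ.zetaMul.pmul (pw 1)) n = ((Wsum χ 0 N : ℝ) : ℂ) := by
    rw [Wsum]; push_cast
    apply Finset.sum_congr rfl
    intro n hn
    have hn0 : n ≠ 0 := by have := (Finset.mem_Ioc.1 hn).1; omega
    rw [ArithmeticFunction.pmul_apply, pw_apply _ hn0, ← nu_re hχ, Complex.cpow_neg_one]; rfl
  rw [h1] at h
  have h2 := congrArg norm h
  rw [Complex.norm_real, Real.norm_of_nonneg (Wsum_nonneg _ _ _)] at h2
  rw [h2]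
  have h3 : 0 ≤ 1 + Real.log N := by
    rcases Nat.eq_zero_or_pos N with rfl | hN
    · simp
    · have := Real.log_nonneg (by exact_mod_cast hN : (1 : ℝ) ≤ N); linarith
  have h4 : ∀ n ∈ Finset.Ioc 0 N, ‖((ArithmeticFunction.zeta : ArithmeticFunction ℂ).pmul (pw 1)) n‖ ≤ 1 / n ∧
      ‖((chiA χ).pmul (pw 1)) n‖ ≤ 1 / n := by
    intro n hn
    have hn0 : n ≠ 0 := by have := (Finset.mem_Ioc.1 hn).1; omega
    rw [ArithmeticFunction.pmul_apply, ArithmeticFunction.pmul_apply, pw_apply _ hn0, chiA_apply _ hn0, Complex.cpow_neg_one]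
    constructor
    · simp [hn0]
    · rw [norm_mul, norm_inv, Complex.norm_natCast, ← div_eq_mul_inv]
      gcongr
      exact χ.norm_le_one _
  calc _ ≤ ∑ x ∈ Finset.Ioc 0 N ×ˢ Finset.Ioc 0 N with x.1 * x.2 ≤ N, (1 / (x.1 : ℝ)) * (1 / (x.2 : ℝ)) := by
        refine (norm_sum_le _ _).trans (Finset.sum_le_sum ?_)
        intro x hx
        rw [Finset.mem_filter, Finset.mem_product] at hx
        rw [norm_mul]
        exact mul_le_mul (h4 _ hx.1.1).1 (h4 _ hx.1.2).2 (norm_nonneg _) (by positivity)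
    _ ≤ ∑ x ∈ Finset.Ioc 0 N ×ˢ Finset.Ioc 0 N, (1 / (x.1 : ℝ)) * (1 / (x.2 : ℝ)) :=
        Finset.sum_le_sum_of_subset_of_nonneg (Finset.filter_subset _ _) (fun _ _ _ => by positivity)
    _ = (∑ n ∈ Finset.Ioc 0 N, (1 : ℝ) / n) * (∑ n ∈ Finset.Ioc 0 N, (1 : ℝ) / n) := by
        rw [Finset.sum_mul_sum, Finset.sum_product]
    _ ≤ _ := by
        rw [sq]
        exact mul_le_mul (sum_inv_le N) (sum_inv_le N) (Finset.sum_nonneg fun _ _ => by positivity) h3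

lemma Wsum_dyadic {D : ℕ} [NeZero D] {χ : DirichletCharacter ℂ D} (hχ : χ ≠ 1) (h2 : χ ^ 2 = 1) {x : ℕ} (hx : 1 ≤ x) :
    Wsum χ x (2 * x) ≤ ‖χ.LFunction 1‖ + 39 * D / √x := by
  have hx0 : (0 : ℝ) < x := by exact_mod_cast hx
  have hsq : √(x : ℝ) * √x = x := Real.mul_self_sqrt hx0.le
  have hs0 : 0 < √(x : ℝ) := Real.sqrt_pos.2 hx0
  have h1 : Wsum χ x (2 * x) ≤ (∑ n ∈ Finset.Ioc x (2 * x), ‖χ.zetaMul n‖) / x := by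
    rw [Wsum, Finset.sum_div]
    apply Finset.sum_le_sum
    intro n hn
    have : x < n := (Finset.mem_Ioc.1 hn).1
    gcongr
  have h3 : (∑ n ∈ Finset.Ioc x (2 * x), ‖χ.zetaMul n‖) ≤ ‖χ.LFunction 1‖ * x + 39 * D * √x := by
    have e : ((∑ n ∈ Finset.Ioc x (2 * x), ‖χ.zetaMul n‖ : ℝ) : ℂ) =
        ((∑ k ∈ Finset.Icc 1 (2 * x), χ.zetaMul k) - χ.LFunction 1 * (2 * x : ℕ)) -
        ((∑ k ∈ Finset.Icc 1 x, χ.zetaMul k) - χ.LFunction 1 * x) + χ.LFunction 1 * x := by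
      rw [Icc_one_eq_Ioc, Icc_one_eq_Ioc, ← Finset.sum_Ioc_consecutive _ (Nat.zero_le x) (by omega : x ≤ 2 * x)]
      push_cast
      rw [Finset.sum_congr rfl (fun n _ => (nu_re h2 n).symm)]
      ring
    have e2 := congrArg norm e
    rw [Complex.norm_real, Real.norm_of_nonneg (Finset.sum_nonneg fun _ _ => norm_nonneg _)] at e2
    rw [e2]
    have a := sum_nu_nat hχ (n := 2 * x) (by omega)
    have b := sum_nu_nat hχ (n := x) (by omega)
    have c : √((2 * x : ℕ) : ℝ) ≤ 2 * √x := by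
      rw [Real.sqrt_le_left (by positivity), mul_pow, sq √(x : ℝ), hsq]; push_cast; linarith
    calc _ ≤ (13 * D * √((2 * x : ℕ) : ℝ) + 13 * D * √x) + ‖χ.LFunction 1‖ * x := by
          refine (norm_add_le _ _).trans (add_le_add ((norm_sub_le _ _).trans (add_le_add a b)) ?_)
          rw [norm_mul, Complex.norm_natCast]
      _ ≤ (13 * D * (2 * √x) + 13 * D * √x) + ‖χ.LFunction 1‖ * x := by gcongr
      _ = _ := by ring
  calc _ ≤ _ := h1
    _ ≤ (‖χ.LFunction 1‖ * x + 39 * D * √x) / x := by gcongr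
    _ = _ := by
      nth_rewrite 3 [← hsq]
      field_simp
      linear_combination -‖χ.LFunction 1‖ * hsq

lemma Wsum_dyadic_k {D : ℕ} [NeZero D] {χ : DirichletCharacter ℂ D} (hχ : χ ≠ 1) (h2 : χ ^ 2 = 1) {x : ℕ} (hx : 1 ≤ x)
    (k : ℕ) : Wsum χ x (2 ^ k * x) ≤ k * (‖χ.LFunction 1‖ + 39 * D / √x) := by
  induction k with
  | zero => simp [Wsum]
  | succ k ih =>
    have hk : 1 ≤ 2 ^ k := Nat.one_le_two_pow
    have hx1 : x ≤ 2 ^ k * x := Nat.le_mul_of_pos_left x hk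
    have h := Wsum_dyadic hχ h2 (x := 2 ^ k * x) (by omega)
    have e : Wsum χ x (2 ^ (k + 1) * x) = Wsum χ x (2 ^ k * x) + Wsum χ (2 ^ k * x) (2 * (2 ^ k * x)) := by
      rw [Wsum, Wsum, Wsum, Finset.sum_Ioc_consecutive _ hx1 (by omega)]
      congr 2; ring
    have hx0 : (0 : ℝ) < x := by exact_mod_cast hx
    have : 39 * (D : ℝ) / √((2 ^ k * x : ℕ) : ℝ) ≤ 39 * D / √x := by
      have hs0 : 0 < √(x : ℝ) := Real.sqrt_pos.2 hx0
      gcongr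
    rw [e]; push_cast
    linarith

lemma Wsum_mono {D : ℕ} (χ : DirichletCharacter ℂ D) (M : ℕ) {N N' : ℕ} (h : N ≤ N') : Wsum χ M N ≤ Wsum χ M N' :=
  Finset.sum_le_sum_of_subset_of_nonneg (Finset.Ioc_subset_Ioc_right h) (fun _ _ _ => by positivity)

def FN {D : ℕ} (χ : DirichletCharacter ℂ D) (N : ℕ) (s : ℂ) : ℂ := ∑ n ∈ Finset.Icc 1 N, χ.zetaMul n * (n : ℂ) ^ (-s)
def GN {D : ℕ} (χ : DirichletCharacter ℂ D) (N : ℕ) (s : ℂ) : ℂ := ∑ n ∈ Finset.Icc 1 N, ups χ n * (n : ℂ) ^ (-s)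

lemma norm_GN_le {D : ℕ} {χ : DirichletCharacter ℂ D} (h2 : χ ^ 2 = 1) {N : ℕ} {s : ℂ} {Q : ℝ}
    (hQ : ∀ n ∈ Finset.Ioc 0 N, ‖(n : ℂ) ^ (-s)‖ ≤ Q / n) : ‖GN χ N s‖ ≤ Q * Wsum χ 0 N := by
  rw [GN, Icc_one_eq_Ioc, Wsum, Finset.mul_sum]
  refine (norm_sum_le _ _).trans (Finset.sum_le_sum fun n hn => ?_)
  rw [norm_mul]
  calc _ ≤ ‖χ.zetaMul n‖ * (Q / n) := mul_le_mul (norm_ups_le h2 n) (hQ n hn) (norm_nonneg _) (norm_nonneg _)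
    _ = _ := by ring

lemma FN_GN {D : ℕ} {χ : DirichletCharacter ℂ D} (h2 : χ ^ 2 = 1) {M : ℕ} (hM : 1 ≤ M) {s : ℂ} {Q : ℝ} (hQ0 : 0 ≤ Q)
    (hQ : ∀ n ∈ Finset.Ioc 0 (M * M), ‖(n : ℂ) ^ (-s)‖ ≤ Q / n) :
    ‖FN χ (M * M) s * GN χ (M * M) s - 1‖ ≤ 2 * Q ^ 2 * Wsum χ M (M * M) * Wsum χ 0 (M * M) := by
  set N := M * M with hN
  have hMN : M ≤ N := Nat.le_mul_of_pos_left M hM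
  set f := χ.zetaMul.pmul (pw s) with hf
  set g := (ups χ).pmul (pw s) with hg
  have hfg : f * g = 1 := by
    rw [hf, hg, ← mul_pmul_cm _ _ _ (pw_cm s), nu_mul_ups]
    ext n
    rw [ArithmeticFunction.pmul_apply, ArithmeticFunction.one_apply]
    split_ifs with h
    · subst h; rw [pw_apply _ one_ne_zero]; simp
    · simp
  have hF : FN χ N s = ∑ n ∈ Finset.Ioc 0 N, f n := by
    rw [FN, Icc_one_eq_Ioc]
    apply Finset.sum_congr rfl
    intro n hn
    have hn0 : n ≠ 0 := by have := (Finset.mem_Ioc.1 hn).1; omega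
    rw [hf, ArithmeticFunction.pmul_apply, pw_apply _ hn0]
  have hG : GN χ N s = ∑ n ∈ Finset.Ioc 0 N, g n := by
    rw [GN, Icc_one_eq_Ioc]
    apply Finset.sum_congr rfl
    intro n hn
    have hn0 : n ≠ 0 := by have := (Finset.mem_Ioc.1 hn).1; omega
    rw [hg, ArithmeticFunction.pmul_apply, pw_apply _ hn0]
  have h1 := ArithmeticFunction.sum_Ioc_mul_eq_sum_prod_filter f g N
  have h1' : ∑ n ∈ Finset.Ioc 0 N, (f * g) n = 1 := by
    rw [hfg, Finset.sum_eq_single 1]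
    · simp
    · intro b _ hb; simp [hb]
    · intro h; exfalso; apply h; simp; omega
  rw [h1'] at h1
  have h3 : FN χ N s * GN χ N s - 1 = ∑ x ∈ Finset.Ioc 0 N ×ˢ Finset.Ioc 0 N with ¬ (x.1 * x.2 ≤ N), f x.1 * g x.2 := by
    rw [hF, hG, Finset.sum_mul_sum, ← Finset.sum_product', ← Finset.sum_filter_add_sum_filter_not _ (fun x : ℕ × ℕ => x.1 * x.2 ≤ N), h1]
    ring
  set a : ℕ → ℝ := fun n => Q * (‖χ.zetaMul n‖ / n) with ha
  have ha0 : ∀ n, 0 ≤ a n := fun n => by positivity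
  have hfa : ∀ n ∈ Finset.Ioc 0 N, ‖f n‖ ≤ a n := by
    intro n hn
    have hn0 : n ≠ 0 := by have := (Finset.mem_Ioc.1 hn).1; omega
    rw [hf, ArithmeticFunction.pmul_apply, pw_apply _ hn0, norm_mul]
    calc _ ≤ ‖χ.zetaMul n‖ * (Q / n) := mul_le_mul le_rfl (hQ n hn) (norm_nonneg _) (norm_nonneg _)
      _ = _ := by rw [ha]; ring
  have hga : ∀ n ∈ Finset.Ioc 0 N, ‖g n‖ ≤ a n := by
    intro n hn
    have hn0 : n ≠ 0 := by have := (Finset.mem_Ioc.1 hn).1; omega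
    rw [hg, ArithmeticFunction.pmul_apply, pw_apply _ hn0, norm_mul]
    calc _ ≤ ‖χ.zetaMul n‖ * (Q / n) := mul_le_mul (norm_ups_le h2 n) (hQ n hn) (norm_nonneg _) (norm_nonneg _)
      _ = _ := by rw [ha]; ring
  set b : ℕ → ℝ := fun n => if M < n then a n else 0 with hb
  have hb0 : ∀ n, 0 ≤ b n := fun n => by simp only [hb]; split_ifs; exacts [ha0 n, le_rfl]
  have sa : ∑ n ∈ Finset.Ioc 0 N, a n = Q * Wsum χ 0 N := by rw [Wsum, Finset.mul_sum]
  have sb : ∑ n ∈ Finset.Ioc 0 N, b n = Q * Wsum χ M N := by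
    rw [Wsum, Finset.mul_sum, hb, ← Finset.sum_filter]
    apply Finset.sum_congr _ (fun _ _ => rfl)
    ext n; simp; omega
  rw [h3]
  calc _ ≤ ∑ x ∈ Finset.Ioc 0 N ×ˢ Finset.Ioc 0 N with ¬ (x.1 * x.2 ≤ N), (b x.1 * a x.2 + a x.1 * b x.2) := by
        refine (norm_sum_le _ _).trans (Finset.sum_le_sum ?_)
        intro x hx
        rw [Finset.mem_filter, Finset.mem_product] at hx
        rw [norm_mul]
        refine (mul_le_mul (hfa _ hx.1.1) (hga _ hx.1.2) (norm_nonneg _) (ha0 _)).trans ?_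
        by_cases hc : M < x.1
        · have : b x.1 = a x.1 := by simp [hb, hc]
          rw [this]
          have := mul_nonneg (ha0 x.1) (hb0 x.2)
          linarith
        · have hc2 : M < x.2 := by
            by_contra h
            exact hx.2 (Nat.mul_le_mul (by omega) (by omega))
          have : b x.2 = a x.2 := by simp [hb, hc2]
          rw [this]
          have := mul_nonneg (hb0 x.1) (ha0 x.2)
          linarith
    _ ≤ ∑ x ∈ Finset.Ioc 0 N ×ˢ Finset.Ioc 0 N, (b x.1 * a x.2 + a x.1 * b x.2) :=
        Finset.sum_le_sum_of_subset_of_nonneg (Finset.filter_subset _ _) (fun x _ _ => add_nonneg (mul_nonneg (hb0 _) (ha0 _)) (mul_nonneg (ha0 _) (hb0 _)))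
    _ = (∑ n ∈ Finset.Ioc 0 N, b n) * (∑ n ∈ Finset.Ioc 0 N, a n) + (∑ n ∈ Finset.Ioc 0 N, a n) * (∑ n ∈ Finset.Ioc 0 N, b n) := by
        rw [Finset.sum_add_distrib, Finset.sum_mul_sum, Finset.sum_mul_sum, Finset.sum_product, Finset.sum_product]
    _ = _ := by rw [sa, sb]; ring

structure Good (D : ℕ) [NeZero D] (χ : DirichletCharacter ℂ D) (u : ℝ) : Prop where
  ne1 : χ ≠ 1
  sq1 : χ ^ 2 = 1
  real : ∀ a, (χ a).im = 0
  hlog : Real.log D = u⁻¹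
  hu0 : 0 < u
  hu : u ≤ 1 / 1000000
  hQ : Real.exp 16 ^ 2 * u ≤ 1
  hD : (D : ℝ)⁻¹ ≤ u ^ 20
  hL : ‖χ.LFunction 1‖ ≤ u ^ 2022
  hz : ∀ x : ℝ, x ≠ 0 → |x| ≤ u → ‖riemannZeta (1 + x : ℝ) - ((1 / x : ℝ) : ℂ)‖ ≤ u⁻¹

def NN (D : ℕ) : ℕ := D ^ 4 * D ^ 4

lemma NN_pos (D : ℕ) [NeZero D] : 1 ≤ NN D := by
  have := NeZero.pos D
  have : 0 < NN D := by unfold NN; positivity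
  omega

namespace Good
variable {D : ℕ} [NeZero D] {χ : DirichletCharacter ℂ D} {u : ℝ}

lemma hDpos (_h : Good D χ u) : (0 : ℝ) < D := by exact_mod_cast NeZero.pos D

lemma D1 (_h : Good D χ u) : (1 : ℝ) ≤ D := by exact_mod_cast NeZero.pos D

lemma Q1 (_h : Good D χ u) : 1 ≤ Real.exp 16 := Real.one_le_exp (by norm_num)

lemma logNN (h : Good D χ u) : Real.log (NN D) = 8 * u⁻¹ := by
  have := h.hDpos
  rw [NN]; push_cast
  rw [Real.log_mul (by positivity) (by positivity), Real.log_pow, h.hlog]; push_cast; ring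

lemma rpow_le (h : Good D χ u) {n : ℕ} (h0 : 0 < n) (hn : n ≤ NN D) {σ : ℝ} (hσ : 1 - 2 * u < σ) :
    (n : ℝ) ^ (1 - σ) ≤ Real.exp 16 := by
  have hn0 : (0 : ℝ) < n := by exact_mod_cast h0
  have hl : Real.log n ≤ 8 * u⁻¹ := by
    rw [← h.logNN]; exact Real.log_le_log hn0 (by exact_mod_cast hn)
  have hl0 : 0 ≤ Real.log n := Real.log_nonneg (by exact_mod_cast h0)
  rw [Real.rpow_def_of_pos hn0]
  apply Real.exp_le_exp.2
  have hu0 := h.hu0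
  have : 8 * u⁻¹ * (2 * u) = 16 := by field_simp; norm_num
  calc _ ≤ Real.log n * (2 * u) := by gcongr; linarith
    _ ≤ 8 * u⁻¹ * (2 * u) := by gcongr
    _ = 16 := this

lemma pow_bound (h : Good D χ u) {s : ℂ} (hσ : 1 - 2 * u < s.re) :
    ∀ n ∈ Finset.Ioc 0 (NN D), ‖(n : ℂ) ^ (-s)‖ ≤ Real.exp 16 / n := by
  intro n hn
  rw [Finset.mem_Ioc] at hn
  have hn0 : (0 : ℝ) < n := by exact_mod_cast hn.1
  rw [Complex.norm_natCast_cpow_of_pos hn.1, Complex.neg_re]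
  have : -s.re = (1 - s.re) - 1 := by ring
  rw [this, Real.rpow_sub hn0, Real.rpow_one]
  gcongr
  exact h.rpow_le hn.1 hn.2 hσ

lemma W_le (h : Good D χ u) : Wsum χ 0 (NN D) ≤ 81 * (u⁻¹) ^ 2 := by
  have h1 := Wsum_le h.sq1 (NN D)
  rw [h.logNN] at h1
  have : 1 ≤ u⁻¹ := (one_le_inv₀ h.hu0).2 (by linarith [h.hu])
  nlinarith

lemma T_le (h : Good D χ u) : Wsum χ (D ^ 4) (NN D) ≤ 480 * u ^ 19 := by
  set K := Nat.log 2 D + 1 with hK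
  have hDK : D ≤ 2 ^ K := (Nat.lt_pow_succ_log_self (by norm_num) D).le
  have h1 := Wsum_dyadic_k h.ne1 h.sq1 (x := D ^ 4) (Nat.one_le_pow _ _ (NeZero.pos D)) (4 * K)
  have h2 : NN D ≤ 2 ^ (4 * K) * D ^ 4 := by
    rw [NN, mul_comm 4 K, pow_mul]; gcongr
  refine (Wsum_mono χ _ h2).trans (h1.trans ?_)
  have hs : √((D ^ 4 : ℕ) : ℝ) = (D : ℝ) ^ 2 := by
    rw [show ((D ^ 4 : ℕ) : ℝ) = ((D : ℝ) ^ 2) ^ 2 by push_cast; ring, Real.sqrt_sq (by positivity)]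
  have hD0 := h.hDpos
  have hu0 := h.hu0
  have hl1 : 1000000 ≤ u⁻¹ := by
    rw [le_inv_comm₀ (by norm_num) hu0]; simpa using h.hu
  have hKl : (K : ℝ) ≤ 3 * u⁻¹ := by
    have a : (2 : ℝ) ^ (Nat.log 2 D) ≤ D := by exact_mod_cast Nat.pow_log_le_self 2 (NeZero.ne D)
    have b := Real.log_le_log (by positivity) a
    rw [Real.log_pow, h.hlog] at b
    have c := Real.log_two_gt_d9
    rw [hK]; push_cast
    have : 0 ≤ (Nat.log 2 D : ℝ) := by positivity
    nlinarith
  have hL : ‖χ.LFunction 1‖ ≤ u ^ 20 :=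
    h.hL.trans (pow_le_pow_of_le_one hu0.le (by linarith [h.hu]) (by norm_num))
  rw [hs]
  have e : 39 * (D : ℝ) / D ^ 2 = 39 * (D : ℝ)⁻¹ := by field_simp
  rw [e]; push_cast
  calc _ ≤ 4 * (3 * u⁻¹) * (u ^ 20 + 39 * u ^ 20) := by
        have := h.hD
        gcongr
    _ = 480 * u ^ 19 := by field_simp; ring

lemma err_le (h : Good D χ u) {s : ℂ} (hσ : 1 - 2 * u < s.re) (hn : ‖s‖ ≤ 4 * D) :
    ‖s‖ * (2 * (20 * D) * (NN D : ℝ) ^ (1 / 2 - s.re) / (s.re - 1 / 2)) ≤ u ^ 30 := by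
  have hD0 := h.hDpos
  have hu0 := h.hu0
  have hu := h.hu
  have h1 : (NN D : ℝ) ^ (1 / 2 - s.re) ≤ Real.exp 16 * ((D : ℝ)⁻¹) ^ 4 := by
    have hN0 : (0 : ℝ) < NN D := by exact_mod_cast NN_pos D
    have : 1 / 2 - s.re = (1 - s.re) + (-(1/2)) := by ring
    rw [this, Real.rpow_add hN0]
    have e : (NN D : ℝ) ^ (-(1 / 2) : ℝ) = ((D : ℝ)⁻¹) ^ 4 := by
      rw [Real.rpow_neg hN0.le, ← Real.sqrt_eq_rpow, NN]
      push_cast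
      rw [Real.sqrt_mul_self (by positivity), inv_pow]
    rw [e]
    gcongr
    exact h.rpow_le (NN_pos D) le_rfl hσ
  have h2 : (1 : ℝ) / 4 ≤ s.re - 1 / 2 := by linarith
  calc _ ≤ (4 * D) * (2 * (20 * D) * (Real.exp 16 * ((D : ℝ)⁻¹) ^ 4) / (1 / 4)) := by gcongr
    _ = 640 * Real.exp 16 * ((D : ℝ)⁻¹) ^ 2 := by field_simp; ring
    _ ≤ 640 * Real.exp 16 * (u ^ 20) ^ 2 := by have := h.hD; gcongr
    _ = (Real.exp 16 * u) * (640 * u) * u ^ 38 := by ring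
    _ ≤ 1 * 1 * u ^ 38 := by
      have := h.hQ
      have := h.Q1
      gcongr
      · nlinarith
      · linarith
    _ ≤ u ^ 30 := by
      rw [one_mul, one_mul]
      exact pow_le_pow_of_le_one hu0.le (by linarith) (by norm_num)

lemma zero_free (h : Good D χ u) {s : ℂ} (hσ : 1 - 2 * u < s.re) (hσ1 : s.re < 1) (ht : |s.im| < 2 * D)
    (hs : u ^ 10 ≤ ‖s - 1‖) : χ.LFunction s ≠ 0 := by
  intro h0
  have hu0 := h.hu0
  have hu := h.hu
  have hQ1 := h.Q1
  have hQ := h.hQ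
  have hs1 : s ≠ 1 := by rintro rfl; simp at hσ1
  have hF := approx_F h.ne1 (NN_pos D) (s := s) (by linarith) hs1
  have hsn : ‖s‖ ≤ 4 * D := by
    refine (Complex.norm_le_abs_re_add_abs_im s).trans ?_
    have := h.D1
    rw [abs_of_pos (by linarith)]
    linarith
  have he := hF.trans (h.err_le hσ hsn)
  rw [h0, mul_zero] at he
  have hpole : ‖χ.LFunction 1 * (NN D : ℂ) ^ (1 - s) / (s - 1)‖ ≤ u ^ 19 := by
    rw [norm_div, norm_mul, Complex.norm_natCast_cpow_of_pos (NN_pos D)]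
    rw [div_le_iff₀ (lt_of_lt_of_le (by positivity) hs)]
    have a := h.rpow_le (NN_pos D) le_rfl hσ
    calc _ ≤ u ^ 2022 * Real.exp 16 := by
          have := h.hL
          rw [Complex.sub_re, Complex.one_re]; gcongr
      _ = (Real.exp 16 * u) * u ^ 2021 := by ring
      _ ≤ 1 * u ^ 2021 := by gcongr; nlinarith
      _ ≤ 1 * u ^ 29 := by
        gcongr 1 * ?_
        exact pow_le_pow_of_le_one hu0.le (by linarith) (by norm_num)
      _ = u ^ 19 * u ^ 10 := by ring
      _ ≤ _ := by gcongr
  have hFN : ‖FN χ (NN D) s‖ ≤ 2 * u ^ 19 := by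
    have e : FN χ (NN D) s = -((0 - FN χ (NN D) s - χ.LFunction 1 * (NN D : ℂ) ^ (1 - s) / (s - 1)) + χ.LFunction 1 * (NN D : ℂ) ^ (1 - s) / (s - 1)) := by ring
    rw [e, norm_neg]
    refine (norm_add_le _ _).trans ((add_le_add he hpole).trans ?_)
    have : u ^ 30 ≤ u ^ 19 := pow_le_pow_of_le_one hu0.le (by linarith) (by norm_num)
    linarith
  have hG := norm_GN_le h.sq1 (h.pow_bound hσ)
  have hFG := FN_GN h.sq1 (Nat.one_le_pow 4 _ (NeZero.pos D)) (Real.exp_pos 16).le (h.pow_bound hσ)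
  have hW := h.W_le
  have hT := h.T_le
  have hT0 := Wsum_nonneg χ (D ^ 4) (NN D)
  have hW0 := Wsum_nonneg χ 0 (NN D)
  have b1 : ‖FN χ (NN D) s * GN χ (NN D) s - 1‖ ≤ 1 / 4 := by
    refine hFG.trans ?_
    calc _ ≤ 2 * Real.exp 16 ^ 2 * (480 * u ^ 19) * (81 * (u⁻¹) ^ 2) := by
          change 2 * Real.exp 16 ^ 2 * Wsum χ (D ^ 4) (NN D) * Wsum χ 0 (NN D) ≤ _
          gcongr
      _ = (Real.exp 16 ^ 2 * u) * (77760 * u) * u ^ 15 := by field_simp; norm_num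
      _ ≤ 1 * 1 * (1 / 1000000) := by
        gcongr
        · linarith
        · calc u ^ 15 ≤ u ^ 1 := pow_le_pow_of_le_one hu0.le (by linarith) (by norm_num)
            _ ≤ _ := by simpa using hu
      _ ≤ _ := by norm_num
  have b2 : ‖FN χ (NN D) s * GN χ (NN D) s‖ ≤ 1 / 4 := by
    rw [norm_mul]
    calc _ ≤ 2 * u ^ 19 * (Real.exp 16 * (81 * (u⁻¹) ^ 2)) := by
          gcongr; exact hG.trans (by gcongr)
      _ = (Real.exp 16 * u) * (162 * u) * u ^ 15 := by field_simp; norm_num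
      _ ≤ 1 * 1 * (1 / 1000000) := by
        gcongr
        · nlinarith
        · linarith
        · calc u ^ 15 ≤ u ^ 1 := pow_le_pow_of_le_one hu0.le (by linarith) (by norm_num)
            _ ≤ _ := by simpa using hu
      _ ≤ _ := by norm_num
  have : ‖(1 : ℂ)‖ ≤ 1 / 4 + 1 / 4 := by
    have e : (1 : ℂ) = FN χ (NN D) s * GN χ (NN D) s - (FN χ (NN D) s * GN χ (NN D) s - 1) := by ring
    calc ‖(1 : ℂ)‖ = ‖FN χ (NN D) s * GN χ (NN D) s - (FN χ (NN D) s * GN χ (NN D) s - 1)‖ := by rw [← e]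
      _ ≤ _ := (norm_sub_le _ _).trans (add_le_add b2 b1)
  norm_num at this

end Good

namespace Good
variable {D : ℕ} [NeZero D] {χ : DirichletCharacter ℂ D} {u : ℝ}

lemma FN_re (h : Good D χ u) (y : ℝ) : 1 ≤ (FN χ (NN D) y).re := by
  have key : ∀ n ∈ Finset.Icc 1 (NN D), (χ.zetaMul n * (n : ℂ) ^ (-(y : ℂ))).re = ‖χ.zetaMul n‖ * (n : ℝ) ^ (-y) := by
    intro n hn
    have : ((n : ℂ) ^ (-(y : ℂ))) = (((n : ℝ) ^ (-y) : ℝ) : ℂ) := by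
      rw [Complex.ofReal_cpow (by positivity)]; push_cast; rfl
    rw [this, nu_re h.sq1, ← Complex.ofReal_mul, Complex.ofReal_re]
    simp
  rw [FN, Complex.re_sum, Finset.sum_congr rfl key]
  have h1 : 1 ∈ Finset.Icc 1 (NN D) := by simp; exact NN_pos D
  refine le_trans ?_ (Finset.single_le_sum (fun n _ => by positivity) h1)
  have : χ.zetaMul 1 = 1 := χ.isMultiplicative_zetaMul.1
  simp [this]

lemma F_re (h : Good D χ u) {x : ℝ} (hx0 : x ≠ 0) (hx : |x| ≤ u) :
    1 + ‖χ.LFunction 1‖ * (NN D : ℝ) ^ (-x) / x - u ^ 30 ≤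
      (riemannZeta (1 + x : ℝ)).re * (χ.LFunction (1 + x : ℝ)).re := by
  have hu := h.hu
  have hu0 := h.hu0
  have hx' := abs_le.1 hx
  have hD1 := h.D1
  have hs : ((1 + x : ℝ) : ℂ) ≠ 1 := by
    intro h'
    have : (1 + x : ℝ) = 1 := by exact_mod_cast h'
    exact hx0 (by linarith)
  have hre : (((1 + x : ℝ) : ℂ)).re = 1 + x := Complex.ofReal_re _
  have a := approx_F h.ne1 (NN_pos D) (s := ((1 + x : ℝ) : ℂ)) (by rw [hre]; linarith) hs
  have b := a.trans (h.err_le (by rw [hre]; linarith) (by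
    rw [Complex.norm_real, Real.norm_of_nonneg (by linarith)]; linarith))
  have c := (abs_le.1 ((Complex.abs_re_le_norm _).trans b)).1
  have hL1 : χ.LFunction 1 = ((‖χ.LFunction 1‖ : ℝ) : ℂ) := by
    have i := L_real h.ne1 h.real (x := 1) one_pos
    have r := L_one_nonneg h.ne1 h.sq1
    rw [Complex.ofReal_one] at i
    have e : χ.LFunction 1 = ((χ.LFunction 1).re : ℂ) := by apply Complex.ext <;> simp [i]
    rw [e, Complex.norm_real, Real.norm_of_nonneg r]
  have hp : (χ.LFunction 1 * (NN D : ℂ) ^ (1 - ((1 + x : ℝ) : ℂ)) / (((1 + x : ℝ) : ℂ) - 1)) =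
      ((‖χ.LFunction 1‖ * (NN D : ℝ) ^ (-x) / x : ℝ) : ℂ) := by
    rw [hL1]
    have : (1 - ((1 + x : ℝ) : ℂ)) = ((-x : ℝ) : ℂ) := by push_cast; ring
    rw [this]
    push_cast
    rw [Complex.ofReal_cpow (by positivity)]
    push_cast
    rw [Complex.norm_real, norm_norm]
    congr 1; ring
  have hzL : (riemannZeta (1 + x : ℝ) * χ.LFunction (1 + x : ℝ)).re =
      (riemannZeta (1 + x : ℝ)).re * (χ.LFunction (1 + x : ℝ)).re := by
    rw [Complex.mul_re, L_real h.ne1 h.real (x := 1 + x) (by linarith)]; ring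
  rw [hp] at c
  have hf := h.FN_re (1 + x)
  change -u ^ 30 ≤ (riemannZeta (1 + x : ℝ) * χ.LFunction (1 + x : ℝ) - FN χ (NN D) (1 + x : ℝ) - ((‖χ.LFunction 1‖ * (NN D : ℝ) ^ (-x) / x : ℝ) : ℂ)).re at c
  rw [Complex.sub_re, Complex.sub_re, hzL, Complex.ofReal_re] at c
  linarith

lemma zeta_re (h : Good D χ u) {x : ℝ} (hx0 : x ≠ 0) (hx : |x| ≤ u) :
    |(riemannZeta (1 + x : ℝ)).re - 1 / x| ≤ u⁻¹ := by
  have := (Complex.abs_re_le_norm _).trans (h.hz x hx0 hx)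
  rwa [Complex.sub_re, Complex.ofReal_re] at this

lemma pow_small (h : Good D χ u) {k : ℕ} (hk : 1 ≤ k) : u ^ k ≤ u :=
  (pow_le_pow_of_le_one h.hu0.le (by linarith [h.hu]) hk).trans (by simp)

lemma L_neg (h : Good D χ u) : (χ.LFunction (1 - 4 * u ^ 2022 : ℝ)).re < 0 := by
  have hu := h.hu
  have hu0 := h.hu0
  set δ := 4 * u ^ 2022 with hδ
  have hδ0 : 0 < δ := by positivity
  have h4 : u ^ 2022 = u ^ 2021 * u := by ring
  have hδ1 : δ ≤ u * (1 / 16) := by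
    have := h.pow_small (k := 2021) (by norm_num)
    rw [hδ, h4]; nlinarith
  have hne : -δ ≠ 0 := by linarith
  have hab : |(-δ)| ≤ u := by rw [abs_neg, abs_of_pos hδ0]; linarith
  have f := h.F_re hne hab
  have z := (abs_le.1 (h.zeta_re hne hab)).2
  have e : (1 + -δ : ℝ) = 1 - δ := by ring
  rw [e] at f z
  have zneg : (riemannZeta (1 - δ : ℝ)).re < 0 := by
    have h1 : u⁻¹ < 1 / δ := by
      rw [inv_eq_one_div]
      exact one_div_lt_one_div_of_lt hδ0 (by linarith)
    have h2 : 1 / -δ = - (1 / δ) := by rw [div_neg]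
    rw [h2] at z
    linarith
  have hN : (NN D : ℝ) ^ (- -δ) ≤ 2 := by
    have hN0 : (0 : ℝ) < NN D := by exact_mod_cast NN_pos D
    rw [Real.rpow_def_of_pos hN0, h.logNN, neg_neg]
    have : 8 * u⁻¹ * δ ≤ 1 / 2 := by
      calc _ ≤ 8 * u⁻¹ * (u * (1 / 16)) := by gcongr
        _ = 1 / 2 := by field_simp; norm_num
    calc _ ≤ Real.exp (1 / 2) := Real.exp_le_exp.2 this
      _ ≤ 2 := by
        have := Real.exp_bound_div_one_sub_of_interval (x := 1 / 2) (by norm_num) (by norm_num)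
        norm_num at this ⊢
        linarith
  have hp : ‖χ.LFunction 1‖ * (NN D : ℝ) ^ (- -δ) / δ ≤ 1 / 2 := by
    rw [div_le_iff₀ hδ0]
    calc _ ≤ u ^ 2022 * 2 := by have := h.hL; gcongr
      _ = _ := by rw [hδ]; ring
  rw [div_neg] at f
  have h30 := h.pow_small (k := 30) (by norm_num)
  have hpos : 0 < (riemannZeta (1 - δ : ℝ)).re * (χ.LFunction (1 - δ : ℝ)).re := by linarith
  by_contra hc
  push Not at hc
  nlinarith

lemma L_pos (h : Good D χ u) : u ^ 8 / 4 ≤ (χ.LFunction (1 + u ^ 8 : ℝ)).re := by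
  have hu := h.hu
  have hu0 := h.hu0
  set r := u ^ 8 with hr
  have hr0 : 0 < r := by positivity
  have hru : r ≤ u / 2 := by
    have : u ^ 8 = u ^ 7 * u := by ring
    have := h.pow_small (k := 7) (by norm_num)
    nlinarith
  have hab : |r| ≤ u := by rw [abs_of_pos hr0]; linarith
  have f := h.F_re hr0.ne' hab
  have z := abs_le.1 (h.zeta_re hr0.ne' hab)
  have h30 := h.pow_small (k := 30) (by norm_num)
  have hpole : 0 ≤ ‖χ.LFunction 1‖ * (NN D : ℝ) ^ (-r) / r := by positivity
  have hui : u⁻¹ < 1 / r := by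
    rw [inv_eq_one_div]
    exact one_div_lt_one_div_of_lt hr0 (by linarith)
  have z1 : 0 < (riemannZeta (1 + r : ℝ)).re := by linarith
  have z2 : (riemannZeta (1 + r : ℝ)).re ≤ 2 / r := by
    have : 2 / r = 1 / r + 1 / r := by ring
    linarith
  clear z
  set z := (riemannZeta (1 + r : ℝ)).re
  set l := (χ.LFunction (1 + r : ℝ)).re
  have hzl : 1 / 2 ≤ z * l := by linarith
  have hl : 0 < l := by
    by_contra hc
    push Not at hc
    nlinarith
  have : 1 / 2 ≤ 2 / r * l := hzl.trans (by gcongr)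
  rw [div_mul_eq_mul_div, le_div_iff₀ hr0] at this
  linarith

lemma exists_zero (h : Good D χ u) : ∃ ρ : ℝ, χ.LFunction ρ = 0 ∧ ρ < 1 ∧ 1 - ρ ≤ 4 * u ^ 2022 := by
  have hu := h.hu
  have hu0 := h.hu0
  have hc : ContinuousOn (fun x : ℝ => (χ.LFunction (x : ℂ)).re) (Set.Icc (1 - 4 * u ^ 2022) (1 + u ^ 8)) := by
    have := (DirichletCharacter.differentiable_LFunction h.ne1).continuous
    exact (Complex.continuous_re.comp (this.comp Complex.continuous_ofReal)).continuousOn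
  have hle : 1 - 4 * u ^ 2022 ≤ 1 + u ^ 8 := by
    have : 0 ≤ u ^ 2022 := by positivity
    have : 0 ≤ u ^ 8 := by positivity
    linarith
  have hlt : (0 : ℝ) ∈ Set.Icc ((χ.LFunction ((1 - 4 * u ^ 2022 : ℝ) : ℂ)).re) ((χ.LFunction ((1 + u ^ 8 : ℝ) : ℂ)).re) := by
    refine ⟨h.L_neg.le, le_trans (by positivity) h.L_pos⟩
  obtain ⟨ρ, hρ, h0⟩ := intermediate_value_Icc hle hc hlt
  have h4 : 4 * u ^ 2022 ≤ 1 / 2 := by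
    have := h.pow_small (k := 2022) (by norm_num)
    linarith
  have hz : χ.LFunction ρ = 0 := by
    apply Complex.ext
    · simpa using h0
    · simpa using L_real h.ne1 h.real (x := ρ) (by linarith [hρ.1])
  refine ⟨ρ, hz, ?_, by linarith [hρ.1]⟩
  by_contra hcon
  push Not at hcon
  refine DirichletCharacter.LFunction_ne_zero_of_one_le_re χ (.inl h.ne1) (s := ρ) ?_ hz
  simpa using hcon

lemma L_bound (h : Good D χ u) {s : ℂ} (hs : ‖s - 1‖ < 2 * u) : ‖χ.LFunction s‖ ≤ 10 * Real.exp 16 * u⁻¹ := by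
  have hu := h.hu
  have hu0 := h.hu0
  have hD1 := h.D1
  have hD0 := h.hDpos
  have hre := (Complex.abs_re_le_norm (s - 1)).trans_lt hs
  rw [Complex.sub_re, Complex.one_re, abs_lt] at hre
  have hσ : 1 - 2 * u < s.re := by linarith
  have a := approx_L h.ne1 (NN_pos D) (s := s) (by linarith)
  have b : ‖∑ n ∈ Finset.Icc 1 (NN D), χ (n : ZMod D) * (n : ℂ) ^ (-s)‖ ≤ Real.exp 16 * (1 + 8 * u⁻¹) := by
    rw [Icc_one_eq_Ioc]
    calc _ ≤ ∑ n ∈ Finset.Ioc 0 (NN D), Real.exp 16 * (1 / n) := by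
          refine (norm_sum_le _ _).trans (Finset.sum_le_sum fun n hn => ?_)
          rw [norm_mul]
          calc _ ≤ 1 * (Real.exp 16 / n) :=
                mul_le_mul (χ.norm_le_one _) (h.pow_bound hσ n hn) (norm_nonneg _) zero_le_one
            _ = _ := by ring
      _ = Real.exp 16 * ∑ n ∈ Finset.Ioc 0 (NN D), (1 : ℝ) / n := by rw [Finset.mul_sum]
      _ ≤ _ := by
        have := sum_inv_le (NN D)
        rw [h.logNN] at this
        gcongr
  have hsn : ‖s‖ ≤ 2 := by
    calc ‖s‖ = ‖(s - 1) + 1‖ := by congr 1; ring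
      _ ≤ 2 * u + 1 := (norm_add_le _ _).trans (by simp; linarith)
      _ ≤ 2 := by linarith
  have c : ‖s‖ * (4 * D * (NN D : ℝ) ^ (-s.re) / s.re) ≤ Real.exp 16 * 16 := by
    have hb := h.pow_bound hσ (NN D) (by simp; exact NN_pos D)
    rw [Complex.norm_natCast_cpow_of_pos (NN_pos D), Complex.neg_re] at hb
    have hr : (1 : ℝ) / 2 ≤ s.re := by linarith
    have hN : (D : ℝ) ≤ NN D := by
      have : D ≤ NN D := by
        have := NeZero.pos D
        calc D = D ^ 1 := by simp
          _ ≤ D ^ 8 := Nat.pow_le_pow_right this (by norm_num)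
          _ = NN D := by rw [NN]; ring
      exact_mod_cast this
    calc _ ≤ 2 * (4 * D * (Real.exp 16 / NN D) / (1 / 2)) := by gcongr
      _ ≤ 2 * (4 * D * (Real.exp 16 / D) / (1 / 2)) := by gcongr
      _ = _ := by field_simp; norm_num
  have hl1 : 1000000 ≤ u⁻¹ := by
    rw [le_inv_comm₀ (by norm_num) hu0]; simpa using hu
  have hQ := h.Q1
  calc _ = ‖(χ.LFunction s - ∑ n ∈ Finset.Icc 1 (NN D), χ (n : ZMod D) * (n : ℂ) ^ (-s)) + ∑ n ∈ Finset.Icc 1 (NN D), χ (n : ZMod D) * (n : ℂ) ^ (-s)‖ := by congr 1; ring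
    _ ≤ Real.exp 16 * 16 + Real.exp 16 * (1 + 8 * u⁻¹) := (norm_add_le _ _).trans (add_le_add (a.trans c) b)
    _ ≤ _ := by nlinarith

end Good

/-- Second-order estimate at a zero. -/
lemma dslope_est {f : ℂ → ℂ} (hf : Differentiable ℂ f) {ρ : ℂ} (h0 : f ρ = 0) {R B : ℝ} (hR : 0 < R) (hB : 0 < B)
    (hfB : ∀ z ∈ Metric.ball ρ R, ‖f z‖ ≤ B) {z : ℂ} (hz : z ∈ Metric.ball ρ R) :
    ‖dslope f ρ z - deriv f ρ‖ ≤ 5 * B / R ^ 2 * ‖z - ρ‖ := by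
  have hρ : ρ ∈ Metric.ball ρ R := Metric.mem_ball_self hR
  have h1 : ∀ z ∈ Metric.ball ρ R, ‖dslope f ρ z‖ ≤ 2 * B / R := by
    intro z hz
    refine Complex.norm_dslope_le_div_of_mapsTo_ball hf.differentiableOn ?_ hz
    intro w hw
    rw [Metric.mem_closedBall, h0, dist_zero_right]
    linarith [hfB w hw]
  have hd : DifferentiableOn ℂ (dslope f ρ) (Metric.ball ρ R) :=
    (Complex.differentiableOn_dslope (Metric.isOpen_ball.mem_nhds hρ)).2 hf.differentiableOn
  have h2 : ‖dslope (dslope f ρ) ρ z‖ ≤ (5 * B / R) / R := by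
    refine Complex.norm_dslope_le_div_of_mapsTo_ball hd ?_ hz
    intro w hw
    rw [Metric.mem_closedBall, dist_eq_norm]
    refine (norm_sub_le _ _).trans ((add_le_add (h1 w hw) (h1 ρ hρ)).trans ?_)
    rw [← add_div]; gcongr; linarith
  have e : dslope f ρ z - deriv f ρ = (z - ρ) * dslope (dslope f ρ) ρ z := by
    have := sub_smul_dslope (dslope f ρ) ρ z
    rw [dslope_same f, smul_eq_mul] at this
    exact this.symm
  rw [e, norm_mul]
  calc _ ≤ ‖z - ρ‖ * ((5 * B / R) / R) := by gcongr
    _ = _ := by field_simp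

namespace Good
variable {D : ℕ} [NeZero D] {χ : DirichletCharacter ℂ D} {u : ℝ}

lemma taylor (h : Good D χ u) {ρ : ℝ} (h0 : χ.LFunction ρ = 0) (h1 : ρ < 1) (h2 : 1 - ρ ≤ 4 * u ^ 2022)
    {z : ℂ} (hz : ‖z - 1‖ ≤ u ^ 8) :
    ‖dslope χ.LFunction ρ z - deriv χ.LFunction ρ‖ ≤ 1 / 100 := by
  have hu := h.hu
  have hu0 := h.hu0
  have hQ1 := h.Q1
  have hQ := h.hQ
  have hr : 4 * u ^ 2022 ≤ u ^ 8 := by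
    have a : u ^ 2022 = u ^ 2014 * u ^ 8 := by ring
    have b := h.pow_small (k := 2014) (by norm_num)
    have c : 0 < u ^ 8 := by positivity
    rw [a]; nlinarith
  have hru : u ^ 8 ≤ u / 4 := by
    have : u ^ 8 = u ^ 7 * u := by ring
    have := h.pow_small (k := 7) (by norm_num)
    nlinarith
  have hd : ‖(1 : ℂ) - ρ‖ ≤ u ^ 8 := by
    have : (1 : ℂ) - ρ = ((1 - ρ : ℝ) : ℂ) := by push_cast; ring
    rw [this, Complex.norm_real, Real.norm_of_nonneg (by linarith)]; linarith
  have hzρ : ‖z - ρ‖ ≤ 2 * u ^ 8 := by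
    calc ‖z - ρ‖ = ‖(z - 1) + (1 - ρ)‖ := by congr 1; ring
      _ ≤ u ^ 8 + u ^ 8 := (norm_add_le _ _).trans (add_le_add hz hd)
      _ = _ := by ring
  have hB : ∀ w ∈ Metric.ball (ρ : ℂ) u, ‖χ.LFunction w‖ ≤ 10 * Real.exp 16 * u⁻¹ := by
    intro w hw
    apply h.L_bound
    rw [Metric.mem_ball, dist_eq_norm] at hw
    calc ‖w - 1‖ = ‖(w - ρ) - (1 - ρ)‖ := by congr 1; ring
      _ ≤ ‖w - ρ‖ + ‖(1 : ℂ) - ρ‖ := norm_sub_le _ _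
      _ < 2 * u := by linarith
  have := dslope_est (DirichletCharacter.differentiable_LFunction h.ne1) h0 hu0 (by positivity) hB
    (z := z) (by rw [Metric.mem_ball, dist_eq_norm]; linarith)
  refine this.trans ?_
  calc _ ≤ 5 * (10 * Real.exp 16 * u⁻¹) / u ^ 2 * (2 * u ^ 8) := by gcongr
    _ = (Real.exp 16 * u) * (100 * u ^ 4) := by field_simp; norm_num
    _ ≤ 1 * (1 / 100) := by
      have := h.pow_small (k := 4) (by norm_num)
      gcongr
      · nlinarith
      · linarith
    _ = _ := by ring

lemma deriv_big (h : Good D χ u) {ρ : ℝ} (h0 : χ.LFunction ρ = 0) (h1 : ρ < 1) (h2 : 1 - ρ ≤ 4 * u ^ 2022) :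
    1 / 10 ≤ ‖deriv χ.LFunction ρ‖ := by
  have hu := h.hu
  have hu0 := h.hu0
  have hr : 4 * u ^ 2022 ≤ u ^ 8 := by
    have a : u ^ 2022 = u ^ 2014 * u ^ 8 := by ring
    have b := h.pow_small (k := 2014) (by norm_num)
    have c : 0 < u ^ 8 := by positivity
    rw [a]; nlinarith
  have c : 0 < u ^ 8 := by positivity
  set z : ℂ := ((1 + u ^ 8 : ℝ) : ℂ) with hz
  have t := h.taylor h0 h1 h2 (z := z) (by
    have : z - 1 = ((u ^ 8 : ℝ) : ℂ) := by rw [hz]; push_cast; ring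
    rw [this, Complex.norm_real, Real.norm_of_nonneg c.le])
  have e := sub_smul_dslope χ.LFunction (ρ : ℂ) z
  rw [h0, sub_zero, smul_eq_mul] at e
  have e2 := congrArg norm e
  have hzρ : ‖z - ρ‖ ≤ 2 * u ^ 8 := by
    have : z - ρ = ((1 + u ^ 8 - ρ : ℝ) : ℂ) := by rw [hz]; push_cast; ring
    rw [this, Complex.norm_real, Real.norm_of_nonneg (by linarith)]; linarith
  have hL : u ^ 8 / 4 ≤ ‖χ.LFunction z‖ := h.L_pos.trans ((le_abs_self _).trans (Complex.abs_re_le_norm _))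
  rw [norm_mul] at e2
  have hdl : 1 / 8 ≤ ‖dslope χ.LFunction ρ z‖ := by
    have : u ^ 8 / 4 ≤ 2 * u ^ 8 * ‖dslope χ.LFunction ρ z‖ := by
      calc _ ≤ _ := hL
        _ = _ := e2.symm
        _ ≤ _ := by gcongr
    by_contra hc
    push Not at hc
    nlinarith
  have := norm_sub_norm_le (dslope χ.LFunction ρ z) (deriv χ.LFunction ρ)
  linarith

theorem main (h : Good D χ u) : ∃ ρ : ℝ, χ.LFunction ρ = 0 ∧ ρ < 1 ∧ 1 - ρ ≤ 4 * u ^ 2022 ∧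
    deriv χ.LFunction ρ ≠ 0 ∧ ∀ s : ℂ, 1 - 2 * u < s.re → |s.im| < 2 * (D : ℝ) → χ.LFunction s = 0 → s = ρ := by
  obtain ⟨ρ, h0, h1, h2⟩ := h.exists_zero
  have hb := h.deriv_big h0 h1 h2
  refine ⟨ρ, h0, h1, h2, ?_, ?_⟩
  · intro hc; rw [hc] at hb; norm_num at hb
  · intro s hσ ht hs
    have hlt : s.re < 1 := by
      by_contra hc
      push Not at hc
      exact DirichletCharacter.LFunction_ne_zero_of_one_le_re χ (.inl h.ne1) hc hs
    have hnear : ‖s - 1‖ < u ^ 10 := by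
      by_contra hc
      push Not at hc
      exact h.zero_free hσ hlt ht hc hs
    by_contra hne
    have t := h.taylor h0 h1 h2 (z := s) (hnear.le.trans
      (pow_le_pow_of_le_one h.hu0.le (by linarith [h.hu]) (by norm_num)))
    have e := sub_smul_dslope χ.LFunction (ρ : ℂ) s
    rw [h0, hs, sub_zero, smul_eq_mul, mul_eq_zero] at e
    have e0 : dslope χ.LFunction ρ s = 0 := e.resolve_left (sub_ne_zero.2 hne)
    rw [e0, zero_sub, norm_neg] at t
    linarith

end Good

lemma zeta_near : ∃ η : ℝ, 0 < η ∧ ∃ C : ℝ, ∀ x : ℝ, x ≠ 0 → |x| ≤ η →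
    ‖riemannZeta (1 + x : ℝ) - ((1 / x : ℝ) : ℂ)‖ ≤ C := by
  have h := tendsto_riemannZeta_sub_one_div.norm.eventually_le_const (lt_add_one _)
  rw [eventually_nhdsWithin_iff, Metric.eventually_nhds_iff] at h
  obtain ⟨η, hη, h⟩ := h
  refine ⟨η / 2, by positivity, ‖((Real.eulerMascheroniConstant : ℝ) : ℂ)‖ + 1, fun x hx0 hx => ?_⟩
  have hd : ((1 + x : ℝ) : ℂ) - 1 = (x : ℂ) := by push_cast; ring
  have := h (y := ((1 + x : ℝ) : ℂ)) (by
    rw [dist_eq_norm, hd, Complex.norm_real, Real.norm_eq_abs]; linarith) (by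
    intro hc
    rw [Set.mem_singleton_iff] at hc
    rw [hc, sub_self] at hd
    exact hx0 (by exact_mod_cast hd.symm))
  rw [hd] at this
  push_cast at this ⊢
  exact this

lemma large_D : ∃ D₀ : ℕ, ∀ D : ℕ, D₀ ≤ D → ∀ (_ : NeZero D) (χ : DirichletCharacter ℂ D),
    IsRealChar χ → χ.IsPrimitive → (χ.LFunction 1).re < bigL D ^ (-2022 : ℤ) → Good D χ (bigL D)⁻¹ := by
  obtain ⟨η, hη, C, hz⟩ := zeta_near
  have hlog : Filter.Tendsto (fun D : ℕ => Real.log D) Filter.atTop Filter.atTop :=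
    Real.tendsto_log_atTop.comp tendsto_natCast_atTop_atTop
  have hpow : ∀ᶠ D : ℕ in Filter.atTop, Real.log D ^ 20 ≤ (D : ℝ) := by
    have := (Real.isLittleO_pow_log_id_atTop (n := 20)).bound (c := 1) one_pos
    have := (tendsto_natCast_atTop_atTop (R := ℝ)).eventually this
    filter_upwards [this] with D hD
    simp only [one_mul, id, Real.norm_eq_abs] at hD
    rw [abs_of_nonneg (by positivity : (0 : ℝ) ≤ D)] at hD
    exact (le_abs_self _).trans hD
  have hall := ((((hlog.eventually_ge_atTop 1000000).and (hlog.eventually_ge_atTop (Real.exp 16 ^ 2))).and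
    ((hlog.eventually_ge_atTop η⁻¹).and (hlog.eventually_ge_atTop C))).and hpow).and (Filter.eventually_ge_atTop 2)
  obtain ⟨D₀, hD₀⟩ := Filter.eventually_atTop.1 hall
  refine ⟨D₀, fun D hD _ χ hr hp hA => ?_⟩
  obtain ⟨⟨⟨⟨h1, h2⟩, h3, h4⟩, h5⟩, h6⟩ := hD₀ D hD
  rw [bigL] at hA ⊢
  set l := Real.log D
  have hl0 : 0 < l := by linarith
  have hne := chi_ne_one_of_prim h6 hp
  have hsq := chi_sq_of_real hr
  refine ⟨hne, hsq, hr, (inv_inv _).symm, by positivity, ?_, ?_, ?_, ?_, ?_⟩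
  · rw [inv_le_comm₀ hl0 (by norm_num)]; norm_num; exact h1
  · rw [← div_eq_mul_inv, div_le_one hl0]; exact h2
  · rw [inv_pow]; exact inv_anti₀ (by positivity) h5
  · have r := L_one_nonneg hne hsq
    have i := L_real hne hr (x := 1) one_pos
    rw [Complex.ofReal_one] at i
    have e : χ.LFunction 1 = ((χ.LFunction 1).re : ℂ) := by apply Complex.ext <;> simp [i]
    rw [e, Complex.norm_real, Real.norm_of_nonneg r, inv_pow]
    have : l ^ (-2022 : ℤ) = (l ^ 2022)⁻¹ := by rw [zpow_neg]; norm_cast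
    rw [← this]; exact hA.le
  · intro x hx0 hx
    rw [inv_inv]
    refine (hz x hx0 (hx.trans ?_)).trans h4
    rw [inv_le_comm₀ hl0 hη]; exact h3

/-- Under (A), `L(s,χ)` has a simple real zero `ρ̃ < 1` with
`1 - ρ̃ ≤ C 𝓛^{-2022}`, and no other zero in the region `Re s > 1 - 2𝓛⁻¹`, `|Im s| < 2D`. -/
theorem statement14 :
    ∃ C : ℝ, 0 < C ∧ ∃ D₀ : ℕ, ∀ D : ℕ, D₀ ≤ D → ∀ χ : DirichletCharacter ℂ D,
      IsRealChar χ → χ.IsPrimitive → AssumptionA D χ →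
        ∃ ρ' : ℝ, Lfun χ (ρ' : ℂ) = 0 ∧ ρ' < 1 ∧ 1 - ρ' ≤ C * bigL D ^ (-2022 : ℤ) ∧
          deriv (Lfun χ) (ρ' : ℂ) ≠ 0 ∧
          ∀ s : ℂ, 1 - 2 * (bigL D)⁻¹ < s.re → |s.im| < 2 * (D : ℝ) →
            Lfun χ s = 0 → s = (ρ' : ℂ) := by
  obtain ⟨D₀, h⟩ := large_D
  refine ⟨4, by norm_num, max D₀ 1, fun D hD χ hr hp hA => ?_⟩
  have hD0 : D ≠ 0 := by have := le_of_max_le_right hD; omega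
  haveI : NeZero D := ⟨hD0⟩
  have hfun : Lfun χ = χ.LFunction := by funext s; simp [Lfun, hD0]
  rw [AssumptionA, hfun] at hA
  rw [hfun]
  obtain ⟨ρ, a, b, c, d, e⟩ := (h D (le_of_max_le_left hD) this χ hr hp hA).main
  refine ⟨ρ, a, b, ?_, d, e⟩
  rwa [show bigL D ^ (-2022 : ℤ) = (bigL D)⁻¹ ^ 2022 by rw [zpow_neg, inv_pow]; norm_cast]

end
end

section
/- There is a positive absolute constant c such that the following holds. If Assumption (A) holds, then L'(1,χ) ≥ c·D/φ(D), where L'(1,χ) is the derivative of L(s,χ) at s = 1 and φ is Euler's totient function. -/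
open scoped Classical

noncomputable section

lemma prod_one_sub_sq_ge (n : ℕ) (P : Finset ℕ) (hP : P ⊆ Finset.Icc 2 n) :
    (1/2 : ℝ) ≤ ∏ p ∈ P, (1 - ((p : ℝ)⁻¹)^2) := by
  have key : ∀ m : ℕ, 1 ≤ m → (1/2 : ℝ) ≤ ∏ p ∈ Finset.Icc 2 m, (1 - ((p : ℝ)⁻¹)^2) := by
    intro m hm
    have : ∏ p ∈ Finset.Icc 2 m, (1 - ((p : ℝ)⁻¹)^2) = ((m : ℝ) + 1) / (2 * m) := by
      induction m, hm using Nat.le_induction with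
      | base => norm_num
      | succ k hk ih =>
        rw [Finset.prod_Icc_succ_top (by omega), ih]
        have : (k : ℝ) ≠ 0 := by positivity
        have h2 : (k : ℝ) + 1 ≠ 0 := by positivity
        push_cast
        field_simp
        ring
    rw [this]
    have : (0 : ℝ) < m := by exact_mod_cast hm
    rw [div_le_div_iff₀ (by norm_num) (by positivity)]
    linarith
  rcases Nat.eq_zero_or_pos n with rfl | hn
  · have : P = ∅ := by simpa using hP
    subst this; norm_num
  refine (key n hn).trans ?_
  have h01 : ∀ i ∈ Finset.Icc 2 n, 0 ≤ 1 - ((i : ℝ)⁻¹)^2 := by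
    intro i hi
    have : (2 : ℝ) ≤ i := by exact_mod_cast (Finset.mem_Icc.1 hi).1
    have h3 : (i : ℝ)⁻¹ ≤ 1 := inv_le_one_of_one_le₀ (by linarith)
    have : 0 ≤ (i : ℝ)⁻¹ := by positivity
    nlinarith
  rw [← Finset.prod_sdiff hP]
  refine mul_le_of_le_one_left (Finset.prod_nonneg fun i hi => h01 i (hP hi)) ?_
  refine Finset.prod_le_one (fun i hi => h01 i (Finset.sdiff_subset hi)) (fun i _ => ?_)
  have : 0 ≤ ((i : ℝ)⁻¹)^2 := by positivity
  linarith

lemma sum_inv_divisors_ge (D : ℕ) (hD : D ≠ 0) :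
    (1/2 : ℝ) * (D / Nat.totient D) ≤ ∑ d ∈ D.divisors, (d : ℝ)⁻¹ := by
  have hφ : (0 : ℝ) < Nat.totient D := by exact_mod_cast Nat.totient_pos.2 (Nat.pos_of_ne_zero hD)
  have hD' : (0 : ℝ) < D := by exact_mod_cast Nat.pos_of_ne_zero hD
  have h1 : (Nat.totient D : ℝ) = D * ∏ p ∈ D.primeFactors, (1 - (p : ℝ)⁻¹) := by
    have := congrArg (fun q : ℚ => (q : ℝ)) (Nat.totient_eq_mul_prod_factors D)
    push_cast at this
    exact this
  have h2 : ∏ p ∈ D.primeFactors, (1 + (p : ℝ)⁻¹) ≤ ∑ d ∈ D.divisors, (d : ℝ)⁻¹ := by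
    rw [Finset.prod_one_add]
    have e : ∀ T ∈ D.primeFactors.powerset, ∏ i ∈ T, (i : ℝ)⁻¹ = (((∏ i ∈ T, i : ℕ)) : ℝ)⁻¹ := by
      intro T _; push_cast; rw [Finset.prod_inv_distrib]
    rw [Finset.sum_congr rfl e]
    have inj : Set.InjOn (fun T : Finset ℕ => ∏ i ∈ T, i) (D.primeFactors.powerset : Set (Finset ℕ)) := by
      intro T hT U hU h
      simp only [Finset.coe_powerset, Set.mem_preimage, Set.mem_powerset_iff, Finset.coe_subset] at hT hU
      have := congrArg Nat.primeFactors h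
      simp only at this
      rwa [Nat.primeFactors_prod (fun p hp => Nat.prime_of_mem_primeFactors (hT hp)),
        Nat.primeFactors_prod (fun p hp => Nat.prime_of_mem_primeFactors (hU hp))] at this
    rw [← Finset.sum_image (f := fun d : ℕ => (d : ℝ)⁻¹) inj]
    refine Finset.sum_le_sum_of_subset_of_nonneg ?_ (fun _ _ _ => by positivity)
    intro d hd
    obtain ⟨T, hT, rfl⟩ := Finset.mem_image.1 hd
    rw [Nat.mem_divisors]
    exact ⟨(Finset.prod_dvd_prod_of_subset _ _ _ (Finset.mem_powerset.1 hT)).trans (Nat.prod_primeFactors_dvd D), hD⟩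
  refine le_trans ?_ h2
  have h3 := prod_one_sub_sq_ge D D.primeFactors (by
    intro p hp
    exact Finset.mem_Icc.2 ⟨(Nat.prime_of_mem_primeFactors hp).two_le, Nat.le_of_mem_primeFactors hp⟩)
  have h4 : ∏ p ∈ D.primeFactors, (1 - ((p : ℝ)⁻¹)^2) =
      (∏ p ∈ D.primeFactors, (1 + (p : ℝ)⁻¹)) * ∏ p ∈ D.primeFactors, (1 - (p : ℝ)⁻¹) := by
    rw [← Finset.prod_mul_distrib]
    exact Finset.prod_congr rfl fun p _ => by ring
  have h5 : (D : ℝ) / Nat.totient D * ∏ p ∈ D.primeFactors, (1 - (p : ℝ)⁻¹) = 1 := by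
    rw [div_mul_eq_mul_div, ← h1, div_self hφ.ne']
  have h6 : 0 < ∏ p ∈ D.primeFactors, (1 - (p : ℝ)⁻¹) := by
    have := hφ; rw [h1] at this; exact (pos_iff_pos_of_mul_pos this).1 hD'
  rw [h4] at h3
  refine le_of_mul_le_mul_right ?_ h6
  rw [mul_assoc, h5]; linarith

/-- Abel summation bound -/
lemma abel_bound (c : ℕ → ℂ) (f : ℕ → ℝ) (C : ℝ) (hC : ∀ k, ‖∑ i ∈ Finset.range k, c i‖ ≤ C)
    (hf : Antitone f) (hf0 : ∀ n, 0 ≤ f n) (n : ℕ) :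
    ‖∑ i ∈ Finset.range n, c i * (f i : ℂ)‖ ≤ C * f 0 := by
  have hC0 : 0 ≤ C := (norm_nonneg _).trans (hC 0)
  rcases n with _ | n
  · simpa using mul_nonneg hC0 (hf0 0)
  have key : ∀ m : ℕ, ∑ i ∈ Finset.range (m+1), c i * (f i : ℂ) =
      (∑ i ∈ Finset.range (m+1), c i) * (f m : ℂ) +
      ∑ j ∈ Finset.range m, (∑ i ∈ Finset.range (j+1), c i) * ((f j - f (j+1) : ℝ) : ℂ) := by
    intro m
    induction m with
    | zero => simp
    | succ m ih =>
      rw [Finset.sum_range_succ, ih, Finset.sum_range_succ (fun j => (∑ i ∈ Finset.range (j+1), c i) * ((f j - f (j+1) : ℝ) : ℂ)) m, Finset.sum_range_succ c (m+1)]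
      push_cast
      ring
  rw [key]
  calc _ ≤ C * f n + ∑ j ∈ Finset.range n, C * (f j - f (j+1)) := by
        refine (norm_add_le _ _).trans (add_le_add ?_ ((norm_sum_le _ _).trans (Finset.sum_le_sum ?_)))
        · rw [norm_mul, Complex.norm_real, Real.norm_of_nonneg (hf0 _)]
          exact mul_le_mul_of_nonneg_right (hC _) (hf0 _)
        · intro j _
          have : 0 ≤ f j - f (j+1) := sub_nonneg.2 (hf (Nat.le_succ j))
          rw [norm_mul, Complex.norm_real, Real.norm_of_nonneg this]
          exact mul_le_mul_of_nonneg_right (hC _) this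
    _ = C * f 0 := by
        rw [← Finset.mul_sum, Finset.sum_range_sub']; ring

lemma char_sum_bound (D : ℕ) [NeZero D] (χ : DirichletCharacter ℂ D) (hχ : χ ≠ 1) (k : ℕ) :
    ‖∑ i ∈ Finset.range k, χ (i : ZMod D)‖ ≤ D := by
  have per : ∀ a : ℕ, ∑ i ∈ Finset.range D, χ ((a + i : ℕ) : ZMod D) = 0 := by
    intro a
    have h0 : ∑ x : ZMod D, χ ((a : ZMod D) + x) = 0 := by
      rw [← MulChar.sum_eq_zero_of_ne_one hχ]
      exact Fintype.sum_equiv (Equiv.addLeft (a : ZMod D)) _ _ (fun _ => rfl)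
    rw [← h0]
    refine Finset.sum_bij (fun i _ => (i : ZMod D)) (fun _ _ => Finset.mem_univ _) ?_ ?_ ?_
    · intro i hi j hj h
      rw [ZMod.natCast_eq_natCast_iff'] at h
      rwa [Nat.mod_eq_of_lt (Finset.mem_range.1 hi), Nat.mod_eq_of_lt (Finset.mem_range.1 hj)] at h
    · intro b _
      exact ⟨b.val, Finset.mem_range.2 (ZMod.val_lt b), ZMod.natCast_zmod_val b⟩
    · intro i _; push_cast; rfl
  have hq : ∀ q : ℕ, ∑ i ∈ Finset.range (D * q), χ (i : ZMod D) = 0 := by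
    intro q
    induction q with
    | zero => simp
    | succ q ih => rw [Nat.mul_succ, Finset.sum_range_add, ih, per, zero_add]
  rw [← Nat.div_add_mod k D, Finset.sum_range_add, hq, zero_add]
  refine (norm_sum_le _ _).trans ?_
  calc _ ≤ ∑ i ∈ Finset.range (k % D), (1 : ℝ) := Finset.sum_le_sum fun i _ => χ.norm_le_one _
    _ ≤ D := by simpa using (Nat.mod_lt k (NeZero.pos D)).le

lemma char_sum_bound' (D : ℕ) [NeZero D] (χ : DirichletCharacter ℂ D) (hχ : χ ≠ 1) (a k : ℕ) :
    ‖∑ i ∈ Finset.range k, χ ((a + i : ℕ) : ZMod D)‖ ≤ 2 * D := by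
  have h := Finset.sum_range_add (fun i => χ ((i : ℕ) : ZMod D)) a k
  rw [show ∑ i ∈ Finset.range k, χ ((a + i : ℕ) : ZMod D) =
    ∑ i ∈ Finset.range (a + k), χ (i : ZMod D) - ∑ i ∈ Finset.range a, χ (i : ZMod D) by
      rw [h]; ring]
  refine (norm_sub_le _ _).trans ?_
  linarith [char_sum_bound D χ hχ a, char_sum_bound D χ hχ (a+k)]

lemma tail_bound (D : ℕ) [NeZero D] (χ : DirichletCharacter ℂ D) (hχ : χ ≠ 1) (z : ℕ)
    (f : ℕ → ℝ) (hf : AntitoneOn f (Set.Ici z)) (hf0 : ∀ n, 0 ≤ f n) (n : ℕ) :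
    ‖∑ i ∈ Finset.range (z + n), χ (i : ZMod D) * (f i : ℂ) -
      ∑ i ∈ Finset.range z, χ (i : ZMod D) * (f i : ℂ)‖ ≤ 2 * D * f z := by
  rw [Finset.sum_range_add, add_sub_cancel_left]
  refine abel_bound (fun i => χ ((z + i : ℕ) : ZMod D)) (fun i => f (z + i)) (2 * D)
    (char_sum_bound' D χ hχ z) ?_ (fun _ => hf0 _) n
  intro i j hij
  exact hf (by simp) (by simp) (by omega)

lemma tsum_tail_bound (D : ℕ) [NeZero D] (χ : DirichletCharacter ℂ D) (hχ : χ ≠ 1) (z : ℕ)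
    (f : ℕ → ℝ) (hf : AntitoneOn f (Set.Ici z)) (hf0 : ∀ n, 0 ≤ f n) (S : ℂ)
    (hs : HasSum (fun i : ℕ => χ (i : ZMod D) * (f i : ℂ)) S) :
    ‖S - ∑ i ∈ Finset.range z, χ (i : ZMod D) * (f i : ℂ)‖ ≤ 2 * D * f z := by
  have h1 := (hs.tendsto_sum_nat.comp (Filter.tendsto_add_atTop_nat z)).sub_const
    (∑ i ∈ Finset.range z, χ (i : ZMod D) * (f i : ℂ))
  refine le_of_tendsto h1.norm (Filter.Eventually.of_forall fun n => ?_)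
  have := tail_bound D χ hχ z f hf hf0 n
  rwa [add_comm z n] at this

open Filter Topology in
lemma L_bound_gen (D : ℕ) [NeZero D] (χ : DirichletCharacter ℂ D) (hχ : χ ≠ 1) (z : ℕ)
    (F : ℝ → ℂ) (hF : ContinuousAt F 1) (g : ℕ → ℝ) (hg : ∀ n, 0 ≤ g n)
    (hanti : ∀ s : ℝ, 1 < s → AntitoneOn (fun i : ℕ => g i / (i : ℝ) ^ s) (Set.Ici z))
    (hsum : ∀ s : ℝ, 1 < s → HasSum (fun i : ℕ => χ (i : ZMod D) * ((g i / (i : ℝ) ^ s : ℝ) : ℂ)) (F s)) :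
    ‖F 1 - ∑ i ∈ Finset.range z, χ (i : ZMod D) * ((g i / (i : ℝ) : ℝ) : ℂ)‖ ≤
      2 * D * (g z / (z : ℝ)) := by
  have hc : ∀ i : ℕ, ContinuousAt (fun s : ℝ => g i / (i : ℝ) ^ s) 1 := by
    intro i
    rcases Nat.eq_zero_or_pos i with rfl | hi
    · have : (fun s : ℝ => g 0 / ((0 : ℕ) : ℝ) ^ s) =ᶠ[𝓝 1] fun _ => 0 := by
        filter_upwards [lt_mem_nhds (show (0 : ℝ) < 1 by norm_num)] with s hs
        simp [Real.zero_rpow hs.ne']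
      exact (continuousAt_congr this).2 continuousAt_const
    · have hi' : (0 : ℝ) < i := by exact_mod_cast hi
      exact continuousAt_const.div (Real.continuousAt_const_rpow hi'.ne') (by simpa using hi'.ne')
  have h1 : Tendsto (fun s : ℝ => ‖F s - ∑ i ∈ Finset.range z, χ (i : ZMod D) * ((g i / (i : ℝ) ^ s : ℝ) : ℂ)‖)
      (𝓝[>] 1) (𝓝 ‖F 1 - ∑ i ∈ Finset.range z, χ (i : ZMod D) * ((g i / (i : ℝ) ^ (1:ℝ) : ℝ) : ℂ)‖) := by
    refine Tendsto.mono_left (Tendsto.norm (hF.tendsto.sub (tendsto_finsetSum _ fun i _ => ?_))) nhdsWithin_le_nhds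
    exact tendsto_const_nhds.mul ((Complex.continuous_ofReal.tendsto _).comp (hc i).tendsto)
  have h2 : Tendsto (fun s : ℝ => 2 * D * (g z / (z : ℝ) ^ s)) (𝓝[>] 1) (𝓝 (2 * D * (g z / (z : ℝ) ^ (1 : ℝ)))) :=
    Tendsto.mono_left (tendsto_const_nhds.mul (hc z).tendsto) nhdsWithin_le_nhds
  have h3 := le_of_tendsto_of_tendsto h1 h2 (by
    filter_upwards [self_mem_nhdsWithin] with s hs
    exact tsum_tail_bound D χ hχ z _ (hanti s hs) (fun n => div_nonneg (hg n) (by positivity)) _ (hsum s hs))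
  simpa using h3

lemma L_one_bound (D : ℕ) [NeZero D] (χ : DirichletCharacter ℂ D) (hχ : χ ≠ 1) (z : ℕ) (hz : 3 ≤ z) :
    ‖χ.LFunction 1 - ∑ i ∈ Finset.range z, χ (i : ZMod D) * (((1 : ℝ) / (i : ℝ) : ℝ) : ℂ)‖ ≤
      2 * D * (1 / (z : ℝ)) := by
  have := L_bound_gen D χ hχ z (fun s : ℝ => χ.LFunction s) ?_ (fun _ => 1) (fun _ => zero_le_one) ?_ ?_
  · simpa using this
  · exact ((DirichletCharacter.differentiable_LFunction hχ).continuous.comp Complex.continuous_ofReal).continuousAt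
  · intro s hs i hi j hj hij
    have : (0 : ℝ) < i := by
      have : z ≤ i := hi
      exact_mod_cast (by omega)
    have h2 : (i : ℝ) ≤ j := by exact_mod_cast hij
    exact one_div_le_one_div_of_le (by positivity) (Real.rpow_le_rpow this.le h2 (by linarith))
  · intro s hs
    have hs' : 1 < (s : ℂ).re := by simpa
    have h := (DirichletCharacter.LSeriesSummable_of_one_lt_re χ hs').hasSum
    rw [DirichletCharacter.LFunction_eq_LSeries χ hs']
    refine h.congr_fun ?_
    intro i
    rw [LSeries.term_def]
    split_ifs with h0
    · subst h0; simp [Real.zero_rpow (by linarith : s ≠ 0)]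
    · push_cast
      rw [Complex.ofReal_cpow (by positivity)]
      simp [div_eq_mul_inv]

lemma L_deriv_bound (D : ℕ) [NeZero D] (χ : DirichletCharacter ℂ D) (hχ : χ ≠ 1) (z : ℕ) (hz : 3 ≤ z) :
    ‖-deriv χ.LFunction 1 - ∑ i ∈ Finset.range z, χ (i : ZMod D) * ((Real.log i / (i : ℝ) : ℝ) : ℂ)‖ ≤
      2 * D * (Real.log z / (z : ℝ)) := by
  have := L_bound_gen D χ hχ z (fun s : ℝ => -deriv χ.LFunction s) ?_ (fun i => Real.log i)
    (fun i => Real.log_natCast_nonneg i) ?_ ?_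
  · simpa using this
  · have h1 : Continuous (deriv χ.LFunction) :=
      ((DirichletCharacter.differentiable_LFunction hχ).contDiff (n := 1)).continuous_deriv le_rfl
    exact (h1.comp Complex.continuous_ofReal).neg.continuousAt
  · intro s hs i hi j hj hij
    have key : ∀ k : ℕ, k ∈ Set.Ici z → (k : ℝ) ∈ Set.Ici (Real.exp s⁻¹) := by
      intro k hk
      have h3 : z ≤ k := hk
      have h4 : (3 : ℝ) ≤ k := by exact_mod_cast (by omega)
      have h5 : Real.exp s⁻¹ ≤ Real.exp 1 := by
        apply Real.exp_le_exp.2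
        exact inv_le_one_of_one_le₀ hs.le
      have := Real.exp_one_lt_d9
      simp only [Set.mem_Ici]
      linarith
    exact Real.log_div_self_rpow_antitoneOn (by linarith) (key i hi) (key j hj) (by exact_mod_cast hij)
  · intro s hs
    have hs' : 1 < (s : ℂ).re := by simpa
    have ha : LSeries.abscissaOfAbsConv (fun n : ℕ => χ (n : ZMod D)) < (s : ℂ).re := by
      rw [DirichletCharacter.absicssaOfAbsConv_eq_one (NeZero.ne D), ← EReal.coe_one, EReal.coe_lt_coe_iff]
      exact hs'
    have h := (LSeriesSummable_logMul_of_lt_re ha).hasSum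
    have e : -deriv χ.LFunction s = LSeries (LSeries.logMul (fun n : ℕ => χ (n : ZMod D))) s := by
      rw [DirichletCharacter.deriv_LFunction_eq_deriv_LSeries χ hs', LSeries_deriv ha, neg_neg]
    rw [e]
    refine h.congr_fun ?_
    intro i
    rw [LSeries.term_def]
    split_ifs with h0
    · subst h0; simp
    · push_cast
      rw [Complex.ofReal_cpow (by positivity)]
      simp only [LSeries.logMul, Complex.ofReal_natCast]
      ring

lemma real_sq_eq_one (D : ℕ) (χ : DirichletCharacter ℂ D) (h : ∀ a : ZMod D, (χ a).im = 0) :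
    χ ^ 2 = 1 := by
  ext a
  have hn : ‖χ (a : ZMod D)‖ = 1 := DirichletCharacter.unit_norm_eq_one χ a
  have him := h a
  rw [MulChar.pow_apply_coe, MulChar.one_apply_coe]
  have h2 : (χ (a : ZMod D)).re ^ 2 = 1 := by
    have := Complex.sq_norm (χ (a : ZMod D))
    rw [hn, Complex.normSq_apply, him] at this
    nlinarith
  apply Complex.ext
  · simp [pow_two, him]; nlinarith
  · simp [pow_two, him]

lemma nu_re_nonneg (D : ℕ) (χ : DirichletCharacter ℂ D) (h : ∀ a : ZMod D, (χ a).im = 0) (n : ℕ) :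
    0 ≤ (∑ d ∈ n.divisors, χ (d : ZMod D)).re := by
  have h1 := DirichletCharacter.zetaMul_nonneg (real_sq_eq_one D χ h) n
  have h2 : χ.zetaMul n = ∑ d ∈ n.divisors, χ (d : ZMod D) := by
    rw [DirichletCharacter.zetaMul, ArithmeticFunction.coe_zeta_mul_apply]
    refine Finset.sum_congr rfl fun d hd => ?_
    have : d ≠ 0 := (Nat.pos_of_mem_divisors hd).ne'
    simp [toArithmeticFunction, this]
  rw [h2] at h1
  exact (Complex.le_def.1 h1).1

lemma nu_dvd (D : ℕ) (hD : D ≠ 0) (χ : DirichletCharacter ℂ D) (n : ℕ) (hn : n ∣ D) :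
    ∑ d ∈ n.divisors, χ (d : ZMod D) = 1 := by
  have hn0 : n ≠ 0 := fun h => hD (by subst h; simpa using hn)
  rw [Finset.sum_eq_single 1]
  · simp
  · intro d hd h1
    apply MulChar.map_nonunit
    rw [ZMod.isUnit_iff_coprime]
    intro hc
    exact h1 (Nat.eq_one_of_dvd_coprimes (k := d) (a := d) (b := D) hc dvd_rfl ((Nat.dvd_of_mem_divisors hd).trans hn))
  · intro h; exact absurd (Nat.one_mem_divisors.2 hn0) h

lemma S_identity (D : ℕ) (χ : DirichletCharacter ℂ D) (N : ℕ) :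
    ∑ n ∈ Finset.Ioc 0 N, (∑ d ∈ n.divisors, χ (d : ZMod D)) * ((n : ℂ)⁻¹) =
    ∑ i ∈ Finset.range (N + 1), χ (i : ZMod D) * (((harmonic (N / i) : ℝ) / (i : ℝ) : ℝ) : ℂ) := by
  let f : ArithmeticFunction ℂ := ⟨fun n => χ (n : ZMod D) * (n : ℂ)⁻¹, by simp⟩
  let g : ArithmeticFunction ℂ := ⟨fun n => (n : ℂ)⁻¹, by simp⟩
  have h := ArithmeticFunction.sum_Ioc_mul_eq_sum_sum f g N
  have h1 : ∀ n ∈ Finset.Ioc 0 N, (f * g) n = (∑ d ∈ n.divisors, χ (d : ZMod D)) * ((n : ℂ)⁻¹) := by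
    intro n hn
    rw [ArithmeticFunction.mul_apply, Finset.sum_mul, ← Nat.map_div_right_divisors, Finset.sum_map]
    refine Finset.sum_congr rfl fun d hd => ?_
    have hd' := Nat.dvd_of_mem_divisors hd
    change χ (d : ZMod D) * (d : ℂ)⁻¹ * ((n / d : ℕ) : ℂ)⁻¹ = _
    rw [mul_assoc, ← mul_inv, ← Nat.cast_mul, Nat.mul_div_cancel' hd']
  rw [Finset.sum_congr rfl h1] at h
  rw [h]
  have h2 : Finset.range (N+1) = insert 0 (Finset.Ioc 0 N) := by
    ext i; simp only [Finset.mem_range, Finset.mem_insert, Finset.mem_Ioc]; omega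
  rw [h2, Finset.sum_insert (by simp)]
  simp only [Nat.div_zero, harmonic_zero, Rat.cast_zero, zero_div, Complex.ofReal_zero, mul_zero, zero_add]
  refine Finset.sum_congr rfl fun i _ => ?_
  simp only [f, g, ArithmeticFunction.coe_mk, harmonic_eq_sum_Icc]
  push_cast
  rw [show Finset.Ioc 0 (N / i) = Finset.Icc 1 (N/i) from rfl]
  ring

lemma S_lower (D : ℕ) (hD : D ≠ 0) (χ : DirichletCharacter ℂ D) (h : ∀ a : ZMod D, (χ a).im = 0) (N : ℕ)
    (hN : D ≤ N) :
    (1/2 : ℝ) * (D / Nat.totient D) ≤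
      (∑ n ∈ Finset.Ioc 0 N, (∑ d ∈ n.divisors, χ (d : ZMod D)) * ((n : ℂ)⁻¹)).re := by
  refine (sum_inv_divisors_ge D hD).trans ?_
  rw [Complex.re_sum]
  have e : ∀ n : ℕ, ((∑ d ∈ n.divisors, χ (d : ZMod D)) * ((n : ℂ)⁻¹)).re =
      (∑ d ∈ n.divisors, χ (d : ZMod D)).re * (n : ℝ)⁻¹ := by
    intro n
    rw [← Complex.ofReal_natCast, ← Complex.ofReal_inv, Complex.re_mul_ofReal]
  calc _ = ∑ n ∈ D.divisors, ((∑ d ∈ n.divisors, χ (d : ZMod D)) * ((n : ℂ)⁻¹)).re := by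
        refine Finset.sum_congr rfl fun n hn => ?_
        rw [e, nu_dvd D hD χ n (Nat.dvd_of_mem_divisors hn)]; simp
    _ ≤ _ := by
        refine Finset.sum_le_sum_of_subset_of_nonneg ?_ ?_
        · intro n hn
          rw [Finset.mem_Ioc]
          exact ⟨Nat.pos_of_mem_divisors hn, (Nat.divisor_le hn).trans hN⟩
        · intro n _ _
          rw [e]
          exact mul_nonneg (nu_re_nonneg D χ h n) (by positivity)

lemma harmonic_approx (N i M : ℕ) (hM : 0 < M) (hi : 0 < i) (h : M * i ≤ N) :
    |(harmonic (N / i) : ℝ) - (Real.log N + Real.eulerMascheroniConstant) + Real.log i| ≤ 1 / M := by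
  set m := N / i with hm
  have hMm : M ≤ m := (Nat.le_div_iff_mul_le hi).2 h
  have hm0 : 0 < m := by omega
  have hmR : (0 : ℝ) < m := by exact_mod_cast hm0
  have hiR : (0 : ℝ) < i := by exact_mod_cast hi
  have h1 := Real.eulerMascheroniSeq_lt_eulerMascheroniConstant m
  have h2 := Real.eulerMascheroniConstant_lt_eulerMascheroniSeq' m
  simp only [Real.eulerMascheroniSeq, Real.eulerMascheroniSeq', hm0.ne', if_false] at h1 h2
  have hNpos : (0 : ℝ) < N := by
    have : 0 < N := lt_of_lt_of_le (Nat.mul_pos hM hi) h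
    exact_mod_cast this
  have h3 : Real.log m ≤ Real.log N - Real.log i := by
    rw [← Real.log_div hNpos.ne' hiR.ne']
    refine Real.log_le_log hmR ?_
    rw [le_div_iff₀ hiR]; exact_mod_cast Nat.div_mul_le_self N i
  have h4 : Real.log N - Real.log i ≤ Real.log (m + 1) := by
    rw [← Real.log_div hNpos.ne' hiR.ne']
    refine Real.log_le_log (by positivity) ?_
    rw [div_le_iff₀ hiR]
    have := (Nat.lt_div_mul_add (a := N) hi).le
    have h5 : N ≤ (m + 1) * i := by rw [hm]; linarith
    exact_mod_cast h5
  have h5 : Real.log (m + 1) - Real.log m ≤ 1 / M := by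
    rw [← Real.log_div (by positivity) hmR.ne']
    have h6 := Real.log_le_sub_one_of_pos (show (0 : ℝ) < (m + 1) / m by positivity)
    have h7 : ((m : ℝ) + 1) / m - 1 = 1 / m := by field_simp; ring
    have h8 : (1 : ℝ) / m ≤ 1 / M := one_div_le_one_div_of_le (by exact_mod_cast hM) (by exact_mod_cast hMm)
    linarith
  rw [abs_le]
  constructor <;> linarith

lemma main_ineq (D : ℕ) [NeZero D] (hD : 3 ≤ D) (χ : DirichletCharacter ℂ D) (hχ : χ ≠ 1)
    (h : ∀ a : ZMod D, (χ a).im = 0) :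
    (1/2 : ℝ) * (D / Nat.totient D) ≤ (deriv χ.LFunction 1).re +
      ((χ.LFunction 1).re + 2 / D) * (5 * Real.log D + Real.eulerMascheroniConstant) +
      (3 + 10 * Real.log D) / D := by
  have hDR : (0 : ℝ) < D := by exact_mod_cast (by omega : 0 < D)
  have hS := S_lower D (by omega) χ h (D^5) (Nat.le_self_pow (by norm_num) D)
  rw [S_identity] at hS
  set N := D ^ 5 with hN
  set S := ∑ i ∈ Finset.range (N + 1), χ (i : ZMod D) * (((harmonic (N / i) : ℝ) / (i : ℝ) : ℝ) : ℂ) with hSdef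
  have hz : 3 ≤ D ^ 2 := by nlinarith
  have hzN : D ^ 2 ≤ D ^ 5 := Nat.pow_le_pow_right (by omega) (by norm_num)
  have hA := L_one_bound D χ hχ (D^2) hz
  have hB := L_deriv_bound D χ hχ (D^2) hz
  have hT := tail_bound D χ hχ (D^2) (fun i => (harmonic (N / i) : ℝ) / (i : ℝ)) (by
    intro i hi j hj hij
    have hi0 : (0 : ℝ) < i := by
      have : D ^ 2 ≤ i := hi
      exact_mod_cast (by omega)
    have hm : (harmonic (N / j) : ℝ) ≤ harmonic (N / i) := by
      have : harmonic (N / j) ≤ harmonic (N / i) :=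
        Finset.sum_le_sum_of_subset_of_nonneg
          (Finset.range_mono (Nat.div_le_div_left hij (by exact_mod_cast hi0))) (fun _ _ _ => by positivity)
      exact_mod_cast this
    have h0 : (0 : ℝ) ≤ harmonic (N / i) := by
      have : 0 ≤ harmonic (N / i) := Finset.sum_nonneg (fun _ _ => by positivity)
      exact_mod_cast this
    exact div_le_div₀ h0 hm hi0 (by exact_mod_cast hij)) (by
    intro n
    have : 0 ≤ harmonic (N / n) := Finset.sum_nonneg (fun _ _ => by positivity)
    have : (0 : ℝ) ≤ harmonic (N / n) := by exact_mod_cast this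
    positivity) (N + 1 - D^2)
  rw [show D^2 + (N + 1 - D^2) = N + 1 by omega, ← hSdef] at hT
  set A := ∑ i ∈ Finset.range (D^2), χ (i : ZMod D) * (((1 : ℝ) / (i : ℝ) : ℝ) : ℂ) with hAdef
  set B := ∑ i ∈ Finset.range (D^2), χ (i : ZMod D) * ((Real.log i / (i : ℝ) : ℝ) : ℂ) with hBdef
  set S₀ := ∑ i ∈ Finset.range (D^2), χ (i : ZMod D) * (((harmonic (N / i) : ℝ) / (i : ℝ) : ℝ) : ℂ) with hS0def
  set K : ℝ := 5 * Real.log D + Real.eulerMascheroniConstant with hK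
  have hKN : Real.log N + Real.eulerMascheroniConstant = K := by
    rw [hN, hK]; push_cast; rw [Real.log_pow]; norm_num
  have hH : ‖S₀ - (A * (K : ℂ) - B)‖ ≤ 1 / D := by
    rw [hS0def, hAdef, hBdef, Finset.sum_mul, ← Finset.sum_sub_distrib, ← Finset.sum_sub_distrib]
    have hb : ∀ i ∈ Finset.range (D^2), ‖χ (i : ZMod D) * (((harmonic (N / i) : ℝ) / (i : ℝ) : ℝ) : ℂ) -
        (χ (i : ZMod D) * (((1 : ℝ) / (i : ℝ) : ℝ) : ℂ) * (K : ℂ) - χ (i : ZMod D) * ((Real.log i / (i : ℝ) : ℝ) : ℂ))‖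
        ≤ 1 / (D : ℝ)^3 := by
      intro i hi
      have e : χ (i : ZMod D) * (((harmonic (N / i) : ℝ) / (i : ℝ) : ℝ) : ℂ) -
        (χ (i : ZMod D) * (((1 : ℝ) / (i : ℝ) : ℝ) : ℂ) * (K : ℂ) - χ (i : ZMod D) * ((Real.log i / (i : ℝ) : ℝ) : ℂ)) =
        χ (i : ZMod D) * ((((harmonic (N / i) : ℝ) - K + Real.log i) / i : ℝ) : ℂ) := by
        push_cast; ring
      rw [e, norm_mul, Complex.norm_real, Real.norm_eq_abs]
      rcases Nat.eq_zero_or_pos i with rfl | hi0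
      · simp
      have h1 := harmonic_approx N i (D^3) (by positivity) hi0 (by
        have : i ≤ D^2 := (Finset.mem_range.1 hi).le
        calc D^3 * i ≤ D^3 * D^2 := Nat.mul_le_mul_left _ this
          _ = N := by rw [hN]; ring)
      rw [hKN] at h1
      push_cast at h1
      have hi1 : (1 : ℝ) ≤ i := by exact_mod_cast hi0
      rw [abs_div, Nat.abs_cast]
      calc _ ≤ 1 * (|(harmonic (N / i) : ℝ) - K + Real.log i| / i) := by
            exact mul_le_mul_of_nonneg_right (χ.norm_le_one _) (by positivity)
        _ ≤ |(harmonic (N / i) : ℝ) - K + Real.log i| := by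
            rw [one_mul]; exact div_le_self (abs_nonneg _) hi1
        _ ≤ _ := h1
    refine (norm_sum_le _ _).trans ((Finset.sum_le_sum hb).trans ?_)
    rw [Finset.sum_const, Finset.card_range, nsmul_eq_mul]
    push_cast
    apply le_of_eq
    field_simp
  have hT' : ‖S - S₀‖ ≤ (2 + 6 * Real.log D) / D := by
    refine hT.trans ?_
    have h1 := harmonic_le_one_add_log (N / D^2)
    rw [show N / D^2 = D^3 by
      rw [hN, show D^5 = D^3 * D^2 by ring, Nat.mul_div_cancel _ (by positivity)]] at h1 ⊢
    push_cast at h1 ⊢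
    rw [Real.log_pow] at h1
    push_cast at h1
    rw [show 2 * (D : ℝ) * ((harmonic (D^3) : ℝ) / (D : ℝ)^2) = 2 * (harmonic (D^3) : ℝ) / D by field_simp]
    exact div_le_div_of_nonneg_right (by linarith) hDR.le
  have hA' : ‖χ.LFunction 1 - A‖ ≤ 2 / D := by
    refine hA.trans (le_of_eq ?_)
    push_cast; field_simp
  have hB' : ‖-deriv χ.LFunction 1 - B‖ ≤ 4 * Real.log D / D := by
    refine hB.trans (le_of_eq ?_)
    push_cast; rw [Real.log_pow]; push_cast; field_simp; ring
  have rA := (abs_le.1 ((Complex.abs_re_le_norm _).trans hA')).1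
  have rB := (abs_le.1 ((Complex.abs_re_le_norm _).trans hB')).1
  have rH := (abs_le.1 ((Complex.abs_re_le_norm _).trans hH)).2
  have rT := (abs_le.1 ((Complex.abs_re_le_norm _).trans hT')).2
  simp only [Complex.sub_re, Complex.neg_re, Complex.re_mul_ofReal] at rA rB rH rT
  have hK0 : 0 ≤ K := by
    have := Real.one_half_lt_eulerMascheroniConstant
    have := Real.log_natCast_nonneg D
    rw [hK]; linarith
  have rB2 := (abs_le.1 ((Complex.abs_re_le_norm _).trans hB')).2
  simp only [Complex.sub_re, Complex.neg_re] at rB2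
  have hAK : A.re * K ≤ ((χ.LFunction 1).re + 2 / D) * K := mul_le_mul_of_nonneg_right (by linarith) hK0
  have e : (3 + 10 * Real.log D) / D = (2 + 6 * Real.log D) / D + 1 / D + 4 * Real.log D / D := by ring
  rw [e]
  linarith

/-- Under (A), `L'(1,χ) ≥ c D / φ(D)`. -/
theorem statement16 :
    ∃ c : ℝ, 0 < c ∧ ∃ D₀ : ℕ, ∀ D : ℕ, D₀ ≤ D → ∀ χ : DirichletCharacter ℂ D,
      IsRealChar χ → χ.IsPrimitive → AssumptionA D χ →
        c * (D : ℝ) / (Nat.totient D : ℝ) ≤ (deriv (Lfun χ) 1).re := by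
  refine ⟨1/4, by norm_num, ⌈Real.exp 400⌉₊, ?_⟩
  intro D hD χ hreal hprim hA
  have hDe : Real.exp 400 ≤ D := Nat.ceil_le.1 hD
  have hDpos : (0 : ℝ) < D := (Real.exp_pos _).trans_le hDe
  have hl : 400 ≤ Real.log D := (Real.le_log_iff_exp_le hDpos).2 hDe
  have hD3 : 3 ≤ D := by
    have h1 := Real.add_one_le_exp (400 : ℝ)
    have : (3 : ℝ) ≤ D := by linarith
    exact_mod_cast this
  have hD0 : D ≠ 0 := by omega
  have : NeZero D := ⟨hD0⟩
  have hL : Lfun χ = χ.LFunction := by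
    funext s; simp [Lfun, hD0]
  have hχ : χ ≠ 1 := by
    rintro rfl
    have h1 : (1 : DirichletCharacter ℂ D).conductor = D := hprim
    rw [DirichletCharacter.conductor_one] at h1
    omega
  have hmain := main_ineq D hD3 χ hχ hreal
  unfold AssumptionA bigL at hA
  rw [hL] at hA ⊢
  set l := Real.log D with hldef
  have hγ := Real.eulerMascheroniConstant_lt_two_thirds
  have hγ0 := Real.one_half_lt_eulerMascheroniConstant
  have hpow : l ^ (-2022 : ℤ) ≤ l ^ (-2 : ℤ) := zpow_le_zpow_right₀ (by linarith) (by norm_num)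
  have hpow2 : l ^ (-2 : ℤ) = 1 / (l * l) := by
    rw [zpow_neg, one_div]; congr 1; rw [← pow_two]; norm_cast
  have hDl : l * l / 2 ≤ D := by
    have h1 := Real.quadratic_le_exp_of_nonneg (show 0 ≤ l by linarith)
    rw [hldef, Real.exp_log hDpos] at h1
    nlinarith
  have hlpos : 0 < l := by linarith
  have hinv : 1 / (D : ℝ) ≤ 2 * (1 / (l * l)) := by
    have h1 := one_div_le_one_div_of_le (by positivity) hDl
    rwa [show 1 / (l * l / 2) = 2 * (1 / (l * l)) by field_simp] at h1
  have hq0 : 0 < 1 / (l * l) := by positivity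
  have hql : 1 / (l * l) * l ≤ 1 / 400 := by
    rw [show 1 / (l * l) * l = 1 / l by field_simp]
    exact one_div_le_one_div_of_le (by norm_num) hl
  have hDi : 0 < 1 / (D : ℝ) := by positivity
  set q := 1 / (l * l)
  have e1 : ((χ.LFunction 1).re + 2 / D) * (5 * l + Real.eulerMascheroniConstant) ≤
      (5 * q) * (6 * l) := by
    have h1 : (χ.LFunction 1).re + 2 / D ≤ 5 * q := by
      have : 2 / (D : ℝ) = 2 * (1 / D) := by ring
      linarith
    exact (mul_le_mul_of_nonneg_right h1 (by linarith)).trans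
      (mul_le_mul_of_nonneg_left (by linarith) (by linarith))
  have e2 : (3 + 10 * l) / D ≤ (11 * l) * (2 * q) := by
    rw [div_eq_mul_one_div]
    exact mul_le_mul (by linarith) hinv hDi.le (by linarith)
  have hφ : (1 : ℝ) ≤ D / Nat.totient D := by
    rw [one_le_div (by exact_mod_cast Nat.totient_pos.2 (by omega))]
    exact_mod_cast Nat.totient_le D
  rw [mul_div_assoc]
  linarith

end
end

section
/- There is a positive absolute constant C such that the following holds. If Assumption (A) holds, then for every complex number s with α ≤ |s − 1| ≤ 10α, one has |L(s,χ) − L'(1,χ)·(s − 1)| ≤ C·𝓛^{-15}, where α = π/log P and L'(1,χ) is the derivative of L(s,χ) at s = 1. -/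
open scoped Classical

noncomputable section

/-- Second-order Taylor bound from a uniform bound on a ball. -/
lemma taylor_two_bound (f : ℂ → ℂ) (hf : Differentiable ℂ f) (c : ℂ) (M r ρ : ℝ)
    (hr : 0 < r) (hρ : ρ ≤ r) (hM : ∀ z, ‖z - c‖ ≤ 3 * r → ‖f z‖ ≤ M) (s : ℂ) (hs : ‖s - c‖ ≤ ρ) :
    ‖f s - f c - deriv f c * (s - c)‖ ≤ M / r ^ 2 * ρ ^ 2 := by
  have hM0 : 0 ≤ M := (norm_nonneg _).trans (hM c (by simpa using by positivity))
  have hρ0 : 0 ≤ ρ := (norm_nonneg _).trans hs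
  have h1 : ∀ z, ‖z - c‖ ≤ 2 * r → ‖deriv f z‖ ≤ M / r := by
    intro z hz
    refine Complex.norm_deriv_le_of_forall_mem_sphere_norm_le hr hf.diffContOnCl ?_
    intro w hw
    apply hM
    have hw' : ‖w - z‖ = r := by simpa [dist_eq_norm] using hw
    calc ‖w - c‖ = ‖(w - z) + (z - c)‖ := by congr 1; ring
      _ ≤ ‖w - z‖ + ‖z - c‖ := norm_add_le _ _
      _ ≤ 3 * r := by linarith
  have hf' : Differentiable ℂ (deriv f) := hf.deriv
  have h2 : ∀ z, ‖z - c‖ ≤ r → ‖deriv (deriv f) z‖ ≤ M / r ^ 2 := by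
    intro z hz
    have : ‖deriv (deriv f) z‖ ≤ (M / r) / r := by
      refine Complex.norm_deriv_le_of_forall_mem_sphere_norm_le hr hf'.diffContOnCl ?_
      intro w hw
      apply h1
      have hw' : ‖w - z‖ = r := by simpa [dist_eq_norm] using hw
      calc ‖w - c‖ = ‖(w - z) + (z - c)‖ := by congr 1; ring
        _ ≤ ‖w - z‖ + ‖z - c‖ := norm_add_le _ _
        _ ≤ 2 * r := by linarith
    rwa [div_div, ← sq] at this
  have hcv : Convex ℝ (Metric.closedBall c ρ) := convex_closedBall c ρ
  have hcm : c ∈ Metric.closedBall c ρ := by simpa using hρ0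
  have hsm : s ∈ Metric.closedBall c ρ := by simpa [dist_eq_norm] using hs
  have h3 : ∀ z ∈ Metric.closedBall c ρ, ‖deriv f z - deriv f c‖ ≤ M / r ^ 2 * ρ := by
    intro z hz
    have hz' : ‖z - c‖ ≤ ρ := by simpa [dist_eq_norm] using hz
    have := Convex.norm_image_sub_le_of_norm_deriv_le (f := deriv f) (C := M / r ^ 2)
      (fun x _ => hf' x) (fun x hx => h2 x (by
        have : ‖x - c‖ ≤ ρ := by simpa [dist_eq_norm] using hx
        linarith)) hcv hcm hz
    exact this.trans (by gcongr)
  have h4 := Convex.norm_image_sub_le_of_norm_hasDerivWithin_le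
      (f := fun z => f z - deriv f c * z) (f' := fun z => deriv f z - deriv f c)
      (C := M / r ^ 2 * ρ) (s := Metric.closedBall c ρ)
      (fun x _ => by
        have := ((hf x).hasDerivAt.fun_sub ((hasDerivAt_id x).const_mul (deriv f c))).hasDerivWithinAt
          (s := Metric.closedBall c ρ)
        simpa using this) h3 hcv hcm hsm
  have e : f s - f c - deriv f c * (s - c) = (f s - deriv f c * s) - (f c - deriv f c * c) := by ring
  rw [e]
  refine h4.trans ?_
  rw [sq ρ, ← mul_assoc]
  gcongr

/-- Nonnegativity of `L(1,χ)` for real nontrivial `χ`. -/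
lemma LFunction_one_nonneg {D : ℕ} [NeZero D] (χ : DirichletCharacter ℂ D)
    (hreal : ∀ a : ZMod D, (χ a).im = 0) (hχ : χ ≠ 1) :
    (DirichletCharacter.LFunction χ 1).im = 0 ∧ 0 ≤ (DirichletCharacter.LFunction χ 1).re := by
  open scoped ComplexOrder in
  have key : ∀ x : ℝ, 1 < x → 0 ≤ DirichletCharacter.LFunction χ (x : ℂ) := by
    intro x hx
    rw [DirichletCharacter.LFunction_eq_LSeries χ (by simpa using hx)]
    have hp := DirichletCharacter.LSeries_eulerProduct_hasProd χ (s := (x : ℂ)) (by simpa using hx)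
    refine ge_of_tendsto' hp (fun S => Finset.prod_nonneg fun p _ => ?_)
    have hpp : (1 : ℝ) < (p : ℕ) := by exact_mod_cast p.2.one_lt
    have e1 : χ ((p : ℕ) : ZMod D) = (((χ ((p : ℕ) : ZMod D)).re : ℝ) : ℂ) := by
      apply Complex.ext <;> simp [hreal]
    have e2 : (((p : ℕ) : ℂ)) ^ (-(x : ℂ)) = ((((p : ℕ) : ℝ) ^ (-x) : ℝ) : ℂ) := by
      rw [Complex.ofReal_cpow (by positivity)]; simp
    rw [e1, e2]
    have hle : |(χ ((p : ℕ) : ZMod D)).re| ≤ 1 :=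
      (Complex.abs_re_le_norm _).trans (χ.norm_le_one _)
    have hle2 : (((p : ℕ) : ℝ) ^ (-x) : ℝ) ≤ 1 := Real.rpow_le_one_of_one_le_of_nonpos hpp.le (by linarith)
    have hge2 : 0 ≤ (((p : ℕ) : ℝ) ^ (-x) : ℝ) := by positivity
    have : (0 : ℝ) ≤ (1 - (χ ((p : ℕ) : ZMod D)).re * ((p : ℕ) : ℝ) ^ (-x))⁻¹ := by
      rw [inv_nonneg]
      have := (abs_le.1 hle).2
      nlinarith
    exact_mod_cast this
  open scoped ComplexOrder in
  have h0 : 0 ≤ DirichletCharacter.LFunction χ 1 := by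
    have hc : Filter.Tendsto (fun x : ℝ => DirichletCharacter.LFunction χ (x : ℂ))
        (nhdsWithin 1 (Set.Ioi 1)) (nhds (DirichletCharacter.LFunction χ 1)) := by
      have : Continuous (fun x : ℝ => DirichletCharacter.LFunction χ (x : ℂ)) :=
        (DirichletCharacter.differentiable_LFunction hχ).continuous.comp Complex.continuous_ofReal
      simpa using (this.tendsto 1).mono_left nhdsWithin_le_nhds
    refine ge_of_tendsto hc ?_
    filter_upwards [self_mem_nhdsWithin] with x hx using key x hx
  rw [Complex.le_def] at h0
  exact ⟨h0.2.symm, h0.1⟩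

/-- Sum of a nontrivial character over a block. -/
lemma block_sum_zero {D : ℕ} [NeZero D] (χ : DirichletCharacter ℂ D) (hχ : χ ≠ 1) (k : ℕ) :
    ∑ j ∈ Finset.range D, χ ((k * D + j + 1 : ℕ) : ZMod D) = 0 := by
  have h1 : ∑ j ∈ Finset.range D, χ ((k * D + j + 1 : ℕ) : ZMod D) = ∑ a : ZMod D, χ (a + 1) := by
    refine Finset.sum_bij' (fun j _ => (j : ZMod D)) (fun a _ => a.val) ?_ ?_ ?_ ?_ ?_
    · simp
    · intro a _; simpa using ZMod.val_lt a
    · intro j hj; exact ZMod.val_cast_of_lt (by simpa using hj)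
    · intro a _; simp
    · intro j _; simp
  rw [h1, Fintype.sum_equiv (Equiv.addRight (1 : ZMod D)) (fun a => χ (a + 1)) (fun a => χ a)
    (fun a => by simp)]
  exact MulChar.sum_eq_zero_of_ne_one hχ

/-- Difference of powers. -/
lemma cpow_diff_bound (s : ℂ) (hs : 0 < s.re) (c a b : ℝ) (hc : 0 < c) (hca : c ≤ a) (hab : a ≤ b) :
    ‖(a : ℂ) ^ (-s) - (b : ℂ) ^ (-s)‖ ≤ ‖s‖ * c ^ (-s.re - 1) * (b - a) := by
  have hs0 : s ≠ 0 := by rintro rfl; simp at hs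
  have h := norm_image_sub_le_of_norm_deriv_le_segment' (f := fun y : ℝ => (y : ℂ) ^ (-s))
    (f' := fun y : ℝ => (-s) * (y : ℂ) ^ (-s - 1)) (a := a) (b := b) (C := ‖s‖ * c ^ (-s.re - 1))
    (fun x hx => (hasDerivAt_ofReal_cpow_const (by linarith [hx.1]) (by simpa)).hasDerivWithinAt)
    (fun x hx => by
      have hx0 : 0 < x := by linarith [hx.1]
      rw [norm_mul, norm_neg, Complex.norm_cpow_eq_rpow_re_of_pos hx0]
      simp only [Complex.sub_re, Complex.neg_re, Complex.one_re]
      gcongr ‖s‖ * ?_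
      exact Real.rpow_le_rpow_of_nonpos hc (by linarith [hx.1]) (by linarith)) b ⟨hab, le_rfl⟩
  rw [norm_sub_rev]
  exact h

/-- The `k`-th block, with the mean subtracted. -/
def blk {D : ℕ} (χ : DirichletCharacter ℂ D) (k : ℕ) (s : ℂ) : ℂ :=
  ∑ j ∈ Finset.range D, χ ((k * D + j + 1 : ℕ) : ZMod D) *
    ((((k * D + j + 1 : ℕ) : ℝ) : ℂ) ^ (-s) - ((((k + 1) * D : ℕ) : ℝ) : ℂ) ^ (-s))

/-- The head: first `D` terms. -/
def hd {D : ℕ} (χ : DirichletCharacter ℂ D) (s : ℂ) : ℂ :=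
  ∑ j ∈ Finset.range D, χ ((j + 1 : ℕ) : ZMod D) * (((j + 1 : ℕ) : ℝ) : ℂ) ^ (-s)

lemma re_bounds {s : ℂ} {r : ℝ} (hs : ‖s - 1‖ ≤ r) : 1 - r ≤ s.re ∧ s.re ≤ 1 + r := by
  have h := (Complex.abs_re_le_norm (s - 1)).trans hs
  simp only [Complex.sub_re, Complex.one_re] at h
  rw [abs_le] at h
  constructor <;> linarith [h.1, h.2]

lemma blk_bound {D : ℕ} [NeZero D] (χ : DirichletCharacter ℂ D) (k : ℕ) (s : ℂ) (r : ℝ)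
    (hr : r ≤ 1 / 2) (hs : ‖s - 1‖ ≤ r) :
    ‖blk χ (k + 1) s‖ ≤ 2 * (D : ℝ) ^ r * ((k + 1 : ℕ) : ℝ) ^ (-(3 / 2) : ℝ) := by
  obtain ⟨h1, h2⟩ := re_bounds hs
  have hD : (1 : ℝ) ≤ D := by exact_mod_cast NeZero.one_le
  have hD0 : (0 : ℝ) < D := by linarith
  have hk : (1 : ℝ) ≤ ((k + 1 : ℕ) : ℝ) := by push_cast; linarith [Nat.cast_nonneg (α := ℝ) k]
  have hk0 : (0 : ℝ) < ((k + 1 : ℕ) : ℝ) := by linarith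
  have hns : ‖s‖ ≤ 2 := by
    calc ‖s‖ = ‖(s - 1) + 1‖ := by congr 1; ring
      _ ≤ ‖s - 1‖ + ‖(1 : ℂ)‖ := norm_add_le _ _
      _ ≤ 2 := by simp; linarith
  have hterm : ∀ j ∈ Finset.range D, ‖χ (((k + 1) * D + j + 1 : ℕ) : ZMod D) *
    (((((k + 1) * D + j + 1 : ℕ) : ℝ) : ℂ) ^ (-s) - ((((k + 1 + 1) * D : ℕ) : ℝ) : ℂ) ^ (-s))‖
      ≤ 2 * (((k + 1 : ℕ) : ℝ) * D) ^ (-s.re - 1) * D := by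
    intro j hj
    have hj' : j + 1 ≤ D := Finset.mem_range.1 hj
    rw [norm_mul]
    have hle : (((k + 1) * D + j + 1 : ℕ) : ℝ) ≤ (((k + 1 + 1) * D : ℕ) : ℝ) := by
      have : (k + 1) * D + j + 1 ≤ (k + 1 + 1) * D := by
        have : (k + 1 + 1) * D = (k + 1) * D + D := by ring
        omega
      exact_mod_cast this
    have hc := cpow_diff_bound s (by linarith) (((k + 1 : ℕ) : ℝ) * D)
      (((k + 1) * D + j + 1 : ℕ) : ℝ) (((k + 1 + 1) * D : ℕ) : ℝ) (by positivity)
      (by push_cast; linarith [Nat.cast_nonneg (α := ℝ) j])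
      hle
    have hpos : 0 ≤ (((k + 1 : ℕ) : ℝ) * D) ^ (-s.re - 1) := by positivity
    calc _ ≤ 1 * (‖s‖ * (((k + 1 : ℕ) : ℝ) * D) ^ (-s.re - 1) *
            ((((k + 1 + 1) * D : ℕ) : ℝ) - (((k + 1) * D + j + 1 : ℕ) : ℝ))) := by
            gcongr
            exact χ.norm_le_one _
      _ ≤ 1 * (2 * (((k + 1 : ℕ) : ℝ) * D) ^ (-s.re - 1) * D) := by
            have : ((((k + 1 + 1) * D : ℕ) : ℝ) - (((k + 1) * D + j + 1 : ℕ) : ℝ)) ≤ D := by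
              push_cast; linarith [Nat.cast_nonneg (α := ℝ) j]
            rw [one_mul, one_mul]
            exact mul_le_mul (mul_le_mul_of_nonneg_right hns hpos) this (sub_nonneg.2 hle)
              (by positivity)
      _ = _ := one_mul _
  have := (norm_sum_le _ _).trans (Finset.sum_le_card_nsmul _ _ _ hterm)
  refine this.trans ?_
  rw [Finset.card_range, nsmul_eq_mul, Real.mul_rpow hk0.le hD0.le]
  have e : (D : ℝ) * (2 * (((k + 1 : ℕ) : ℝ) ^ (-s.re - 1) * (D : ℝ) ^ (-s.re - 1)) * D)
      = 2 * (D : ℝ) ^ (1 - s.re) * ((k + 1 : ℕ) : ℝ) ^ (-s.re - 1) := by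
    have : (D : ℝ) ^ (1 - s.re) = (D : ℝ) ^ (-s.re - 1) * D * D := by
      rw [show (1 - s.re) = (-s.re - 1) + 1 + 1 by ring, Real.rpow_add hD0, Real.rpow_add hD0,
        Real.rpow_one]
    rw [this]; ring
  rw [e]
  have a1 : (D : ℝ) ^ (1 - s.re) ≤ (D : ℝ) ^ r :=
    Real.rpow_le_rpow_of_exponent_le hD (by linarith)
  have a2 : ((k + 1 : ℕ) : ℝ) ^ (-s.re - 1) ≤ ((k + 1 : ℕ) : ℝ) ^ (-(3 / 2) : ℝ) :=
    Real.rpow_le_rpow_of_exponent_le hk (by linarith)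
  gcongr

lemma summable_three_halves : Summable (fun k : ℕ => ((k + 1 : ℕ) : ℝ) ^ (-(3 / 2) : ℝ)) :=
  (summable_nat_add_iff 1).2 (Real.summable_nat_rpow.2 (by norm_num))

lemma diff_cpow_aux (x : ℝ) (hx : x ≠ 0) : Differentiable ℂ (fun s : ℂ => (x : ℂ) ^ (-s)) := by
  intro s
  exact (differentiableAt_id.neg).const_cpow (Or.inl (by exact_mod_cast hx))

lemma blk_diff {D : ℕ} [NeZero D] (χ : DirichletCharacter ℂ D) (k : ℕ) :
    Differentiable ℂ (blk χ k) := by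
  unfold blk
  refine Differentiable.fun_sum fun j _ => ?_
  refine Differentiable.const_mul ((diff_cpow_aux _ ?_).sub (diff_cpow_aux _ ?_)) _
  · positivity
  · have := NeZero.ne D
    exact_mod_cast by positivity

lemma hd_diff {D : ℕ} [NeZero D] (χ : DirichletCharacter ℂ D) :
    Differentiable ℂ (hd χ) := by
  unfold hd
  refine Differentiable.fun_sum fun j _ => ?_
  refine Differentiable.const_mul (diff_cpow_aux _ ?_) _
  positivity

lemma LF_eq_of_one_lt {D : ℕ} [NeZero D] (χ : DirichletCharacter ℂ D) (hχ : χ ≠ 1) (s : ℂ)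
    (hs : 1 < s.re) (hb : Summable (fun k => blk χ (k + 1) s)) :
    DirichletCharacter.LFunction χ s = hd χ s + ∑' k, blk χ (k + 1) s := by
  rw [DirichletCharacter.LFunction_eq_LSeries χ hs]
  set g : ℕ → ℂ := fun n => χ ((n + 1 : ℕ) : ZMod D) * (((n + 1 : ℕ) : ℝ) : ℂ) ^ (-s) with hg
  have h1 : HasSum g (LSeries (fun n => χ (n : ZMod D)) s) := by
    have := (ZMod.LSeriesSummable_of_one_lt_re χ hs).hasSum
    rw [← hasSum_nat_add_iff' 1] at this
    simp only [Finset.range_one, Finset.sum_singleton, LSeries.term_zero, sub_zero] at this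
    have e : g = fun n => LSeries.term (fun x => χ (x : ZMod D)) s (n + 1) := by
      funext n
      simp only [hg, LSeries.term_of_ne_zero (Nat.succ_ne_zero n), div_eq_mul_inv]
      rw [Complex.cpow_neg]
      simp
    rw [e]
    exact this
  have hblk : ∀ k, ∑ j ∈ Finset.range D, g (k * D + j) = blk χ k s := by
    intro k
    unfold blk
    simp only [mul_sub, Finset.sum_sub_distrib, ← Finset.sum_mul, block_sum_zero χ hχ k, zero_mul,
      sub_zero, hg]
  have hpart : ∀ N, ∑ n ∈ Finset.range ((N + 1) * D), g n
      = hd χ s + ∑ k ∈ Finset.range N, blk χ (k + 1) s := by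
    intro N
    induction N with
    | zero => simp [hd, hg]
    | succ N ih =>
      rw [show (N + 1 + 1) * D = (N + 1) * D + D by ring, Finset.sum_range_add, ih, hblk,
        Finset.sum_range_succ, add_assoc]
  have t1 : Filter.Tendsto (fun N => ∑ n ∈ Finset.range ((N + 1) * D), g n) Filter.atTop
      (nhds (LSeries (fun n => χ (n : ZMod D)) s)) := by
    refine h1.tendsto_sum_nat.comp (Filter.tendsto_atTop_mono (fun N => ?_) Filter.tendsto_id)
    have : 1 ≤ D := NeZero.one_le
    simp only [id]
    nlinarith
  have t2 : Filter.Tendsto (fun N => ∑ n ∈ Finset.range ((N + 1) * D), g n) Filter.atTop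
      (nhds (hd χ s + ∑' k, blk χ (k + 1) s)) := by
    simp only [hpart]
    exact hb.hasSum.tendsto_sum_nat.const_add _
  exact tendsto_nhds_unique t1 t2

lemma blk_summable {D : ℕ} [NeZero D] (χ : DirichletCharacter ℂ D) (s : ℂ)
    (hs : ‖s - 1‖ ≤ 1 / 2) : Summable (fun k => blk χ (k + 1) s) :=
  Summable.of_norm_bounded (summable_three_halves.mul_left _)
    (fun k => blk_bound χ k s (1 / 2) le_rfl hs)

lemma LF_eq {D : ℕ} [NeZero D] (χ : DirichletCharacter ℂ D) (hχ : χ ≠ 1) (s : ℂ)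
    (hs : ‖s - 1‖ < 1 / 2) :
    DirichletCharacter.LFunction χ s = hd χ s + ∑' k, blk χ (k + 1) s := by
  have hmem : ∀ z : ℂ, z ∈ Metric.ball (1 : ℂ) (1 / 2) ↔ ‖z - 1‖ < 1 / 2 := by
    intro z; rw [Metric.mem_ball, dist_eq_norm]
  have hA : AnalyticOnNhd ℂ (DirichletCharacter.LFunction χ) (Metric.ball 1 (1 / 2)) :=
    (DirichletCharacter.differentiable_LFunction hχ).differentiableOn.analyticOnNhd
      Metric.isOpen_ball
  have hB : AnalyticOnNhd ℂ (fun z => hd χ z + ∑' k, blk χ (k + 1) z) (Metric.ball 1 (1 / 2)) := by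
    refine DifferentiableOn.analyticOnNhd ?_ Metric.isOpen_ball
    refine (hd_diff χ).differentiableOn.fun_add ?_
    exact Complex.differentiableOn_tsum_of_summable_norm (summable_three_halves.mul_left _)
      (fun k => (blk_diff χ (k + 1)).differentiableOn) Metric.isOpen_ball
      (fun k z hz => blk_bound χ k z (1 / 2) le_rfl ((hmem z).1 hz).le)
  have h54 : (5 / 4 : ℂ) ∈ Metric.ball (1 : ℂ) (1 / 2) := by
    rw [hmem]; norm_num
  refine hA.eqOn_of_preconnected_of_eventuallyEq hB (convex_ball _ _).isPreconnected h54 ?_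
    ((hmem s).2 hs)
  have o1 : {z : ℂ | 1 < z.re} ∈ nhds (5 / 4 : ℂ) :=
    (isOpen_lt continuous_const Complex.continuous_re).mem_nhds (by norm_num)
  filter_upwards [o1, Metric.isOpen_ball.mem_nhds h54] with z hz1 hz2
  exact LF_eq_of_one_lt χ hχ z hz1 (blk_summable χ z ((hmem z).1 hz2).le)

lemma hd_bound {D : ℕ} [NeZero D] (χ : DirichletCharacter ℂ D) (s : ℂ) (r : ℝ) (hr : 0 ≤ r)
    (hs : ‖s - 1‖ ≤ r) : ‖hd χ s‖ ≤ (D : ℝ) ^ r * (1 + Real.log D) := by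
  obtain ⟨h1, h2⟩ := re_bounds hs
  have hh : ((harmonic D : ℚ) : ℝ) = ∑ j ∈ Finset.range D, ((j + 1 : ℕ) : ℝ)⁻¹ := by
    simp [harmonic]
  refine le_trans ?_ (mul_le_mul_of_nonneg_left (harmonic_le_one_add_log D) (by positivity))
  rw [hh, Finset.mul_sum]
  refine (norm_sum_le _ _).trans (Finset.sum_le_sum fun j hj => ?_)
  have hj' : j + 1 ≤ D := Finset.mem_range.1 hj
  have hj1 : (1 : ℝ) ≤ ((j + 1 : ℕ) : ℝ) := by exact_mod_cast Nat.succ_le_succ (Nat.zero_le j)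
  have hj0 : (0 : ℝ) < ((j + 1 : ℕ) : ℝ) := by linarith
  rw [norm_mul, Complex.norm_cpow_eq_rpow_re_of_pos hj0]
  calc _ ≤ 1 * ((j + 1 : ℕ) : ℝ) ^ (-s).re := by gcongr; exact χ.norm_le_one _
    _ = ((j + 1 : ℕ) : ℝ) ^ (-s.re) := by simp
    _ ≤ ((j + 1 : ℕ) : ℝ) ^ (r + -1) := Real.rpow_le_rpow_of_exponent_le hj1 (by linarith)
    _ = ((j + 1 : ℕ) : ℝ) ^ r * ((j + 1 : ℕ) : ℝ)⁻¹ := by rw [Real.rpow_add hj0, Real.rpow_neg_one]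
    _ ≤ (D : ℝ) ^ r * ((j + 1 : ℕ) : ℝ)⁻¹ := by gcongr

/-- `L(s,χ) ≪ log D` near `1`. -/
lemma LF_bound {D : ℕ} [NeZero D] (χ : DirichletCharacter ℂ D) (hχ : χ ≠ 1)
    (hL : 4 ≤ Real.log D) (s : ℂ) (hs : ‖s - 1‖ ≤ 1 / Real.log D) :
    ‖DirichletCharacter.LFunction χ s‖ ≤
      Real.exp 1 * (2 + 2 * ∑' k : ℕ, ((k + 1 : ℕ) : ℝ) ^ (-(3 / 2) : ℝ)) * Real.log D := by
  set K := ∑' k : ℕ, ((k + 1 : ℕ) : ℝ) ^ (-(3 / 2) : ℝ) with hK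
  have hK0 : 0 ≤ K := tsum_nonneg fun k => by positivity
  have hr : 1 / Real.log D ≤ 1 / 4 := by gcongr
  have hD0 : (0 : ℝ) < D := by exact_mod_cast Nat.pos_of_ne_zero (NeZero.ne D)
  have hDr : (D : ℝ) ^ (1 / Real.log D) = Real.exp 1 := by
    rw [Real.rpow_def_of_pos hD0]; congr 1; field_simp
  rw [LF_eq χ hχ s (by linarith)]
  have b1 := hd_bound χ s _ (by positivity) hs
  have b2 : ‖∑' k, blk χ (k + 1) s‖ ≤ 2 * (D : ℝ) ^ (1 / Real.log D) * K :=
    tsum_of_norm_bounded (summable_three_halves.hasSum.mul_left _)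
      (fun k => blk_bound χ k s _ (by linarith) hs)
  rw [hDr] at b1 b2
  refine (norm_add_le _ _).trans ((add_le_add b1 b2).trans ?_)
  have he := Real.exp_pos 1
  have : 1 + Real.log D + 2 * K ≤ (2 + 2 * K) * Real.log D := by nlinarith
  nlinarith

/-- Under (A), for `α ≤ |s - 1| ≤ 10α`,
`|L(s,χ) - L'(1,χ)(s-1)| ≤ C 𝓛^{-15}`. -/
theorem statement17 :
    ∃ C : ℝ, 0 < C ∧ ∃ D₀ : ℕ, ∀ D : ℕ, D₀ ≤ D → ∀ χ : DirichletCharacter ℂ D,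
      IsRealChar χ → χ.IsPrimitive → AssumptionA D χ →
        ∀ s : ℂ, alphaD D ≤ ‖s - 1‖ → ‖s - 1‖ ≤ 10 * alphaD D →
          ‖Lfun χ s - deriv (Lfun χ) 1 * (s - 1)‖ ≤ C * bigL D ^ (-15 : ℤ) := by
  set A := Real.exp 1 * (2 + 2 * ∑' k : ℕ, ((k + 1 : ℕ) : ℝ) ^ (-(3 / 2) : ℝ)) with hA
  have hA0 : 0 ≤ A := mul_nonneg (Real.exp_pos 1).le
    (add_nonneg (by norm_num) (mul_nonneg (by norm_num) (tsum_nonneg fun k => by positivity)))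
  refine ⟨1 + A * 9 * (10 * Real.pi) ^ 2, by positivity, ⌈Real.exp 4⌉₊, ?_⟩
  intro D hD χ hreal hprim hAss s _ hs
  have hD4 : Real.exp 4 ≤ D := Nat.ceil_le.1 hD
  have hD0 : (0 : ℝ) < D := (Real.exp_pos 4).trans_le hD4
  have hDne : D ≠ 0 := by rintro rfl; simp at hD0
  have : NeZero D := ⟨hDne⟩
  have hL : 4 ≤ Real.log D := (Real.le_log_iff_exp_le hD0).2 hD4
  have hχ : χ ≠ 1 := by
    rintro rfl
    have h1 : D = 1 := by
      have := DirichletCharacter.conductor_one (R := ℂ) (n := D)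
      rw [(DirichletCharacter.isPrimitive_def _).1 hprim] at this
      exact this
    rw [h1] at hL; norm_num at hL
  have hLf : Lfun χ = DirichletCharacter.LFunction χ := by
    funext z; simp [Lfun, hDne]
  unfold AssumptionA at hAss
  rw [hLf] at hAss ⊢
  unfold bigL at hAss ⊢
  have hal : alphaD D = Real.pi / Real.log D ^ 9 := by simp [alphaD, bigP, bigL]
  set l := Real.log D with hl
  have hl0 : 0 < l := by linarith
  obtain ⟨him, hre⟩ := LFunction_one_nonneg χ hreal hχ
  have hL1 : ‖DirichletCharacter.LFunction χ 1‖ ≤ l ^ (-15 : ℤ) := by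
    have e : DirichletCharacter.LFunction χ 1 = ((DirichletCharacter.LFunction χ 1).re : ℂ) := by
      apply Complex.ext <;> simp [him]
    rw [e, Complex.norm_real, Real.norm_of_nonneg hre]
    exact hAss.le.trans (zpow_le_zpow_right₀ (by linarith) (by norm_num))
  have hρ : 10 * alphaD D ≤ 1 / (3 * l) := by
    rw [hal, ← mul_div_assoc, div_le_div_iff₀ (by positivity) (by positivity)]
    have h8 : (4 : ℝ) ^ 8 ≤ l ^ 8 := by gcongr
    have := Real.pi_lt_four
    have : 10 * Real.pi * 3 ≤ l ^ 8 := by norm_num at h8; linarith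
    calc 10 * Real.pi * (3 * l) = 10 * Real.pi * 3 * l := by ring
      _ ≤ l ^ 8 * l := by gcongr
      _ = 1 * l ^ 9 := by ring
  have hT := taylor_two_bound _ (DirichletCharacter.differentiable_LFunction hχ) 1 (A * l)
    (1 / (3 * l)) (10 * alphaD D) (by positivity) hρ
    (fun z hz => LF_bound χ hχ hL z (hz.trans (le_of_eq (by rw [← hl]; field_simp)))) s hs
  have e : A * l / (1 / (3 * l)) ^ 2 * (10 * alphaD D) ^ 2
      = A * 9 * (10 * Real.pi) ^ 2 * l ^ (-15 : ℤ) := by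
    rw [hal, show (-15 : ℤ) = -((15 : ℕ) : ℤ) by norm_num, zpow_neg, zpow_natCast]
    field_simp
    ring
  rw [e] at hT
  calc _ = ‖(DirichletCharacter.LFunction χ s - DirichletCharacter.LFunction χ 1
        - deriv (DirichletCharacter.LFunction χ) 1 * (s - 1))
        + DirichletCharacter.LFunction χ 1‖ := by congr 1; ring
    _ ≤ _ := norm_add_le _ _
    _ ≤ A * 9 * (10 * Real.pi) ^ 2 * l ^ (-15 : ℤ) + l ^ (-15 : ℤ) := add_le_add hT hL1
    _ = _ := by ring

end
end
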